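/- There is an absolute constant C > 0 such that for all real parameters 1 ≤ w < y, every real α with 1/2 < α < 1, and every real x with y ≤ x, one has ∑_{n ≤ x} Δ(n)²·n^{1−2α} ≤ C·(log(x/w)/log(y/w))·x^{2−2α}. -/

import Mathlib

open scoped BigOperators

/-- The Selberg weight profile `m(d)`: equal to `1` for `d ≤ w`, to
`log(y/d)/log(y/w)` for `w ≤ d ≤ y`, and to `0` for `d > y`. -/
noncomputable def selbergM (w y : ℝ) (d : ℕ) : ℝ :=
  if (d : ℝ) ≤ w then 1
  else if (d : ℝ) ≤ y then Real.log (y / d) / Real.log (y / w)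
  else 0

/-- The Selberg weight `λ_d = μ(d)·m(d)`. -/
noncomputable def selbergLambda (w y : ℝ) (d : ℕ) : ℝ :=
  ((ArithmeticFunction.moebius d : ℤ) : ℝ) * selbergM w y d

/-- `Δ(n) = ∑_{d ∣ n} λ_d`. -/
noncomputable def selbergDelta (w y : ℝ) (n : ℕ) : ℝ :=
  ∑ d ∈ n.divisors, selbergLambda w y d

open Filter Topology MeasureTheory

/-- One step of the Euler–Maclaurin comparison between `∑ n ^ (-s)` and its integral. -/
lemma norm_natCast_cpow_neg_sub_le {s : ℂ} (hs : 1 < s.re) {n : ℕ} (hn : 0 < n) :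
    ‖(n : ℂ) ^ (-s) -
      ((n : ℂ) ^ (1 - s) / (s - 1) - ((n + 1 : ℕ) : ℂ) ^ (1 - s) / (s - 1))‖ ≤
      ‖s‖ * ((n : ℝ) ^ 2)⁻¹ := by
  have hn0 : (0 : ℝ) < n := by exact_mod_cast hn
  have hn1 : (1 : ℝ) ≤ n := by exact_mod_cast hn
  have hs1 : s - 1 ≠ 0 := by
    intro h; rw [sub_eq_zero] at h; simp [h] at hs
  have hs0 : s ≠ 0 := by
    intro h; simp [h] at hs; linarith
  have hpow : ∀ u ∈ Set.Icc (n : ℝ) (n + 1),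
      ‖((n : ℝ) : ℂ) ^ (-s) - (u : ℂ) ^ (-s)‖ ≤ ‖s‖ * ((n : ℝ) ^ 2)⁻¹ := by
    intro u hu
    have key := norm_image_sub_le_of_norm_deriv_le_segment' (a := (n : ℝ)) (b := n + 1)
      (f := fun x : ℝ => (x : ℂ) ^ (-s)) (f' := fun x : ℝ => -s * (x : ℂ) ^ (-s - 1))
      (C := ‖s‖ * ((n : ℝ) ^ 2)⁻¹)
      (fun x hx => (hasDerivAt_ofReal_cpow_const (by linarith [hx.1])
        (neg_ne_zero.mpr hs0)).hasDerivWithinAt)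
      (fun x hx => by
        have hx0 : 0 < x := by linarith [hx.1]
        rw [norm_mul, norm_neg, Complex.norm_cpow_eq_rpow_re_of_pos hx0]
        gcongr
        have : (-s - 1).re = -(s.re + 1) := by simp; ring
        rw [this, Real.rpow_neg hx0.le]
        gcongr
        calc (n : ℝ) ^ 2 = (n : ℝ) ^ (2 : ℝ) := by norm_cast
          _ ≤ (n : ℝ) ^ (s.re + 1) := Real.rpow_le_rpow_of_exponent_le hn1 (by linarith)
          _ ≤ x ^ (s.re + 1) := Real.rpow_le_rpow hn0.le hx.1 (by linarith)) u hu
    rw [norm_sub_rev]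
    refine key.trans ?_
    have : u - n ≤ 1 := by linarith [hu.2]
    exact mul_le_of_le_one_right (by positivity) this
  have key := norm_image_sub_le_of_norm_deriv_le_segment' (a := (n : ℝ)) (b := n + 1)
      (f := fun x : ℝ => ((n : ℝ) : ℂ) ^ (-s) * ((x : ℂ) - n) + (x : ℂ) ^ (1 - s) / (s - 1))
      (f' := fun x : ℝ => ((n : ℝ) : ℂ) ^ (-s) - (x : ℂ) ^ (-s))
      (C := ‖s‖ * ((n : ℝ) ^ 2)⁻¹)
      (fun x hx => by
        refine HasDerivAt.hasDerivWithinAt ?_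
        have h1 : HasDerivAt (fun y : ℝ => (y : ℂ) ^ (1 - s)) ((1 - s) * (x : ℂ) ^ (1 - s - 1)) x :=
          hasDerivAt_ofReal_cpow_const (by linarith [hx.1])
            (by rw [← neg_sub]; exact neg_ne_zero.mpr hs1)
        have h2 : HasDerivAt (fun y : ℝ => ((n : ℝ) : ℂ) ^ (-s) * ((y : ℂ) - n))
            (((n : ℝ) : ℂ) ^ (-s) * 1) x :=
          ((Complex.ofRealCLM.hasDerivAt (x := x)).sub_const (n : ℂ)).const_mul _
        refine (h2.add (h1.div_const (s - 1))).congr_deriv ?_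
        have : 1 - s - 1 = -s := by ring
        rw [this]
        field_simp
        ring)
      (fun x hx => hpow x ⟨hx.1, hx.2.le⟩) (n + 1) ⟨by linarith, le_rfl⟩
  refine le_trans (le_of_eq ?_) (key.trans (le_of_eq (by ring)))
  congr 1
  push_cast
  ring

/-- Approximation of `ζ` by partial sums on the half-plane of absolute convergence. -/
lemma norm_riemannZeta_sub_sum_le {s : ℂ} (hs : 1 < s.re) {N : ℕ} (hN : 0 < N) :
    ‖riemannZeta s -
      (∑ n ∈ Finset.range N, (n : ℂ) ^ (-s) + (N : ℂ) ^ (1 - s) / (s - 1))‖ ≤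
      2 * ‖s‖ / N := by
  have hsum : Summable fun n : ℕ => (n : ℂ) ^ (-s) := by
    simpa [Complex.cpow_neg] using Complex.summable_one_div_nat_cpow.mpr hs
  have hζ : HasSum (fun n : ℕ => (n : ℂ) ^ (-s)) (riemannZeta s) := by
    rw [zeta_eq_tsum_one_div_nat_cpow hs]
    convert hsum.hasSum using 3 with n
    rw [Complex.cpow_neg, one_div]
  have hK : Tendsto (fun K : ℕ => (K : ℂ) ^ (1 - s) / (s - 1)) atTop (𝓝 0) := by
    rw [← zero_div (s - 1)]
    refine Tendsto.div_const ?_ _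
    rw [tendsto_zero_iff_norm_tendsto_zero]
    have : Tendsto (fun K : ℕ => (K : ℝ) ^ (-(s.re - 1))) atTop (𝓝 0) :=
      (tendsto_rpow_neg_atTop (by linarith)).comp tendsto_natCast_atTop_atTop
    refine this.congr' ?_
    filter_upwards [eventually_gt_atTop 0] with K hK
    rw [Complex.norm_natCast_cpow_of_pos hK]
    congr 1
    simp
  have hlim : Tendsto (fun K : ℕ => ∑ n ∈ Finset.range K, (n : ℂ) ^ (-s) -
      (∑ n ∈ Finset.range N, (n : ℂ) ^ (-s) +
        ((N : ℂ) ^ (1 - s) / (s - 1) - (K : ℂ) ^ (1 - s) / (s - 1)))) atTop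
      (𝓝 (riemannZeta s - (∑ n ∈ Finset.range N, (n : ℂ) ^ (-s) +
        ((N : ℂ) ^ (1 - s) / (s - 1) - 0)))) :=
    hζ.tendsto_sum_nat.sub (tendsto_const_nhds.add (tendsto_const_nhds.sub hK))
  rw [sub_zero] at hlim
  refine le_of_tendsto hlim.norm ?_
  filter_upwards [eventually_ge_atTop N] with K hNK
  have htel : ∑ n ∈ Finset.Ico N K, ((n : ℂ) ^ (1 - s) / (s - 1) -
      ((n + 1 : ℕ) : ℂ) ^ (1 - s) / (s - 1)) =
      (N : ℂ) ^ (1 - s) / (s - 1) - (K : ℂ) ^ (1 - s) / (s - 1) := by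
    have := Finset.sum_Ico_sub (fun n : ℕ => (n : ℂ) ^ (1 - s) / (s - 1)) hNK
    rw [← neg_inj, ← Finset.sum_neg_distrib, neg_sub, ← this]
    exact Finset.sum_congr rfl fun _ _ => by ring
  have heq : ∑ n ∈ Finset.range K, (n : ℂ) ^ (-s) - (∑ n ∈ Finset.range N, (n : ℂ) ^ (-s) +
        ((N : ℂ) ^ (1 - s) / (s - 1) - (K : ℂ) ^ (1 - s) / (s - 1))) =
      ∑ n ∈ Finset.Ico N K, ((n : ℂ) ^ (-s) - ((n : ℂ) ^ (1 - s) / (s - 1) -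
      ((n + 1 : ℕ) : ℂ) ^ (1 - s) / (s - 1))) := by
    rw [Finset.sum_sub_distrib, htel, ← Finset.sum_range_add_sum_Ico _ hNK]
    ring
  rw [heq]
  calc _ ≤ ∑ n ∈ Finset.Ico N K, ‖s‖ * ((n : ℝ) ^ 2)⁻¹ :=
        norm_sum_le_of_le _ fun n hn => norm_natCast_cpow_neg_sub_le hs
          (hN.trans_le (Finset.mem_Ico.mp hn).1)
    _ = ‖s‖ * ∑ n ∈ Finset.Ioo (N - 1) K, ((n : ℝ) ^ 2)⁻¹ := by
        rw [Finset.mul_sum]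
        refine Finset.sum_congr ?_ fun _ _ => rfl
        ext n; simp; omega
    _ ≤ ‖s‖ * (2 / ((N - 1 : ℕ) + 1)) := by
        gcongr
        exact sum_Ioo_inv_sq_le _ _
    _ = 2 * ‖s‖ / N := by
        have : ((N - 1 : ℕ) : ℝ) + 1 = N := by
          norm_cast; omega
        rw [this]; ring

lemma sum_range_inv_le_one_add_log (N : ℕ) :
    ∑ n ∈ Finset.range N, ((n : ℝ))⁻¹ ≤ 1 + Real.log N := by
  rcases N with _ | N
  · simp
  · rw [Finset.sum_range_succ']
    have h := harmonic_le_one_add_log N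
    simp only [harmonic, Rat.cast_sum, Rat.cast_inv, Rat.cast_natCast] at h
    have h2 : Real.log N ≤ Real.log (N + 1 : ℕ) := by
      rcases N with _ | N
      · simp
      · exact Real.log_le_log (by positivity) (by push_cast; linarith)
    simp only [CharP.cast_eq_zero, inv_zero, add_zero]
    linarith

lemma norm_natCast_cpow_neg_sub_cpow_neg_add_le {n : ℕ} (hn : 0 < n) (z : ℂ) {h : ℝ} :
    ‖(n : ℂ) ^ (-z) - (n : ℂ) ^ (-(z + h))‖ ≤ (n : ℝ) ^ (-z.re) * |h| * Real.log n ∨ h < 0 := by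
  rcases lt_or_ge h 0 with h0 | h0
  · exact Or.inr h0
  left
  have hn0 : (n : ℂ) ≠ 0 := by exact_mod_cast hn.ne'
  have hn1 : (1 : ℝ) ≤ n := by exact_mod_cast hn
  have hp : (0 : ℝ) < n := by exact_mod_cast hn
  have e1 : (n : ℂ) ^ (-(z + h)) = (n : ℂ) ^ (-z) * (((n : ℝ) ^ (-h) : ℝ) : ℂ) := by
    rw [neg_add, Complex.cpow_add _ _ hn0, Complex.ofReal_cpow hp.le]
    simp
  have e2 : (n : ℂ) ^ (-z) - (n : ℂ) ^ (-(z + h)) =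
      (n : ℂ) ^ (-z) * ((1 - (n : ℝ) ^ (-h) : ℝ) : ℂ) := by
    rw [e1]; push_cast; ring
  rw [e2, norm_mul, Complex.norm_natCast_cpow_of_pos hn, Complex.norm_real, abs_of_nonneg h0,
    Complex.neg_re, mul_assoc]
  gcongr
  have h3 : (n : ℝ) ^ (-h) ≤ 1 := Real.rpow_le_one_of_one_le_of_nonpos hn1 (by linarith)
  have h4 : 1 - h * Real.log n ≤ (n : ℝ) ^ (-h) := by
    rw [Real.rpow_def_of_pos hp]
    have := Real.add_one_le_exp (Real.log n * -h)
    linarith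
  rw [Real.norm_of_nonneg (by linarith)]
  linarith

lemma one_add_log_ceil_sq_le {τ : ℝ} (hτ : 1 ≤ τ) :
    1 + Real.log (⌈τ ^ 2⌉₊ : ℝ) ≤ 129 * τ ^ (1 / 32 : ℝ) := by
  have h1 : (⌈τ ^ 2⌉₊ : ℝ) ≤ 2 * τ ^ 2 := by
    have := (Nat.ceil_lt_add_one (sq_nonneg τ)).le
    nlinarith
  have h2 := Real.log_le_rpow_div (x := (⌈τ ^ 2⌉₊ : ℝ)) (ε := 1 / 64) (by positivity) (by norm_num)
  have h3 : (⌈τ ^ 2⌉₊ : ℝ) ^ (1 / 64 : ℝ) ≤ 2 * τ ^ (1 / 32 : ℝ) := by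
    calc (⌈τ ^ 2⌉₊ : ℝ) ^ (1 / 64 : ℝ) ≤ (2 * τ ^ 2) ^ (1 / 64 : ℝ) := by gcongr
      _ = 2 ^ (1 / 64 : ℝ) * τ ^ (1 / 32 : ℝ) := by
        rw [Real.mul_rpow (by norm_num) (by positivity), ← Real.rpow_natCast τ 2, ← Real.rpow_mul
          (by linarith)]
        norm_num
      _ ≤ 2 * τ ^ (1 / 32 : ℝ) := by
        gcongr
        calc (2 : ℝ) ^ (1 / 64 : ℝ) ≤ 2 ^ (1 : ℝ) :=
              Real.rpow_le_rpow_of_exponent_le (by norm_num) (by norm_num)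
          _ = 2 := by norm_num
  have h4 : (1 : ℝ) ≤ τ ^ (1 / 32 : ℝ) := Real.one_le_rpow hτ (by norm_num)
  have : (⌈τ ^ 2⌉₊ : ℝ) ^ (1 / 64 : ℝ) / (1 / 64) = 64 * (⌈τ ^ 2⌉₊ : ℝ) ^ (1 / 64 : ℝ) := by ring
  linarith

section
variable {τ : ℝ}

private lemma abs_le_norm_sub_one (δ τ : ℝ) : |τ| ≤ ‖(1 + δ + Complex.I * τ : ℂ) - 1‖ := by
  have := Complex.abs_im_le_norm ((1 + δ + Complex.I * τ : ℂ) - 1)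
  simpa using this

private lemma norm_one_add_le {δ : ℝ} (h0 : 0 < δ) (h1 : δ ≤ 1) (hτ : 1 ≤ τ) :
    ‖(1 + δ + Complex.I * τ : ℂ)‖ ≤ 3 * τ := by
  calc _ ≤ ‖(1 : ℂ)‖ + ‖(δ : ℂ)‖ + ‖Complex.I * (τ : ℂ)‖ := norm_add₃_le
    _ = 1 + δ + τ := by
      rw [norm_one, Complex.norm_real, norm_mul, Complex.norm_I, Complex.norm_real, one_mul,
        Real.norm_of_nonneg h0.le, Real.norm_of_nonneg (by linarith)]
    _ ≤ 3 * τ := by linarith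

private lemma norm_cpow_div_le {δ : ℝ} (h0 : 0 < δ) (hτ : 1 ≤ τ) {N : ℕ} (hN : 0 < N) :
    ‖(N : ℂ) ^ (1 - (1 + δ + Complex.I * τ : ℂ)) / ((1 + δ + Complex.I * τ : ℂ) - 1)‖ ≤ 1 := by
  rw [norm_div, Complex.norm_natCast_cpow_of_pos hN]
  have h1 := abs_le_norm_sub_one δ τ
  rw [abs_of_pos (by linarith)] at h1
  rw [div_le_one (by linarith)]
  refine le_trans ?_ (hτ.trans h1)
  refine Real.rpow_le_one_of_one_le_of_nonpos (by exact_mod_cast hN) ?_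
  simp [h0.le]

private lemma tail_le {δ : ℝ} (h0 : 0 < δ) (h1 : δ ≤ 1) (hτ : 1 ≤ τ) :
    2 * ‖(1 + δ + Complex.I * τ : ℂ)‖ / (⌈τ ^ 2⌉₊ : ℝ) ≤ 6 / τ := by
  have := norm_one_add_le h0 h1 hτ
  have h2 : τ ^ 2 ≤ (⌈τ ^ 2⌉₊ : ℝ) := Nat.le_ceil _
  calc _ ≤ 2 * (3 * τ) / τ ^ 2 := by gcongr
    _ = 6 / τ := by field_simp; norm_num

lemma norm_riemannZeta_le {δ : ℝ} (h0 : 0 < δ) (h1 : δ ≤ 1) (hτ : 1 ≤ τ) :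
    ‖riemannZeta (1 + δ + Complex.I * τ)‖ ≤ 136 * τ ^ (1 / 16 : ℝ) := by
  have hN : 0 < ⌈τ ^ 2⌉₊ := Nat.ceil_pos.mpr (by positivity)
  have hs : 1 < (1 + δ + Complex.I * τ : ℂ).re := by simp [h0]
  have h2 := norm_riemannZeta_sub_sum_le hs hN
  have h3 := tail_le h0 h1 hτ
  have h4 := norm_cpow_div_le h0 hτ hN
  have h5 : ‖∑ n ∈ Finset.range ⌈τ ^ 2⌉₊, (n : ℂ) ^ (-(1 + δ + Complex.I * τ : ℂ))‖ ≤
      1 + Real.log (⌈τ ^ 2⌉₊ : ℝ) := by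
    refine le_trans (norm_sum_le_of_le _ fun n hn => ?_) (sum_range_inv_le_one_add_log _)
    rcases Nat.eq_zero_or_pos n with rfl | hn
    · rw [Nat.cast_zero, Complex.zero_cpow]
      · simp
      · intro h
        have := congrArg Complex.re h
        simp at this; linarith
    · rw [Complex.norm_natCast_cpow_of_pos hn, ← Real.rpow_neg_one]
      refine Real.rpow_le_rpow_of_exponent_le (by exact_mod_cast hn) ?_
      simp [h0.le]
  have h6 := one_add_log_ceil_sq_le hτ
  have h7 : τ ^ (1 / 32 : ℝ) ≤ τ ^ (1 / 16 : ℝ) :=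
    Real.rpow_le_rpow_of_exponent_le hτ (by norm_num)
  have h8 : (1 : ℝ) ≤ τ ^ (1 / 16 : ℝ) := Real.one_le_rpow hτ (by norm_num)
  have h9 : 6 / τ ≤ 6 := div_le_self (by norm_num) hτ
  have h10 := norm_le_insert' (riemannZeta (1 + δ + Complex.I * τ))
    (∑ n ∈ Finset.range ⌈τ ^ 2⌉₊, (n : ℂ) ^ (-(1 + δ + Complex.I * τ : ℂ)) +
      (⌈τ ^ 2⌉₊ : ℂ) ^ (1 - (1 + δ + Complex.I * τ : ℂ)) / ((1 + δ + Complex.I * τ : ℂ) - 1))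
  have h11 := norm_add_le
    (∑ n ∈ Finset.range ⌈τ ^ 2⌉₊, (n : ℂ) ^ (-(1 + δ + Complex.I * τ : ℂ)))
    ((⌈τ ^ 2⌉₊ : ℂ) ^ (1 - (1 + δ + Complex.I * τ : ℂ)) / ((1 + δ + Complex.I * τ : ℂ) - 1))
  linarith

lemma norm_riemannZeta_sub_le {δ' δ : ℝ} (h0 : 0 < δ') (hδ : δ' ≤ δ) (h1 : δ ≤ 1) (hτ : 1 ≤ τ) :
    ‖riemannZeta (1 + δ' + Complex.I * τ) - riemannZeta (1 + δ + Complex.I * τ)‖ ≤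
      δ * (33282 * τ ^ (1 / 16 : ℝ)) + 12 / τ := by
  set N := ⌈τ ^ 2⌉₊ with hNdef
  have hN : 0 < N := Nat.ceil_pos.mpr (by positivity)
  set s : ℂ := 1 + δ' + Complex.I * τ with hsdef
  set s' : ℂ := 1 + δ + Complex.I * τ with hsdef'
  have hs : 1 < s.re := by simp [hsdef, h0]
  have hs' : 1 < s'.re := by simp [hsdef']; linarith
  have h2 := norm_riemannZeta_sub_sum_le hs hN
  have h2' := norm_riemannZeta_sub_sum_le hs' hN
  have h3 : 2 * ‖s‖ / N ≤ 6 / τ := tail_le h0 (hδ.trans h1) hτ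
  have h3' : 2 * ‖s'‖ / N ≤ 6 / τ := tail_le (h0.trans_le hδ) h1 hτ
  have hss : s' = s + (δ - δ' : ℝ) := by rw [hsdef, hsdef']; push_cast; ring
  have hlog : 0 ≤ Real.log N := Real.log_natCast_nonneg N
  have h4 : ‖∑ n ∈ Finset.range N, ((n : ℂ) ^ (-s) - (n : ℂ) ^ (-s'))‖ ≤
      δ * Real.log N * (1 + Real.log N) := by
    refine le_trans (norm_sum_le_of_le _ (f := fun n : ℕ => (n : ℂ) ^ (-s) - (n : ℂ) ^ (-s'))
      (n := fun n : ℕ => δ * Real.log N * ((n : ℝ))⁻¹) fun n hn => ?_) ?_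
    · rcases Nat.eq_zero_or_pos n with rfl | hn0
      · rw [Nat.cast_zero, Complex.zero_cpow, Complex.zero_cpow]
        · simp
        · intro h; rw [neg_eq_zero] at h; rw [h] at hs'; simp at hs'; linarith
        · intro h; rw [neg_eq_zero] at h; rw [h] at hs; simp at hs; linarith
      · have h5 := (norm_natCast_cpow_neg_sub_cpow_neg_add_le hn0 s (h := δ - δ')).resolve_right
          (by linarith)
        rw [← hss, abs_of_nonneg (by linarith)] at h5
        have hn1 : (1 : ℝ) ≤ n := by exact_mod_cast hn0
        have h6 : (n : ℝ) ^ (-s.re) ≤ (n : ℝ)⁻¹ := by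
          rw [← Real.rpow_neg_one]
          exact Real.rpow_le_rpow_of_exponent_le hn1 (by linarith)
        have h7 : Real.log n ≤ Real.log N :=
          Real.log_le_log (by linarith) (by exact_mod_cast (Finset.mem_range.mp hn).le)
        have h8 : 0 ≤ Real.log n := Real.log_natCast_nonneg n
        calc _ ≤ (n : ℝ) ^ (-s.re) * (δ - δ') * Real.log n := h5
          _ ≤ (n : ℝ)⁻¹ * δ * Real.log N := by
            have hδ0 : 0 ≤ δ := by linarith
            gcongr
            linarith
          _ = _ := by ring
    · rw [← Finset.mul_sum]
      have := sum_range_inv_le_one_add_log N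
      have hδ0 : 0 ≤ δ := by linarith
      gcongr
  have hA := abs_le_norm_sub_one δ' τ
  have hA' := abs_le_norm_sub_one δ τ
  rw [abs_of_pos (by linarith)] at hA hA'
  have hs1 : s - 1 ≠ 0 := norm_pos_iff.mp (by linarith)
  have hs1' : s' - 1 ≠ 0 := norm_pos_iff.mp (by linarith)
  have h5 : ‖(N : ℂ) ^ (1 - s) / (s - 1) - (N : ℂ) ^ (1 - s') / (s' - 1)‖ ≤
      δ * (1 + Real.log N) := by
    have e : (N : ℂ) ^ (1 - s) / (s - 1) - (N : ℂ) ^ (1 - s') / (s' - 1) =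
      ((N : ℂ) ^ (1 - s) - (N : ℂ) ^ (1 - s')) / (s - 1) +
        (N : ℂ) ^ (1 - s') * ((δ - δ' : ℝ) : ℂ) / ((s - 1) * (s' - 1)) := by
      have : ((δ - δ' : ℝ) : ℂ) = (s' - 1) - (s - 1) := by rw [hss]; ring
      rw [this]
      field_simp
      ring
    rw [e]
    refine (norm_add_le _ _).trans ?_
    have h6 : ‖((N : ℂ) ^ (1 - s) - (N : ℂ) ^ (1 - s')) / (s - 1)‖ ≤ δ * Real.log N := by
      have h7 := (norm_natCast_cpow_neg_sub_cpow_neg_add_le hN (s - 1) (h := δ - δ')).resolve_right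
          (by linarith)
      have e1 : -(s - 1) = 1 - s := by ring
      have e2 : -(s - 1 + (δ - δ' : ℝ)) = 1 - s' := by rw [hss]; ring
      rw [e1, e2, abs_of_nonneg (by linarith)] at h7
      have h8 : (N : ℝ) ^ (-(s - 1).re) ≤ 1 :=
        Real.rpow_le_one_of_one_le_of_nonpos (by exact_mod_cast hN) (by simp; linarith)
      rw [norm_div]
      refine (div_le_self (norm_nonneg _) (by linarith)).trans (h7.trans ?_)
      calc _ ≤ 1 * δ * Real.log N := by gcongr; linarith
        _ = _ := by ring
    have h9 : ‖(N : ℂ) ^ (1 - s') * ((δ - δ' : ℝ) : ℂ) / ((s - 1) * (s' - 1))‖ ≤ δ := by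
      rw [norm_div, norm_mul, norm_mul, Complex.norm_natCast_cpow_of_pos hN, Complex.norm_real,
        Real.norm_of_nonneg (by linarith)]
      have h8 : (N : ℝ) ^ ((1 - s').re) ≤ 1 :=
        Real.rpow_le_one_of_one_le_of_nonpos (by exact_mod_cast hN) (by simp; linarith)
      have h10 : 1 ≤ ‖s - 1‖ * ‖s' - 1‖ := by nlinarith
      refine (div_le_self (mul_nonneg (by positivity) (by linarith)) h10).trans ?_
      calc _ ≤ 1 * δ := mul_le_mul h8 (by linarith) (by linarith) (by norm_num)
        _ = δ := one_mul _
    linarith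
  have e : riemannZeta s - riemannZeta s' =
      (riemannZeta s - (∑ n ∈ Finset.range N, (n : ℂ) ^ (-s) + (N : ℂ) ^ (1 - s) / (s - 1))) -
      (riemannZeta s' - (∑ n ∈ Finset.range N, (n : ℂ) ^ (-s') + (N : ℂ) ^ (1 - s') / (s' - 1))) +
      ∑ n ∈ Finset.range N, ((n : ℂ) ^ (-s) - (n : ℂ) ^ (-s')) +
      ((N : ℂ) ^ (1 - s) / (s - 1) - (N : ℂ) ^ (1 - s') / (s' - 1)) := by
    rw [Finset.sum_sub_distrib]; ring
  rw [e]
  have h11 := one_add_log_ceil_sq_le hτ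
  have h12 : τ ^ (1 / 16 : ℝ) = τ ^ (1 / 32 : ℝ) * τ ^ (1 / 32 : ℝ) := by
    rw [← Real.rpow_add (by linarith)]; norm_num
  have h13 : (1 + Real.log N) ^ 2 ≤ 16641 * τ ^ (1 / 16 : ℝ) := by
    rw [h12]
    calc (1 + Real.log N) ^ 2 ≤ (129 * τ ^ (1 / 32 : ℝ)) ^ 2 := by gcongr
      _ = _ := by ring
  have h14 : δ * Real.log N * (1 + Real.log N) + δ * (1 + Real.log N) ≤
      δ * (33282 * τ ^ (1 / 16 : ℝ)) := by
    have hδ0 : 0 ≤ δ := by linarith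
    have : δ * Real.log N * (1 + Real.log N) + δ * (1 + Real.log N) = δ * (1 + Real.log N) ^ 2 := by
      ring
    rw [this]
    have h0' : 0 ≤ (1 + Real.log N) ^ 2 := sq_nonneg _
    gcongr
    linarith
  have h15 : 12 / τ = 6 / τ + 6 / τ := by ring
  refine (norm_add₃_le).trans ?_
  have := norm_sub_le
    (riemannZeta s - (∑ n ∈ Finset.range N, (n : ℂ) ^ (-s) + (N : ℂ) ^ (1 - s) / (s - 1)))
    (riemannZeta s' - (∑ n ∈ Finset.range N, (n : ℂ) ^ (-s') + (N : ℂ) ^ (1 - s') / (s' - 1)))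
  linarith

end

lemma norm_riemannZeta_one_add_ofReal_le {δ : ℝ} (h0 : 0 < δ) (h1 : δ ≤ 1) :
    ‖riemannZeta (1 + δ)‖ ≤ 5 / δ := by
  have h := norm_riemannZeta_sub_sum_le (s := 1 + δ) (by simpa using h0) one_pos
  have hne : -(1 + (δ : ℂ)) ≠ 0 := by
    intro h
    have := congrArg Complex.re h
    simp at this
    linarith
  simp only [Finset.range_one, Finset.sum_singleton, Nat.cast_zero, Complex.zero_cpow hne,
    Nat.cast_one, Complex.one_cpow, zero_add, add_sub_cancel_left, div_one] at h
  have h2 : ‖(1 + δ : ℂ)‖ = 1 + δ := by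
    rw [← Complex.ofReal_one, ← Complex.ofReal_add, Complex.norm_real, Real.norm_eq_abs,
      abs_of_pos (by linarith)]
  have h3 : ‖(1 / δ : ℂ)‖ = 1 / δ := by
    rw [norm_div, norm_one, Complex.norm_real, Real.norm_eq_abs, abs_of_pos h0]
  have h4 := norm_sub_norm_le (riemannZeta (1 + δ)) (1 / δ : ℂ)
  rw [h2] at h
  rw [h3] at h4
  have h5 : 1 ≤ 1 / δ := by rw [le_div_iff₀ h0]; linarith
  calc _ ≤ 1 / δ + 2 * (1 + δ) := by linarith
    _ ≤ 1 / δ + 4 * (1 / δ) := by linarith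
    _ = _ := by ring

lemma le_norm_riemannZeta_pow_four {δ τ : ℝ} (h0 : 0 < δ) (h1 : δ ≤ 1) (hτ : 1 ≤ τ) :
    δ ^ 3 ≤ ‖riemannZeta (1 + δ + Complex.I * τ)‖ ^ 4 * (34000 * τ ^ (1 / 16 : ℝ)) := by
  have h := DirichletCharacter.norm_LFunction_product_ge_one (N := 1) 1 h0 τ
  rw [DirichletCharacter.LFunctionTrivChar, DirichletCharacter.LFunction_modOne_eq,
    DirichletCharacter.LFunction_modOne_eq, norm_mul, norm_mul, norm_pow, norm_pow] at h
  have h2 := norm_riemannZeta_one_add_ofReal_le h0 h1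
  have h3 := norm_riemannZeta_le h0 h1 (show 1 ≤ 2 * τ by linarith)
  have h4 : (1 + δ + Complex.I * ((2 * τ : ℝ) : ℂ)) = 1 + δ + 2 * Complex.I * τ := by
    push_cast; ring
  rw [h4] at h3
  have h5 : (2 * τ) ^ (1 / 16 : ℝ) ≤ 2 * τ ^ (1 / 16 : ℝ) := by
    rw [Real.mul_rpow (by norm_num) (by linarith)]
    gcongr
    calc (2 : ℝ) ^ (1 / 16 : ℝ) ≤ 2 ^ (1 : ℝ) :=
          Real.rpow_le_rpow_of_exponent_le (by norm_num) (by norm_num)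
      _ = 2 := Real.rpow_one 2
  set Z := ‖riemannZeta (1 + δ + Complex.I * τ)‖
  have h6 : 1 ≤ (5 / δ) ^ 3 * Z ^ 4 * (136 * (2 * τ ^ (1 / 16 : ℝ))) := by
    refine h.le.trans ?_
    gcongr
    exact h3.trans (by gcongr)
  calc δ ^ 3 = δ ^ 3 * 1 := by ring
    _ ≤ δ ^ 3 * ((5 / δ) ^ 3 * Z ^ 4 * (136 * (2 * τ ^ (1 / 16 : ℝ)))) := by gcongr
    _ = _ := by field_simp; ring

lemma exists_le_norm_riemannZeta_of_le : ∃ c T : ℝ, 0 < c ∧ 1 ≤ T ∧ ∀ δ τ : ℝ, 0 < δ → δ ≤ 1 →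
    T ≤ τ → c * τ ^ (-(1 / 4) : ℝ) ≤ ‖riemannZeta (1 + δ + Complex.I * τ)‖ := by
  obtain ⟨B, hB⟩ : ∃ B : ℝ, B = 33282 := ⟨_, rfl⟩
  have hBpos : 0 < B := by rw [hB]; norm_num
  obtain ⟨κ, hκ⟩ : ∃ κ : ℝ, κ = 1 / (34000 * (256 * B ^ 4)) := ⟨_, rfl⟩
  have hκpos : 0 < κ := by rw [hκ]; positivity
  have hκ1 : κ ≤ 1 := by
    rw [hκ, hB]; norm_num
  refine ⟨2 * B * κ, max 1 ((12 / (B * κ)) ^ 2), by positivity, le_max_left _ _, ?_⟩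
  intro δ τ h0 h1 hτ
  have hτ1 : 1 ≤ τ := (le_max_left _ _).trans hτ
  have hτ2 : (12 / (B * κ)) ^ 2 ≤ τ := (le_max_right _ _).trans hτ
  obtain ⟨X, hX⟩ : ∃ X : ℝ, X = τ ^ (1 / 16 : ℝ) := ⟨_, rfl⟩
  have hX1 : 1 ≤ X := by rw [hX]; exact Real.one_le_rpow hτ1 (by norm_num)
  have hX16 : X ^ 16 = τ := by
    rw [hX, ← Real.rpow_natCast, ← Real.rpow_mul (by linarith)]; norm_num
  have hX4 : τ ^ (-(1 / 4) : ℝ) = (X ^ 4)⁻¹ := by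
    rw [hX, ← Real.rpow_natCast, ← Real.rpow_mul (by linarith), ← Real.rpow_neg (by linarith)]
    norm_num
  have hX12 : 12 / (B * κ) ≤ X ^ 12 := by
    have : 12 / (B * κ) ≤ X ^ 8 := by
      refine le_of_sq_le_sq ?_ (by positivity)
      calc _ ≤ τ := hτ2
        _ = _ := by rw [← hX16]; ring
    exact this.trans (pow_le_pow_right₀ hX1 (by norm_num))
  have main : ∀ δ₁ : ℝ, κ * (X ^ 5)⁻¹ ≤ δ₁ → δ₁ ≤ 1 →
      4 * B * κ * (X ^ 4)⁻¹ ≤ ‖riemannZeta (1 + δ₁ + Complex.I * τ)‖ := by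
    intro δ₁ h2 h3
    have h4 : 0 < κ * (X ^ 5)⁻¹ := by positivity
    have h := le_norm_riemannZeta_pow_four (h4.trans_le h2) h3 hτ1
    rw [← hX] at h
    refine le_of_pow_le_pow_left₀ (n := 4) (by norm_num) (norm_nonneg _) ?_
    have h5 : (κ * (X ^ 5)⁻¹) ^ 3 ≤ δ₁ ^ 3 := by gcongr
    have h6 : (4 * B * κ * (X ^ 4)⁻¹) ^ 4 * (34000 * X) = (κ * (X ^ 5)⁻¹) ^ 3 := by
      have h7 : (34000 * (256 * B ^ 4)) * κ = 1 := by rw [hκ]; field_simp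
      field_simp
      linear_combination h7
    refine le_of_mul_le_mul_right ?_ (show 0 < 34000 * X by positivity)
    rw [h6]
    exact h5.trans h
  rw [hX4]
  have hpos : 0 < B * κ * (X ^ 4)⁻¹ := by positivity
  rcases le_total (κ * (X ^ 5)⁻¹) δ with h2 | h2
  · have := main δ h2 h1
    nlinarith
  · have hle : κ * (X ^ 5)⁻¹ ≤ 1 := by
      have : (X ^ 5)⁻¹ ≤ 1 := inv_le_one_of_one_le₀ (one_le_pow₀ hX1)
      calc κ * (X ^ 5)⁻¹ ≤ 1 * 1 := by gcongr
        _ = 1 := one_mul 1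
    have h3 := main _ le_rfl hle
    have h4 := norm_riemannZeta_sub_le h0 h2 hle hτ1
    rw [← hX, ← hB, ← hX16] at h4
    have h5 : κ * (X ^ 5)⁻¹ * (B * X) = B * κ * (X ^ 4)⁻¹ := by field_simp
    have h6 : 12 / X ^ 16 ≤ B * κ * (X ^ 4)⁻¹ := by
      rw [div_le_iff₀ (by positivity)] at hX12 ⊢
      calc 12 ≤ X ^ 12 * (B * κ) := hX12
        _ = _ := by field_simp
    rw [hX16] at h4 h6
    rw [h5] at h4
    have h7 := norm_sub_norm_le (riemannZeta (1 + (κ * (X ^ 5)⁻¹ : ℝ) + Complex.I * τ))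
      (riemannZeta (1 + δ + Complex.I * τ))
    rw [norm_sub_rev] at h7
    linarith

lemma exists_norm_inv_mul_riemannZeta_le_of_abs_im_le (T : ℝ) : ∃ C : ℝ, ∀ w : ℂ,
    0 < w.re → w.re ≤ 1 → |w.im| ≤ T → ‖(w * riemannZeta (1 + w))⁻¹‖ ≤ C := by
  classical
  let g : ℂ → ℂ := Function.update (fun w => w * riemannZeta (1 + w)) 0 1
  have hg : Continuous g := by
    rw [continuous_iff_continuousAt]
    intro z
    by_cases hz : z = 0
    · subst hz
      rw [continuousAt_update_same]
      have h1 : Tendsto (fun w : ℂ => 1 + w) (𝓝[≠] 0) (𝓝[≠] 1) := by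
        refine tendsto_nhdsWithin_of_tendsto_nhds_of_eventually_within _ ?_ ?_
        · refine Tendsto.mono_left ?_ nhdsWithin_le_nhds
          have : ContinuousAt (fun w : ℂ => 1 + w) 0 := by fun_prop
          simpa [ContinuousAt] using this
        · filter_upwards [self_mem_nhdsWithin] with w hw
          simpa using hw
      have := riemannZeta_residue_one.comp h1
      simpa [Function.comp_def] using this
    · refine (continuousAt_update_of_ne hz).mpr ?_
      have h1 : ContinuousAt riemannZeta (1 + z) :=
        (differentiableAt_riemannZeta (by simpa using hz)).continuousAt
      have h2 : ContinuousAt (fun w => riemannZeta (1 + w)) z :=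
        ContinuousAt.comp (f := fun w : ℂ => 1 + w) h1 (by fun_prop)
      exact continuousAt_id.mul h2
  have hne : ∀ w : ℂ, 0 ≤ w.re → g w ≠ 0 := by
    intro w hw
    by_cases hz : w = 0
    · simp [g, hz]
    · simp only [g, Function.update_of_ne hz]
      exact mul_ne_zero hz (riemannZeta_ne_zero_of_one_le_re (by simpa using hw))
  have hK : IsCompact (Set.Icc (0 : ℝ) 1 ×ℂ Set.Icc (-T) T) :=
    isCompact_Icc.reProdIm isCompact_Icc
  obtain ⟨C, hC⟩ := hK.exists_bound_of_continuousOn (f := fun w => (g w)⁻¹)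
    (hg.continuousOn.inv₀ fun w hw => hne w hw.1.1)
  refine ⟨C, fun w h0 h1 h2 => ?_⟩
  have hw0 : w ≠ 0 := by rintro rfl; simp at h0
  have := hC w ⟨⟨h0.le, h1⟩, abs_le.mp h2⟩
  simpa [g, Function.update_of_ne hw0] using this

/-- A quantitative lower bound for `ζ` near the line `re s = 1`. -/
lemma exists_norm_inv_mul_riemannZeta_sq_le : ∃ C : ℝ, 0 < C ∧ ∀ w : ℂ, 0 < w.re → w.re ≤ 1 →
    ‖(w * riemannZeta (1 + w))⁻¹‖ ^ 2 ≤ C * (1 + w.im ^ 2) ^ (-(3 / 4) : ℝ) := by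
  obtain ⟨c, T, hc, hT, H⟩ := exists_le_norm_riemannZeta_of_le
  obtain ⟨K, hK⟩ := exists_norm_inv_mul_riemannZeta_le_of_abs_im_le T
  refine ⟨max ((c ^ 2)⁻¹ * 2) (K ^ 2 * (1 + T ^ 2) ^ (3 / 4 : ℝ)),
    lt_max_of_lt_left (by positivity), fun w h0 h1 => ?_⟩
  have hbase : 0 < 1 + w.im ^ 2 := by positivity
  rcases le_total |w.im| T with h | h
  · refine le_trans ?_ (mul_le_mul_of_nonneg_right (le_max_right _ _) (by positivity))
    have h2 : w.im ^ 2 ≤ T ^ 2 := by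
      rw [← sq_abs]; gcongr
    rw [Real.rpow_neg hbase.le, mul_assoc]
    calc ‖(w * riemannZeta (1 + w))⁻¹‖ ^ 2 ≤ K ^ 2 := by gcongr; exact hK w h0 h1 h
      _ = K ^ 2 * 1 := by ring
      _ ≤ _ := by
        gcongr
        rw [← div_eq_mul_inv, le_div_iff₀ (by positivity), one_mul]
        gcongr
  · refine le_trans ?_ (mul_le_mul_of_nonneg_right (le_max_left _ _) (by positivity))
    set τ := |w.im| with hτ
    have hτ1 : 1 ≤ τ := hT.trans h
    have hz : c * τ ^ (-(1 / 4) : ℝ) ≤ ‖riemannZeta (1 + w)‖ := by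
      have := H w.re τ h0 h1 h
      rcases abs_cases w.im with ⟨h3, -⟩ | ⟨h3, -⟩
      · have h4 : (1 + w.re + Complex.I * τ : ℂ) = 1 + w := by
          rw [hτ, h3]
          apply Complex.ext <;> simp
        rwa [h4] at this
      · have h4 : (1 + w.re + Complex.I * τ : ℂ) = (starRingEnd ℂ) (1 + w) := by
          rw [hτ, h3]
          apply Complex.ext <;> simp
        rwa [h4, riemannZeta_conj, Complex.norm_conj] at this
    have hw : τ ≤ ‖w‖ := Complex.abs_im_le_norm w
    have h5 : c * τ ^ (3 / 4 : ℝ) ≤ ‖w * riemannZeta (1 + w)‖ := by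
      rw [norm_mul]
      calc c * τ ^ (3 / 4 : ℝ) = τ * (c * τ ^ (-(1 / 4) : ℝ)) := by
            rw [show (3 / 4 : ℝ) = 1 + -(1 / 4) by norm_num, Real.rpow_add (by linarith),
              Real.rpow_one]
            ring
        _ ≤ _ := by gcongr
    have hpos : 0 < c * τ ^ (3 / 4 : ℝ) := by positivity
    have h6 : 1 + w.im ^ 2 ≤ 2 * τ ^ 2 := by
      rw [hτ, sq_abs] at *
      have : 1 ≤ |w.im| ^ 2 := one_le_pow₀ hτ1
      rw [sq_abs] at this
      linarith
    calc ‖(w * riemannZeta (1 + w))⁻¹‖ ^ 2 ≤ ((c * τ ^ (3 / 4 : ℝ))⁻¹) ^ 2 := by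
          rw [norm_inv]; gcongr
      _ = (c ^ 2)⁻¹ * ((τ ^ 2) ^ (3 / 4 : ℝ))⁻¹ := by
          rw [inv_pow, mul_pow, mul_inv]
          congr 2
          rw [← Real.rpow_natCast, ← Real.rpow_natCast, ← Real.rpow_mul (by linarith),
            ← Real.rpow_mul (by linarith)]
          norm_num
      _ ≤ (c ^ 2)⁻¹ * (2 * (1 + w.im ^ 2) ^ (-(3 / 4) : ℝ)) := by
          gcongr
          rw [Real.rpow_neg hbase.le, ← div_eq_mul_inv, le_div_iff₀ (by positivity),
            inv_mul_le_iff₀ (by positivity)]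
          calc (1 + w.im ^ 2) ^ (3 / 4 : ℝ) ≤ (2 * τ ^ 2) ^ (3 / 4 : ℝ) := by gcongr
            _ = 2 ^ (3 / 4 : ℝ) * (τ ^ 2) ^ (3 / 4 : ℝ) := by
              rw [Real.mul_rpow (by norm_num) (by positivity)]
            _ ≤ 2 ^ (1 : ℝ) * (τ ^ 2) ^ (3 / 4 : ℝ) := by
              gcongr <;> norm_num
            _ = _ := by rw [Real.rpow_one]; ring
      _ = _ := by ring

open FourierTransform InnerProductSpace in
/-- Plancherel's theorem for a function which is both integrable and square integrable. -/
lemma integral_norm_sq_fourier_of_integrable {f : ℝ → ℂ} (hf : Integrable f)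
    (hf2 : MemLp f 2) (hF : Integrable fun ξ => ‖𝓕 f ξ‖ ^ 2) :
    ∫ u, ‖f u‖ ^ 2 = ∫ ξ, ‖𝓕 f ξ‖ ^ 2 := by
  have hcont : Continuous (𝓕 f) :=
    VectorFourier.fourierIntegral_continuous Real.continuous_fourierChar continuous_inner hf
  have hF2 : MemLp (𝓕 f) 2 := (memLp_two_iff_integrable_sq_norm hcont.aestronglyMeasurable).2 hF
  let f' : Lp ℂ 2 (volume : Measure ℝ) := hf2.toLp f
  let h : Lp ℂ 2 (volume : Measure ℝ) := hF2.toLp (𝓕 f)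
  have key : ∀ G : Lp ℂ 2 (volume : Measure ℝ), inner ℂ h G = inner ℂ f' (𝓕⁻ G) := by
    intro G
    refine (SchwartzMap.denseRange_toLpCLM (E := ℝ) (F := ℂ) (μ := volume)
      (ENNReal.ofNat_ne_top (n := 2))).induction_on
      (p := fun G => inner ℂ h G = inner ℂ f' (𝓕⁻ G)) G ?_ ?_
    · refine isClosed_eq (by fun_prop) ?_
      have : Continuous fun G : Lp ℂ 2 (volume : Measure ℝ) => 𝓕⁻ G :=
        ContinuousFourierInv.continuous_fourierInv
      fun_prop
    · intro g
      rw [SchwartzMap.toLpCLM_apply, SchwartzMap.toLp_fourierInv_eq, L2.inner_def, L2.inner_def]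
      have h1 : ∀ᵐ x, inner ℂ (h x) (g.toLp 2 volume x) = inner ℂ (𝓕 f x) (g x) := by
        filter_upwards [hF2.coeFn_toLp, g.coeFn_toLp 2 volume] with x hx hy
        rw [hx, hy]
      have h2 : ∀ᵐ x, inner ℂ (f' x) ((𝓕⁻ g).toLp 2 volume x) = inner ℂ (f x) (𝓕⁻ g x) := by
        filter_upwards [hf2.coeFn_toLp, (𝓕⁻ g).coeFn_toLp 2 volume] with x hx hy
        rw [hx, hy]
      rw [integral_congr_ae h1, integral_congr_ae h2]
      simpa [SchwartzMap.fourierInv_coe] using!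
        VectorFourier.integral_sesq_fourierIntegral_eq_neg_flip (innerSL ℂ (E := ℂ))
        (L := innerₗ ℝ) Real.continuous_fourierChar continuous_inner hf g.integrable
  have hh : h = 𝓕 f' := by
    refine ext_inner_right ℂ fun G => ?_
    rw [key, ← Lp.inner_fourier_eq f' (𝓕⁻ G), FourierTransform.fourier_fourierInv_eq]
  have hn : ‖h‖ = ‖f'‖ := by rw [hh, Lp.norm_fourier_eq]
  have e1 : ∀ (q : ℝ → ℂ) (hq : MemLp q 2), ‖hq.toLp q‖ ^ 2 = ∫ u, ‖q u‖ ^ 2 := by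
    intro q hq
    rw [← inner_self_eq_norm_sq (𝕜 := ℂ), L2.inner_def]
    rw [← integral_re (𝕜 := ℂ) (L2.integrable_inner _ _)]
    refine integral_congr_ae ?_
    filter_upwards [hq.coeFn_toLp] with x hx
    rw [hx, inner_self_eq_norm_sq (𝕜 := ℂ)]
  rw [← e1 f hf2, ← e1 _ hF2, ← hn]

/-- The smoothed sum `∑ μ(c) c ^ (-s) χ(u - log c)`. -/
noncomputable def moebiusSum (χ : ℝ → ℝ) (s u : ℝ) : ℝ :=
  ∑' c : ℕ, (ArithmeticFunction.moebius c : ℝ) * (c : ℝ) ^ (-s) * χ (u - Real.log c)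

/-- Measurable functions with values in `[0, 1]` which vanish on the negative axis. -/
structure IsCutoff (χ : ℝ → ℝ) : Prop where
  measurable : Measurable χ
  nonneg : ∀ x, 0 ≤ χ x
  le_one : ∀ x, χ x ≤ 1
  eq_zero : ∀ x, x < 0 → χ x = 0

section
variable {χ : ℝ → ℝ} {s : ℝ}

lemma IsCutoff.term_eq_zero (hχ : IsCutoff χ) {u : ℝ} {c : ℕ} (hc : Real.exp u < c) :
    (ArithmeticFunction.moebius c : ℝ) * (c : ℝ) ^ (-s) * χ (u - Real.log c) = 0 := by
  rw [hχ.eq_zero, mul_zero]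
  have := Real.log_lt_log (Real.exp_pos u) hc
  rw [Real.log_exp] at this
  linarith

lemma IsCutoff.moebiusSum_eq_sum (hχ : IsCutoff χ) {u : ℝ} {S : Finset ℕ}
    (hS : ∀ c : ℕ, 0 < c → (c : ℝ) ≤ Real.exp u → c ∈ S) : moebiusSum χ s u =
    ∑ c ∈ S, (ArithmeticFunction.moebius c : ℝ) * (c : ℝ) ^ (-s) * χ (u - Real.log c) := by
  refine tsum_eq_sum fun c hc => ?_
  rcases Nat.eq_zero_or_pos c with rfl | hc0
  · simp
  · exact hχ.term_eq_zero (lt_of_not_ge fun h => hc (hS c hc0 h))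

lemma IsCutoff.summable (hχ : IsCutoff χ) (u : ℝ) : Summable fun c : ℕ =>
    (ArithmeticFunction.moebius c : ℝ) * (c : ℝ) ^ (-s) * χ (u - Real.log c) := by
  refine summable_of_hasFiniteSupport ((Set.finite_Iic ⌊Real.exp u⌋₊).subset fun c hc => ?_)
  by_contra h
  refine hc (hχ.term_eq_zero ?_)
  rw [Set.mem_Iic, not_le] at h
  exact (Nat.floor_lt (Real.exp_pos u).le).1 h

lemma IsCutoff.measurable_moebiusSum (hχ : IsCutoff χ) : Measurable (moebiusSum χ s) := by
  refine measurable_of_tendsto_metrizable (f := fun n u => ∑ c ∈ Finset.range n,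
    (ArithmeticFunction.moebius c : ℝ) * (c : ℝ) ^ (-s) * χ (u - Real.log c)) ?_ ?_
  · intro n
    have := hχ.measurable
    fun_prop
  · rw [tendsto_pi_nhds]
    exact fun u => (hχ.summable u).hasSum.tendsto_sum_nat

lemma IsCutoff.moebiusSum_eq_zero (hχ : IsCutoff χ) {u : ℝ} (hu : u < 0) :
    moebiusSum χ s u = 0 := by
  rw [hχ.moebiusSum_eq_sum (S := ∅)]
  · simp
  · intro c hc hcu
    have h1 : (1 : ℝ) ≤ c := by exact_mod_cast hc
    have := Real.exp_lt_one_iff.2 hu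
    linarith

lemma IsCutoff.abs_moebiusSum_le (hχ : IsCutoff χ) (hs : 1 ≤ s) {u : ℝ} (hu : 0 ≤ u) :
    |moebiusSum χ s u| ≤ 2 + u := by
  have h1 : 1 ≤ Real.exp u := Real.one_le_exp hu
  rw [hχ.moebiusSum_eq_sum (S := Finset.range (⌊Real.exp u⌋₊ + 1))]
  · refine (Finset.abs_sum_le_sum_abs _ _).trans ?_
    have h2 : ∀ c ∈ Finset.range (⌊Real.exp u⌋₊ + 1),
        |(ArithmeticFunction.moebius c : ℝ) * (c : ℝ) ^ (-s) * χ (u - Real.log c)| ≤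
          (c : ℝ)⁻¹ := by
      intro c _
      rcases Nat.eq_zero_or_pos c with rfl | hc0
      · simp
      have hc1 : (1 : ℝ) ≤ c := by exact_mod_cast hc0
      have h3 : |(ArithmeticFunction.moebius c : ℝ)| ≤ 1 := by
        exact_mod_cast ArithmeticFunction.abs_moebius_le_one
      have h4 : (c : ℝ) ^ (-s) ≤ (c : ℝ)⁻¹ := by
        rw [← Real.rpow_neg_one]
        exact Real.rpow_le_rpow_of_exponent_le hc1 (by linarith)
      rw [abs_mul, abs_mul, abs_of_nonneg (hχ.nonneg _),
        abs_of_nonneg (Real.rpow_nonneg (Nat.cast_nonneg c) _)]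
      calc _ ≤ 1 * (c : ℝ)⁻¹ * 1 := by
            gcongr
            · exact hχ.nonneg _
            · exact hχ.le_one _
        _ = _ := by ring
    refine (Finset.sum_le_sum h2).trans ?_
    refine (sum_range_inv_le_one_add_log _).trans ?_
    have h5 : ((⌊Real.exp u⌋₊ + 1 : ℕ) : ℝ) ≤ Real.exp 1 * Real.exp u := by
      have := Nat.floor_le (Real.exp_pos u).le
      have h6 := Real.add_one_le_exp 1
      push_cast
      nlinarith
    have := Real.log_le_log (by positivity) h5
    rw [← Real.exp_add, Real.log_exp] at this
    linarith
  · intro c _ hc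
    rw [Finset.mem_range, Nat.lt_succ_iff]
    exact Nat.le_floor hc

lemma integrable_indicator_exp_neg {ε : ℝ} (hε : 0 < ε) :
    Integrable ((Set.Ici (0 : ℝ)).indicator fun u => Real.exp (-ε * u)) := by
  rw [integrable_indicator_iff measurableSet_Ici, integrableOn_Ici_iff_integrableOn_Ioi]
  exact exp_neg_integrableOn_Ioi 0 hε

lemma IsCutoff.integrable_mul_exp (hχ : IsCutoff χ) {z : ℂ} (hz : 0 < z.re) :
    Integrable fun x : ℝ => (χ x : ℂ) * Complex.exp (-z * x) := by
  refine (integrable_indicator_exp_neg hz).mono' ?_ ?_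
  · have := hχ.measurable
    exact Measurable.aestronglyMeasurable (by fun_prop)
  · refine Eventually.of_forall fun x => ?_
    rw [norm_mul, Complex.norm_real, Complex.norm_exp, Real.norm_eq_abs,
      abs_of_nonneg (hχ.nonneg x)]
    rcases lt_or_ge x 0 with hx | hx
    · rw [hχ.eq_zero x hx, zero_mul]
      exact Set.indicator_nonneg (fun _ _ => (Real.exp_pos _).le) _
    · rw [Set.indicator_of_mem (Set.mem_Ici.2 hx)]
      have : (-z * x).re = -z.re * x := by simp
      rw [this]
      calc _ ≤ 1 * Real.exp (-z.re * x) := by gcongr; exact hχ.le_one x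
        _ = _ := one_mul _

lemma IsCutoff.integral_moebiusSum_mul_exp (hχ : IsCutoff χ) (hs : 1 ≤ s) {z : ℂ}
    (hz : 0 < z.re) :
    ∫ u : ℝ, (moebiusSum χ s u : ℂ) * Complex.exp (-z * u) =
      (∫ x : ℝ, (χ x : ℂ) * Complex.exp (-z * x)) * (riemannZeta (s + z))⁻¹ := by
  set h : ℝ → ℂ := fun x => (χ x : ℂ) * Complex.exp (-z * x) with hh
  have hinteg := hχ.integrable_mul_exp hz
  rw [← hh] at hinteg
  have hre : 1 < ((s : ℂ) + z).re := by simp; linarith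
  let A : ℕ → ℂ := LSeries.term (fun n => ((ArithmeticFunction.moebius n : ℤ) : ℂ)) (s + z)
  have hA : Summable A := ArithmeticFunction.LSeriesSummable_moebius_iff.2 hre
  have hterm : ∀ (c : ℕ) (u : ℝ), (((ArithmeticFunction.moebius c : ℝ) * (c : ℝ) ^ (-s) *
      χ (u - Real.log c) : ℝ) : ℂ) * Complex.exp (-z * u) = A c * h (u - Real.log c) := by
    intro c u
    rcases Nat.eq_zero_or_pos c with rfl | hc
    · simp [A]
    have hc0 : (c : ℂ) ≠ 0 := by exact_mod_cast hc.ne'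
    simp only [A, hh, LSeries.term_def, if_neg hc.ne']
    rw [div_eq_mul_inv, ← Complex.cpow_neg, neg_add, Complex.cpow_add _ _ hc0]
    push_cast
    rw [Complex.ofReal_cpow (by positivity)]
    push_cast
    have h1 : Complex.exp (-z * u) = (c : ℂ) ^ (-z) * Complex.exp (-z * (u - Complex.log c)) := by
      rw [Complex.cpow_def_of_ne_zero hc0, ← Complex.exp_add]
      ring_nf
    rw [h1, ← Complex.natCast_log]
    ring
  have key := hasSum_integral_of_summable_integral_norm
    (F := fun (c : ℕ) (u : ℝ) => A c * h (u - Real.log c)) (μ := volume)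
    (fun c => (hinteg.comp_sub_right (Real.log c)).const_mul (A c)) (by
      simp only [norm_mul, integral_const_mul]
      have : ∀ c : ℕ, ∫ u : ℝ, ‖h (u - Real.log c)‖ = ∫ u, ‖h u‖ := fun c =>
        integral_sub_right_eq_self (fun u => ‖h u‖) (Real.log c)
      simp only [this]
      exact hA.norm.mul_right _)
  have h2 : ∀ c : ℕ, ∫ u : ℝ, A c * h (u - Real.log c) = A c * ∫ u, h u := by
    intro c
    rw [integral_const_mul, integral_sub_right_eq_self h]
  simp only [h2] at key
  have h3 := key.unique (hA.hasSum.mul_right _)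
  have h4 : ∀ u : ℝ, (moebiusSum χ s u : ℂ) * Complex.exp (-z * u) =
      ∑' c : ℕ, A c * h (u - Real.log c) := by
    intro u
    rw [moebiusSum, Complex.ofReal_tsum, ← tsum_mul_right]
    exact tsum_congr fun c => hterm c u
  simp only [h4]
  rw [h3, mul_comm]
  congr 1
  have h5 := ArithmeticFunction.LSeries_zeta_mul_Lseries_moebius hre
  rw [ArithmeticFunction.LSeries_zeta_eq_riemannZeta hre] at h5
  exact eq_inv_of_mul_eq_one_right h5

/-- Plancherel for `moebiusSum`. -/
lemma IsCutoff.integral_moebiusSum_sq_le (hχ : IsCutoff χ) (hs : 1 ≤ s) {ε : ℝ} (hε : 0 < ε)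
    {g : ℝ → ℝ} (hg : Integrable g)
    (H : ∀ ξ : ℝ, ‖(∫ x : ℝ, (χ x : ℂ) * Complex.exp (-(ε + 2 * Real.pi * ξ * Complex.I) * x)) *
      (riemannZeta (s + (ε + 2 * Real.pi * ξ * Complex.I)))⁻¹‖ ^ 2 ≤ g ξ) :
    Integrable (fun u => moebiusSum χ s u ^ 2 * Real.exp (-(2 * ε) * u)) ∧
    ∫ u, moebiusSum χ s u ^ 2 * Real.exp (-(2 * ε) * u) ≤ ∫ ξ, g ξ := by
  set f : ℝ → ℂ := fun u => (moebiusSum χ s u : ℂ) * Real.exp (-ε * u) with hf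
  have hfm : Measurable f := by
    have := hχ.measurable_moebiusSum (s := s)
    fun_prop
  obtain ⟨K, hK⟩ : ∃ K : ℝ, K = 2 + 2 / ε := ⟨_, rfl⟩
  have hK0 : 0 < K := by rw [hK]; positivity
  have hbound : ∀ u, ‖f u‖ ≤ K * (Set.Ici (0 : ℝ)).indicator (fun u => Real.exp (-(ε / 2) * u)) u := by
    intro u
    rw [hf]
    simp only
    rw [norm_mul, Complex.norm_real, Complex.norm_real, Real.norm_eq_abs, Real.norm_eq_abs,
      abs_of_pos (Real.exp_pos _)]
    rcases lt_or_ge u 0 with hu | hu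
    · rw [hχ.moebiusSum_eq_zero hu]
      simp [hu]
    · rw [Set.indicator_of_mem (Set.mem_Ici.2 hu)]
      have h1 : 2 + u ≤ K * Real.exp (ε / 2 * u) := by
        have h2 := Real.add_one_le_exp (ε / 2 * u)
        have h3 : K * (ε / 2 * u + 1) = ε * u + u + 2 + 2 / ε := by
          rw [hK]; field_simp; ring
        have h4 : 0 < 2 / ε := by positivity
        have h5 : 0 ≤ ε * u := by positivity
        nlinarith
      calc _ ≤ K * Real.exp (ε / 2 * u) * Real.exp (-ε * u) := by
            gcongr
            exact (hχ.abs_moebiusSum_le hs hu).trans h1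
        _ = _ := by rw [mul_assoc, ← Real.exp_add]; ring_nf
  have hinteg : Integrable f :=
    ((integrable_indicator_exp_neg (show 0 < ε / 2 by positivity)).const_mul K).mono'
      hfm.aestronglyMeasurable (Eventually.of_forall hbound)
  have hbK : ∀ u, ‖f u‖ ≤ K := by
    intro u
    refine (hbound u).trans ?_
    have : (Set.Ici (0 : ℝ)).indicator (fun u => Real.exp (-(ε / 2) * u)) u ≤ 1 := by
      refine Set.indicator_apply_le' (fun hu => ?_) fun _ => zero_le_one
      have hu : 0 ≤ u := hu
      refine Real.exp_le_one_iff.2 ?_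
      have : 0 ≤ ε / 2 * u := by positivity
      linarith
    nlinarith
  have hint2 : Integrable fun u => ‖f u‖ ^ 2 := by
    refine (hinteg.norm.const_mul K).mono' (by fun_prop) (Eventually.of_forall fun u => ?_)
    rw [Real.norm_eq_abs, abs_of_nonneg (by positivity), sq]
    gcongr
    exact hbK u
  have hmem : MemLp f 2 := (memLp_two_iff_integrable_sq_norm hfm.aestronglyMeasurable).2 hint2
  have hft : ∀ ξ : ℝ, FourierTransform.fourier f ξ = (∫ x : ℝ, (χ x : ℂ) *
      Complex.exp (-(ε + 2 * Real.pi * ξ * Complex.I) * x)) *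
      (riemannZeta (s + (ε + 2 * Real.pi * ξ * Complex.I)))⁻¹ := by
    intro ξ
    rw [← hχ.integral_moebiusSum_mul_exp hs (by simpa using hε),
      Real.fourier_real_eq_integral_exp_smul]
    refine integral_congr_ae (Eventually.of_forall fun u => ?_)
    simp only [hf, smul_eq_mul]
    rw [Complex.ofReal_exp, mul_left_comm, ← Complex.exp_add]
    congr 2
    push_cast
    ring
  have hcont : Continuous (FourierTransform.fourier f) :=
    VectorFourier.fourierIntegral_continuous Real.continuous_fourierChar continuous_inner hinteg
  have hFint : Integrable fun ξ => ‖FourierTransform.fourier f ξ‖ ^ 2 := by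
    refine hg.mono' (by fun_prop) (Eventually.of_forall fun ξ => ?_)
    rw [Real.norm_eq_abs, abs_of_nonneg (by positivity), hft]
    exact H ξ
  have hsq : ∀ u, ‖f u‖ ^ 2 = moebiusSum χ s u ^ 2 * Real.exp (-(2 * ε) * u) := by
    intro u
    simp only [hf]
    rw [norm_mul, Complex.norm_real, Complex.norm_real, Real.norm_eq_abs, Real.norm_eq_abs,
      mul_pow, sq_abs, sq_abs, ← Real.exp_nat_mul]
    congr 2
    push_cast
    ring
  have hpl := integral_norm_sq_fourier_of_integrable hinteg hmem hFint
  simp only [hsq] at hpl hint2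
  refine ⟨hint2, hpl.le.trans (integral_mono hFint hg fun ξ => ?_)⟩
  simp only [hft]
  exact H ξ

end

/-- The indicator function of the nonnegative axis. -/
noncomputable def unitStep (x : ℝ) : ℝ := if 0 ≤ x then 1 else 0

/-- The piecewise linear function rising from `0` at `0` to `1` at `L`. -/
noncomputable def ramp (L x : ℝ) : ℝ := max 0 (min 1 (x / L))

lemma isCutoff_unitStep : IsCutoff unitStep where
  measurable := Measurable.ite measurableSet_Ici measurable_const measurable_const
  nonneg x := by unfold unitStep; split_ifs <;> norm_num
  le_one x := by unfold unitStep; split_ifs <;> norm_num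
  eq_zero x hx := by simp [unitStep, hx]

lemma continuous_ramp (L : ℝ) : Continuous (ramp L) := by
  unfold ramp; fun_prop

lemma isCutoff_ramp {L : ℝ} (hL : 0 < L) : IsCutoff (ramp L) where
  measurable := (continuous_ramp L).measurable
  nonneg _ := le_max_left _ _
  le_one _ := max_le zero_le_one (min_le_left _ _)
  eq_zero _ hx := max_eq_left ((min_le_right _ _).trans (div_neg_of_neg_of_pos hx hL).le)

lemma integral_unitStep_mul_exp {z : ℂ} (hz : 0 < z.re) :
    ∫ x : ℝ, (unitStep x : ℂ) * Complex.exp (-z * x) = 1 / z := by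
  have h1 : (fun x : ℝ => (unitStep x : ℂ) * Complex.exp (-z * x)) =
      (Set.Ici (0 : ℝ)).indicator fun x : ℝ => Complex.exp (-z * x) := by
    funext x
    by_cases hx : 0 ≤ x <;> simp [unitStep, hx]
  rw [h1, integral_indicator measurableSet_Ici, integral_Ici_eq_integral_Ioi,
    integral_exp_mul_complex_Ioi (by simpa using hz)]
  simp

lemma integral_ramp_mul_exp {L : ℝ} (hL : 0 < L) {z : ℂ} (hz : 0 < z.re) :
    ∫ x : ℝ, (ramp L x : ℂ) * Complex.exp (-z * x) =
      (1 - Complex.exp (-z * L)) / (L * z ^ 2) := by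
  have hz0 : z ≠ 0 := by rintro rfl; simp at hz
  have hL0 : (L : ℂ) ≠ 0 := by exact_mod_cast hL.ne'
  have hinteg := (isCutoff_ramp hL).integrable_mul_exp hz
  set f : ℝ → ℂ := fun x => (ramp L x : ℂ) * Complex.exp (-z * x) with hf
  have hneg : ∀ x ∈ Set.Iic (0 : ℝ), f x = 0 := by
    intro x hx
    have : ramp L x = 0 :=
      max_eq_left ((min_le_right _ _).trans (div_nonpos_of_nonpos_of_nonneg hx hL.le))
    simp [hf, this]
  have hmid : ∀ x ∈ Set.uIcc (0 : ℝ) L, f x = x / L * Complex.exp (-z * x) := by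
    intro x hx
    rw [Set.uIcc_of_le hL.le] at hx
    have : ramp L x = x / L := by
      have h1 : x / L ≤ 1 := by rw [div_le_one hL]; exact hx.2
      have h2 : 0 ≤ x / L := div_nonneg hx.1 hL.le
      rw [ramp, min_eq_right h1, max_eq_right h2]
    simp [hf, this]
  have hbig : ∀ x ∈ Set.Ioi L, f x = Complex.exp (-z * x) := by
    intro x hx
    have : ramp L x = 1 := by
      have h1 : 1 ≤ x / L := by rw [le_div_iff₀ hL, one_mul]; exact le_of_lt hx
      rw [ramp, min_eq_left h1, max_eq_right zero_le_one]
    simp [hf, this]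
  have hI : ∫ x in (0 : ℝ)..L, f x =
      -(L / (L * z) + 1 / (L * z ^ 2)) * Complex.exp (-z * L) + 1 / (L * z ^ 2) := by
    rw [intervalIntegral.integral_congr hmid]
    have hd : ∀ x ∈ Set.uIcc (0 : ℝ) L, HasDerivAt
        (fun x : ℝ => -(x / (L * z) + 1 / (L * z ^ 2)) * Complex.exp (-z * x))
        (x / L * Complex.exp (-z * x)) x := by
      intro x _
      have h1 : HasDerivAt (fun x : ℝ => (x : ℂ)) 1 x := Complex.ofRealCLM.hasDerivAt
      have h2 : HasDerivAt (fun x : ℝ => Complex.exp (-z * x))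
          (Complex.exp (-z * x) * (-z * 1)) x := (h1.const_mul (-z)).cexp
      have h3 := (((h1.div_const (L * z)).add_const (1 / (L * z ^ 2))).neg).mul h2
      refine h3.congr_deriv ?_
      change -(1 / (L * z)) * Complex.exp (-z * x) +
        -(x / (L * z) + 1 / (L * z ^ 2)) * (Complex.exp (-z * x) * (-z * 1)) = _
      generalize Complex.exp (-z * x) = E
      field_simp
      ring
    rw [intervalIntegral.integral_eq_sub_of_hasDerivAt hd
      (Continuous.intervalIntegrable (by fun_prop) _ _)]
    simp
  rw [← intervalIntegral.integral_Iic_add_Ioi (b := L) hinteg.integrableOn hinteg.integrableOn,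
    setIntegral_congr_fun measurableSet_Ioi hbig,
    integral_exp_mul_complex_Ioi (by simpa using hz)]
  have h4 : ∫ x in Set.Iic L, f x = ∫ x in (0 : ℝ)..L, f x := by
    rw [← intervalIntegral.integral_Iic_sub_Iic hinteg.integrableOn hinteg.integrableOn,
      setIntegral_congr_fun measurableSet_Iic hneg]
    simp
  rw [h4, hI]
  field_simp
  ring

lemma norm_one_sub_exp_le {z : ℂ} (hz : 0 ≤ z.re) :
    ‖1 - Complex.exp (-z)‖ ≤ 2 ∧ ‖1 - Complex.exp (-z)‖ ≤ 2 * ‖z‖ := by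
  have h1 : ‖1 - Complex.exp (-z)‖ ≤ 2 := by
    refine (norm_sub_le _ _).trans ?_
    rw [norm_one, Complex.norm_exp, Complex.neg_re]
    have : Real.exp (-z.re) ≤ 1 := Real.exp_le_one_iff.2 (by linarith)
    linarith
  refine ⟨h1, ?_⟩
  rcases le_total ‖z‖ 1 with h | h
  · have := Complex.norm_exp_sub_one_le (x := -z) (by rwa [norm_neg])
    rwa [norm_sub_rev, norm_neg] at this
  · linarith

lemma norm_integral_ramp_le {L : ℝ} (hL : 0 < L) {z : ℂ} (hz : 0 < z.re) :
    ‖∫ x : ℝ, (ramp L x : ℂ) * Complex.exp (-z * x)‖ ^ 2 ≤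
      8 / (1 + (L * ‖z‖) ^ 2) / ‖z‖ ^ 2 := by
  rw [integral_ramp_mul_exp hL hz]
  have hz0 : 0 < ‖z‖ := norm_pos_iff.2 (by rintro rfl; simp at hz)
  obtain ⟨h1, h2⟩ := norm_one_sub_exp_le (z := z * L)
    (by simp only [Complex.mul_re, Complex.ofReal_re, Complex.ofReal_im]; nlinarith)
  have hn : ‖z * L‖ = L * ‖z‖ := by
    rw [norm_mul, Complex.norm_real, Real.norm_eq_abs, abs_of_pos hL, mul_comm]
  rw [hn, ← neg_mul] at h2
  rw [← neg_mul] at h1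
  set t := L * ‖z‖ with ht
  have ht0 : 0 < t := by positivity
  set q := ‖1 - Complex.exp (-z * L)‖
  have hq0 : 0 ≤ q := norm_nonneg _
  have h3 : ‖(1 - Complex.exp (-z * L)) / (L * z ^ 2)‖ = q / t / ‖z‖ := by
    rw [norm_div, norm_mul, norm_pow, Complex.norm_real, Real.norm_eq_abs, abs_of_pos hL, ht]
    change q / _ = _
    field_simp
  rw [h3, div_pow, div_pow]
  refine div_le_div_of_nonneg_right ?_ (by positivity)
  rw [div_le_div_iff₀ (by positivity) (by positivity)]
  nlinarith [mul_self_le_mul_self hq0 h1, mul_self_le_mul_self hq0 h2]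

lemma exists_norm_inv_riemannZeta_sq_le : ∃ C : ℝ, 0 < C ∧ ∀ ε₀ ε ξ : ℝ, 0 ≤ ε₀ → ε₀ ≤ ε →
    0 < ε → ε ≤ 1 / 2 →
    (‖(ε + 2 * Real.pi * ξ * Complex.I : ℂ)‖ ^ 2)⁻¹ *
      ‖(riemannZeta ((1 + ε₀ : ℝ) + (ε + 2 * Real.pi * ξ * Complex.I)))⁻¹‖ ^ 2 ≤
      C * (1 + ξ ^ 2) ^ (-(3 / 4) : ℝ) := by
  obtain ⟨C, hC, H⟩ := exists_norm_inv_mul_riemannZeta_sq_le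
  refine ⟨4 * C, by positivity, fun ε₀ ε ξ h0 h1 h2 h3 => ?_⟩
  set z : ℂ := ε + 2 * Real.pi * ξ * Complex.I with hz
  have hzre : z.re = ε := by simp [hz]
  have hzim : z.im = 2 * Real.pi * ξ := by simp [hz]
  have hw := H (ε₀ + z) (by simp [hzre]; linarith) (by simp [hzre]; linarith)
  have hwz : ‖(ε₀ : ℂ) + z‖ ≤ 2 * ‖z‖ := by
    refine (norm_add_le _ _).trans ?_
    rw [Complex.norm_real, Real.norm_eq_abs, abs_of_nonneg h0]
    have := Complex.abs_re_le_norm z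
    rw [hzre, abs_of_pos h2] at this
    linarith
  have hw0 : 0 < ‖(ε₀ : ℂ) + z‖ := by
    refine norm_pos_iff.2 fun h => ?_
    have := congrArg Complex.re h
    simp [hzre] at this
    linarith
  have hz0 : 0 < ‖z‖ := by linarith
  have harg : (((1 + ε₀ : ℝ) : ℂ) + z) = 1 + (ε₀ + z) := by push_cast; ring
  rw [harg]
  rw [norm_inv, norm_mul, mul_inv, mul_pow] at hw
  have him : ((ε₀ : ℂ) + z).im = 2 * Real.pi * ξ := by simp [hzim]
  rw [him] at hw
  calc _ ≤ (4 * (‖(ε₀ : ℂ) + z‖⁻¹) ^ 2) * ‖(riemannZeta (1 + (ε₀ + z)))⁻¹‖ ^ 2 := by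
        gcongr
        rw [inv_pow, inv_le_iff_one_le_mul₀ (by positivity), ← div_eq_mul_inv, mul_comm,
          ← mul_div_assoc, le_div_iff₀ (by positivity)]
        nlinarith
    _ = 4 * ((‖(ε₀ : ℂ) + z‖⁻¹) ^ 2 * ‖(riemannZeta (1 + (ε₀ + z)))⁻¹‖ ^ 2) := by ring
    _ ≤ 4 * (C * (1 + (2 * Real.pi * ξ) ^ 2) ^ (-(3 / 4) : ℝ)) := by
        rw [norm_inv (riemannZeta _)]
        exact mul_le_mul_of_nonneg_left hw (by norm_num)
    _ ≤ 4 * (C * (1 + ξ ^ 2) ^ (-(3 / 4) : ℝ)) := by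
        gcongr 4 * (C * ?_)
        refine Real.rpow_le_rpow_of_nonpos (by positivity) ?_ (by norm_num)
        have := Real.pi_gt_three
        have h5 : 1 ≤ (2 * Real.pi) ^ 2 := one_le_pow₀ (by linarith)
        rw [mul_pow]
        nlinarith [sq_nonneg ξ]
    _ = _ := by ring

lemma exists_integral_moebiusSum_sq_le : ∃ C : ℝ, 0 < C ∧ ∀ ε₀ ε : ℝ, 0 ≤ ε₀ → ε₀ ≤ ε →
    0 < ε → ε ≤ 1 / 2 →
    (Integrable (fun u => moebiusSum unitStep (1 + ε₀) u ^ 2 * Real.exp (-(2 * ε) * u)) ∧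
      ∫ u, moebiusSum unitStep (1 + ε₀) u ^ 2 * Real.exp (-(2 * ε) * u) ≤ C) ∧
    ∀ L : ℝ, 0 < L →
      (Integrable (fun u => moebiusSum (ramp L) (1 + ε₀) u ^ 2 * Real.exp (-(2 * ε) * u)) ∧
      ∫ u, moebiusSum (ramp L) (1 + ε₀) u ^ 2 * Real.exp (-(2 * ε) * u) ≤ C / L) := by
  obtain ⟨C, hC, H⟩ := exists_norm_inv_riemannZeta_sq_le
  have hg0 : Integrable fun ξ : ℝ => (1 + ξ ^ 2) ^ (-(3 / 4) : ℝ) := by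
    have := integrable_rpow_neg_one_add_norm_sq (E := ℝ) (μ := volume) (r := 3 / 2)
      (by norm_num)
    convert! this using 3
    · rw [Real.norm_eq_abs, sq_abs]
    · norm_num
  set I := ∫ ξ : ℝ, (1 + ξ ^ 2) ^ (-(3 / 4) : ℝ) with hI
  have hI0 : 0 ≤ I := integral_nonneg fun ξ => by positivity
  refine ⟨max 1 (max (C * I) (8 * C * Real.pi)), by positivity, fun ε₀ ε h0 h1 h2 h3 => ?_⟩
  have hzre : ∀ ξ : ℝ, 0 < (ε + 2 * Real.pi * ξ * Complex.I : ℂ).re := by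
    intro ξ; simpa using h2
  constructor
  · have := isCutoff_unitStep.integral_moebiusSum_sq_le (s := 1 + ε₀) (by linarith) h2
      (g := fun ξ => C * (1 + ξ ^ 2) ^ (-(3 / 4) : ℝ)) (hg0.const_mul C) ?_
    · refine ⟨this.1, this.2.trans ?_⟩
      rw [integral_const_mul, ← hI]
      exact (le_max_left _ _).trans (le_max_right _ _)
    · intro ξ
      refine le_trans (le_of_eq ?_) (H ε₀ ε ξ h0 h1 h2 h3)
      rw [integral_unitStep_mul_exp (hzre ξ), norm_mul, mul_pow, norm_div, norm_one, one_div,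
        inv_pow]
  · intro L hL
    have hgL : Integrable fun ξ : ℝ => 8 * C * (1 + (L * ξ) ^ 2)⁻¹ :=
      (integrable_inv_one_add_sq.comp_mul_left' hL.ne').const_mul _
    have := (isCutoff_ramp hL).integral_moebiusSum_sq_le (s := 1 + ε₀) (by linarith) h2
      (g := fun ξ => 8 * C * (1 + (L * ξ) ^ 2)⁻¹) hgL ?_
    · refine ⟨this.1, this.2.trans ?_⟩
      rw [integral_const_mul, Measure.integral_comp_mul_left (fun x : ℝ => (1 + x ^ 2)⁻¹),
        integral_univ_inv_one_add_sq, smul_eq_mul, abs_of_pos (by positivity),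
        le_div_iff₀ hL]
      refine le_trans (le_of_eq ?_) ((le_max_right _ _).trans (le_max_right _ _))
      field_simp
    · intro ξ
      have hb := norm_integral_ramp_le hL (hzre ξ)
      have hz := H ε₀ ε ξ h0 h1 h2 h3
      have him := Complex.abs_im_le_norm (ε + 2 * Real.pi * ξ * Complex.I : ℂ)
      rw [norm_mul, mul_pow]
      set z : ℂ := ε + 2 * Real.pi * ξ * Complex.I with hzdef
      have hzim : z.im = 2 * Real.pi * ξ := by simp [hzdef]
      have hξ : |ξ| ≤ ‖z‖ := by
        rw [hzim, abs_mul, abs_of_pos (by positivity)] at him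
        have := Real.pi_gt_three
        nlinarith [abs_nonneg ξ]
      have h5 : (1 + ξ ^ 2) ^ (-(3 / 4) : ℝ) ≤ 1 :=
        Real.rpow_le_one_of_one_le_of_nonpos (by nlinarith [sq_nonneg ξ]) (by norm_num)
      calc _ ≤ 8 / (1 + (L * ‖z‖) ^ 2) / ‖z‖ ^ 2 *
            ‖(riemannZeta ((1 + ε₀ : ℝ) + z))⁻¹‖ ^ 2 := by gcongr
        _ = 8 / (1 + (L * ‖z‖) ^ 2) * ((‖z‖ ^ 2)⁻¹ *
            ‖(riemannZeta ((1 + ε₀ : ℝ) + z))⁻¹‖ ^ 2) := by ring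
        _ ≤ 8 / (1 + (L * |ξ|) ^ 2) * (C * 1) := by
          refine mul_le_mul ?_ (hz.trans (by gcongr)) (by positivity) (by positivity)
          gcongr
        _ = _ := by rw [mul_pow, sq_abs, ← mul_pow]; ring

lemma sq_integral_le {f : ℝ → ℝ} {a b : ℝ} (hab : a ≤ b) (hf : IntervalIntegrable f volume a b)
    (hf2 : IntervalIntegrable (fun x => f x ^ 2) volume a b) :
    (∫ x in a..b, f x) ^ 2 ≤ (b - a) * ∫ x in a..b, f x ^ 2 := by
  rcases hab.eq_or_lt with rfl | hab
  · simp
  set A := ∫ x in a..b, f x with hA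
  set m := A / (b - a) with hm
  have hba : 0 < b - a := sub_pos.2 hab
  have h : 0 ≤ ∫ x in a..b, (f x - m) ^ 2 :=
    intervalIntegral.integral_nonneg hab.le fun x _ => sq_nonneg _
  have h2 : ∫ x in a..b, (f x - m) ^ 2 = (∫ x in a..b, f x ^ 2) - 2 * m * A + m ^ 2 * (b - a) := by
    have : ∀ x, (f x - m) ^ 2 = f x ^ 2 - 2 * m * f x + m ^ 2 := fun x => by ring
    simp only [this]
    rw [intervalIntegral.integral_add (hf2.sub (hf.const_mul _)) (by simp),
      intervalIntegral.integral_sub hf2 (hf.const_mul _), intervalIntegral.integral_const_mul,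
      intervalIntegral.integral_const, smul_eq_mul, hA]
    ring
  have h3 : m * (b - a) = A := by rw [hm]; field_simp
  rw [h2] at h
  nlinarith

lemma measurable_unitStep : Measurable unitStep := isCutoff_unitStep.measurable

lemma intervalIntegrable_unitStep (a b : ℝ) : IntervalIntegrable unitStep volume a b := by
  refine (intervalIntegrable_const (c := (1 : ℝ))).mono_fun' measurable_unitStep.aestronglyMeasurable
    (Eventually.of_forall fun x => ?_)
  simp only
  rw [Real.norm_eq_abs, abs_of_nonneg (isCutoff_unitStep.nonneg x)]
  exact isCutoff_unitStep.le_one x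

lemma integral_unitStep (x : ℝ) : ∫ t in (0 : ℝ)..x, unitStep t = max x 0 := by
  rcases le_total 0 x with hx | hx
  · rw [max_eq_left hx, intervalIntegral.integral_congr (g := fun _ => 1)]
    · simp
    · intro t ht
      rw [Set.uIcc_of_le hx] at ht
      simp [unitStep, ht.1]
  · rw [max_eq_right hx]
    refine intervalIntegral.integral_zero_ae ?_
    filter_upwards [Measure.ae_ne volume (0 : ℝ)] with t ht htx
    rw [Set.uIoc_of_ge hx] at htx
    have : t < 0 := lt_of_le_of_ne htx.2 ht
    simp [unitStep, this]

lemma ramp_eq_integral {L : ℝ} (hL : 0 < L) (x : ℝ) :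
    ramp L x = L⁻¹ * ∫ t in (x - L)..x, unitStep t := by
  rw [← intervalIntegral.integral_interval_sub_left (intervalIntegrable_unitStep 0 _)
    (intervalIntegrable_unitStep 0 _), integral_unitStep, integral_unitStep, ramp]
  rcases le_total x 0 with h1 | h1
  · rw [max_eq_right h1, max_eq_right (by linarith : x - L ≤ 0),
      min_eq_right (by rw [div_le_one hL]; linarith),
      max_eq_left (div_nonpos_of_nonpos_of_nonneg h1 hL.le)]
    simp
  · have h3 : 0 ≤ x / L := by positivity
    rw [max_eq_left h1]
    rcases le_total x L with h2 | h2
    · rw [max_eq_right (by linarith : x - L ≤ 0), min_eq_right (by rwa [div_le_one hL]),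
        max_eq_right h3]
      field_simp
      ring
    · rw [max_eq_left (by linarith : 0 ≤ x - L), min_eq_left (by rwa [le_div_iff₀ hL, one_mul]),
        max_eq_right zero_le_one]
      field_simp
      ring

lemma intervalIntegrable_sum_mul_unitStep {ι : Type*} (S : Finset ι) (w b : ι → ℝ) (x y : ℝ) :
    IntervalIntegrable (fun t => ∑ i ∈ S, w i * unitStep (t - b i)) volume x y := by
  have : IntervalIntegrable (∑ i ∈ S, fun t => w i * unitStep (t - b i)) volume x y := by
    refine IntervalIntegrable.sum S fun i _ => ?_
    refine IntervalIntegrable.const_mul ?_ _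
    simpa using (intervalIntegrable_unitStep (x - b i) (y - b i)).comp_sub_right (b i)
  convert this using 1
  funext t
  simp

lemma sum_mul_ramp {ι : Type*} (S : Finset ι) (w b : ι → ℝ) {L : ℝ} (hL : 0 < L) (u : ℝ) :
    ∑ i ∈ S, w i * ramp L (u - b i) =
      L⁻¹ * ∫ t in (u - L)..u, ∑ i ∈ S, w i * unitStep (t - b i) := by
  rw [intervalIntegral.integral_finsetSum, Finset.mul_sum]
  · refine Finset.sum_congr rfl fun i _ => ?_
    rw [ramp_eq_integral hL, intervalIntegral.integral_const_mul,
      intervalIntegral.integral_comp_sub_right (fun t => unitStep t)]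
    rw [show u - L - b i = u - b i - L by ring]
    ring
  · intro i _
    have := intervalIntegrable_sum_mul_unitStep {i} w b (u - L) u
    simpa using this

lemma moebiusSum_ramp_eq {s L : ℝ} (hL : 0 < L) (u : ℝ) :
    moebiusSum (ramp L) s u = L⁻¹ * ∫ t in (u - L)..u, moebiusSum unitStep s t := by
  rw [(isCutoff_ramp hL).moebiusSum_eq_sum (S := Finset.range (⌊Real.exp u⌋₊ + 1)), sum_mul_ramp]
  · congr 1
    refine intervalIntegral.integral_congr fun t ht => ?_
    rw [Set.uIcc_of_le (by linarith)] at ht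
    refine (isCutoff_unitStep.moebiusSum_eq_sum fun c _ hc => ?_).symm
    rw [Finset.mem_range, Nat.lt_succ_iff]
    exact Nat.le_floor (hc.trans (Real.exp_le_exp.2 ht.2))
  · exact hL
  · intro c _ hc
    rw [Finset.mem_range, Nat.lt_succ_iff]
    exact Nat.le_floor hc

section
variable {χ : ℝ → ℝ} {s : ℝ}

lemma IsCutoff.abs_moebiusSum_le' (hχ : IsCutoff χ) (hs : 1 ≤ s) (u : ℝ) :
    |moebiusSum χ s u| ≤ 2 + |u| := by
  rcases lt_or_ge u 0 with hu | hu
  · rw [hχ.moebiusSum_eq_zero hu, abs_zero]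
    positivity
  · rw [abs_of_nonneg hu]
    exact hχ.abs_moebiusSum_le hs hu

lemma IsCutoff.intervalIntegrable_moebiusSum (hχ : IsCutoff χ) (hs : 1 ≤ s) (a b : ℝ) :
    IntervalIntegrable (moebiusSum χ s) volume a b := by
  have : Continuous fun u : ℝ => 2 + |u| := by fun_prop
  exact (this.intervalIntegrable a b).mono_fun' hχ.measurable_moebiusSum.aestronglyMeasurable
    (Eventually.of_forall fun u => hχ.abs_moebiusSum_le' hs u)

lemma IsCutoff.intervalIntegrable_moebiusSum_sq (hχ : IsCutoff χ) (hs : 1 ≤ s) (a b : ℝ) :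
    IntervalIntegrable (fun u => moebiusSum χ s u ^ 2) volume a b := by
  have : Continuous fun u : ℝ => (2 + |u|) ^ 2 := by fun_prop
  refine (this.intervalIntegrable a b).mono_fun'
    (hχ.measurable_moebiusSum.pow_const 2).aestronglyMeasurable
    (Eventually.of_forall fun u => ?_)
  simp only
  rw [Real.norm_eq_abs, abs_pow]
  have := hχ.abs_moebiusSum_le' hs u
  gcongr

lemma IsCutoff.integral_sq_le (hχ : IsCutoff χ) (hs : 1 ≤ s) {ε P C : ℝ} (hε : 0 < ε)
    (hεP : 2 * ε * P ≤ 1)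
    (hinteg : Integrable (fun u => moebiusSum χ s u ^ 2 * Real.exp (-(2 * ε) * u)))
    (hC : ∫ u, moebiusSum χ s u ^ 2 * Real.exp (-(2 * ε) * u) ≤ C) {a b : ℝ} (hab : a ≤ b)
    (hb : b ≤ P) : ∫ u in a..b, moebiusSum χ s u ^ 2 ≤ 3 * C := by
  have h1 : ∫ u in a..b, moebiusSum χ s u ^ 2 ≤
      ∫ u in a..b, 3 * (moebiusSum χ s u ^ 2 * Real.exp (-(2 * ε) * u)) := by
    refine intervalIntegral.integral_mono_on hab (hχ.intervalIntegrable_moebiusSum_sq hs a b)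
      (hinteg.intervalIntegrable.const_mul 3) fun u hu => ?_
    have h2 : Real.exp (-1) ≤ Real.exp (-(2 * ε) * u) := by
      refine Real.exp_le_exp.2 ?_
      have : u ≤ P := hu.2.trans hb
      nlinarith
    have h3 : 1 ≤ 3 * Real.exp (-1) := by
      have h4 : Real.exp 1 * Real.exp (-1) = 1 := by rw [← Real.exp_add]; simp
      have h5 := Real.exp_one_lt_d9
      nlinarith [Real.exp_pos (-1)]
    nlinarith [sq_nonneg (moebiusSum χ s u)]
  refine h1.trans ?_
  rw [intervalIntegral.integral_const_mul]
  refine mul_le_mul_of_nonneg_left ?_ (by norm_num)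
  rw [intervalIntegral.integral_of_le hab]
  exact (setIntegral_le_integral hinteg (Eventually.of_forall fun u => by positivity)).trans hC

lemma half_inv_le_log {k : ℕ} :
    (2 * ((k : ℝ) + 1))⁻¹ ≤ Real.log (k + 2) - Real.log (k + 1) ∧
    Real.log (k + 2) - Real.log (k + 1) ≤ ((k : ℝ) + 1)⁻¹ := by
  have hk : (0 : ℝ) ≤ k := Nat.cast_nonneg k
  rw [← Real.log_div (by positivity) (by positivity)]
  constructor
  · have := Real.one_sub_inv_le_log_of_pos (show 0 < ((k : ℝ) + 2) / (k + 1) by positivity)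
    refine le_trans ?_ this
    rw [inv_div, ← one_div, div_le_iff₀ (by positivity)]
    have h : 0 < (k : ℝ) + 2 := by positivity
    field_simp
    nlinarith
  · have := Real.log_le_sub_one_of_pos (show 0 < ((k : ℝ) + 2) / (k + 1) by positivity)
    refine this.trans (le_of_eq ?_)
    field_simp
    ring

/-- Comparison of a weighted sum over integers with an integral. -/
lemma sum_inv_mul_sq_le {f : ℝ → ℝ} {P : ℝ}
    (hf2 : ∀ a b, IntervalIntegrable (fun u => f u ^ 2) volume a b) {δ : ℕ → ℝ} (N : ℕ)
    (H : ∀ k < N, ∀ u ∈ Set.Icc (P - Real.log (k + 2)) (P - Real.log (k + 1)),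
      (f (P - Real.log (k + 1)) - f u) ^ 2 ≤ δ k) :
    ∑ k ∈ Finset.range N, ((k : ℝ) + 1)⁻¹ * f (P - Real.log (k + 1)) ^ 2 ≤
      4 * (∫ u in (P - Real.log (N + 1))..P, f u ^ 2) +
      4 * ∑ k ∈ Finset.range N, (Real.log (k + 2) - Real.log (k + 1)) * δ k := by
  have h1 : ∀ k < N, ((k : ℝ) + 1)⁻¹ * f (P - Real.log (k + 1)) ^ 2 ≤
      4 * (∫ u in (P - Real.log (k + 2))..(P - Real.log (k + 1)), f u ^ 2) +
      4 * ((Real.log (k + 2) - Real.log (k + 1)) * δ k) := by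
    intro k hk
    obtain ⟨hl, -⟩ := half_inv_le_log (k := k)
    have hab : P - Real.log (k + 2) ≤ P - Real.log (k + 1) := by
      have : (0 : ℝ) ≤ (2 * ((k : ℝ) + 1))⁻¹ := by positivity
      linarith
    have h2 : ∫ _u in (P - Real.log (k + 2))..(P - Real.log (k + 1)),
        f (P - Real.log (k + 1)) ^ 2 ≤
        ∫ u in (P - Real.log (k + 2))..(P - Real.log (k + 1)), (2 * f u ^ 2 + 2 * δ k) := by
      refine intervalIntegral.integral_mono_on hab (by simp)
        (((hf2 _ _).const_mul 2).add (by simp)) fun u hu => ?_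
      have := H k hk u hu
      nlinarith [sq_nonneg (f (P - Real.log (k + 1)) - 2 * f u)]
    rw [intervalIntegral.integral_add ((hf2 _ _).const_mul 2) (by simp),
      intervalIntegral.integral_const_mul, intervalIntegral.integral_const,
      intervalIntegral.integral_const, smul_eq_mul, smul_eq_mul] at h2
    have h3 : ((k : ℝ) + 1)⁻¹ ≤ 2 * (Real.log (k + 2) - Real.log (k + 1)) := by
      rw [mul_inv] at hl
      linarith
    have h4 := mul_le_mul_of_nonneg_right h3 (sq_nonneg (f (P - Real.log (k + 1))))
    linarith
  refine (Finset.sum_le_sum fun k hk => h1 k (Finset.mem_range.1 hk)).trans ?_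
  rw [Finset.sum_add_distrib, ← Finset.mul_sum, ← Finset.mul_sum]
  refine add_le_add_left (mul_le_mul_of_nonneg_left (le_of_eq ?_) (by norm_num)) _
  have h5 := intervalIntegral.sum_integral_adjacent_intervals (μ := volume) (n := N)
    (f := fun u => f u ^ 2) (a := fun k : ℕ => P - Real.log (k + 1)) fun k _ => hf2 _ _
  simp only [Nat.cast_zero, zero_add, Real.log_one, sub_zero] at h5
  rw [intervalIntegral.integral_symm, ← h5, ← Finset.sum_neg_distrib]
  refine Finset.sum_congr rfl fun k _ => ?_
  rw [intervalIntegral.integral_symm]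
  push_cast
  rw [show (k : ℝ) + 1 + 1 = k + 2 by ring]

end

lemma sum_range_inv_cube_le (N : ℕ) :
    ∑ k ∈ Finset.range N, (((k : ℝ) + 1) ^ 3)⁻¹ ≤ 3 - 2 / ((N : ℝ) + 1) := by
  induction N with
  | zero => norm_num
  | succ N ih =>
    rw [Finset.sum_range_succ]
    have hN : (0 : ℝ) ≤ N := Nat.cast_nonneg N
    have h : (((N : ℝ) + 1) ^ 3)⁻¹ + 2 / ((N : ℝ) + 2) ≤ 2 / ((N : ℝ) + 1) := by
      have h2 : 0 < (N : ℝ) + 2 := by positivity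
      rw [← one_div, div_add_div _ _ (by positivity) h2.ne', div_le_div_iff₀ (by positivity)
        (by positivity)]
      nlinarith [mul_nonneg hN hN, pow_nonneg hN 3]
    push_cast
    rw [show (N : ℝ) + 1 + 1 = N + 2 by ring]
    linarith

lemma sum_range_succ_cast_le (N : ℕ) : ∑ k ∈ Finset.range N, ((k : ℝ) + 1) ≤ (N : ℝ) ^ 2 := by
  induction N with
  | zero => simp
  | succ N ih =>
    rw [Finset.sum_range_succ]
    push_cast
    nlinarith [Nat.cast_nonneg (α := ℝ) N]

lemma abs_moebiusSum_unitStep_sub_le {s : ℝ} (hs : 1 ≤ s) {u b : ℝ} (hub : u ≤ b) :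
    |moebiusSum unitStep s b - moebiusSum unitStep s u| ≤
      Real.exp (b - u) - 1 + Real.exp (-u) := by
  have hexp : Real.exp u ≤ Real.exp b := Real.exp_le_exp.2 hub
  have hS : ∀ c : ℕ, 0 < c → (c : ℝ) ≤ Real.exp b → c ∈ Finset.range (⌊Real.exp b⌋₊ + 1) := by
    intro c _ hc
    rw [Finset.mem_range, Nat.lt_succ_iff]
    exact Nat.le_floor hc
  rw [isCutoff_unitStep.moebiusSum_eq_sum hS,
    isCutoff_unitStep.moebiusSum_eq_sum fun c h0 hc => hS c h0 (hc.trans hexp),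
    ← Finset.sum_sub_distrib]
  have hsub : Finset.Ioc ⌊Real.exp u⌋₊ ⌊Real.exp b⌋₊ ⊆ Finset.range (⌊Real.exp b⌋₊ + 1) := by
    intro c hc
    rw [Finset.mem_Ioc] at hc
    rw [Finset.mem_range]
    omega
  rw [← Finset.sum_subset hsub]
  · refine (Finset.abs_sum_le_sum_abs _ _).trans ?_
    have h1 : ∀ c ∈ Finset.Ioc ⌊Real.exp u⌋₊ ⌊Real.exp b⌋₊,
        |(ArithmeticFunction.moebius c : ℝ) * (c : ℝ) ^ (-s) * unitStep (b - Real.log c) -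
          (ArithmeticFunction.moebius c : ℝ) * (c : ℝ) ^ (-s) * unitStep (u - Real.log c)| ≤
          Real.exp (-u) := by
      intro c hc
      rw [Finset.mem_Ioc] at hc
      have hcu : Real.exp u < c := (Nat.floor_lt (Real.exp_pos u).le).1 hc.1
      have hc0 : 0 < c := by omega
      have hc1 : (1 : ℝ) ≤ c := by exact_mod_cast hc0
      have hlog : u < Real.log c := by
        have := Real.log_lt_log (Real.exp_pos u) hcu
        rwa [Real.log_exp] at this
      rw [isCutoff_unitStep.eq_zero _ (by linarith : u - Real.log c < 0), mul_zero, sub_zero,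
        abs_mul, abs_mul, abs_of_nonneg (isCutoff_unitStep.nonneg _),
        abs_of_nonneg (Real.rpow_nonneg (Nat.cast_nonneg c) _)]
      have h3 : |(ArithmeticFunction.moebius c : ℝ)| ≤ 1 := by
        exact_mod_cast ArithmeticFunction.abs_moebius_le_one
      have h4 : (c : ℝ) ^ (-s) ≤ (c : ℝ)⁻¹ := by
        rw [← Real.rpow_neg_one]
        exact Real.rpow_le_rpow_of_exponent_le hc1 (by linarith)
      calc _ ≤ 1 * (c : ℝ)⁻¹ * 1 := by
            gcongr
            · exact isCutoff_unitStep.nonneg _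
            · exact isCutoff_unitStep.le_one _
        _ = (c : ℝ)⁻¹ := by ring
        _ ≤ (Real.exp u)⁻¹ := by gcongr
        _ = _ := (Real.exp_neg u).symm
    refine (Finset.sum_le_card_nsmul _ _ _ h1).trans ?_
    rw [Nat.card_Ioc, nsmul_eq_mul, Nat.cast_sub (Nat.floor_mono hexp)]
    have h5 := Nat.floor_le (Real.exp_pos b).le
    have h6 := Nat.lt_floor_add_one (Real.exp u)
    calc _ ≤ (Real.exp b - Real.exp u + 1) * Real.exp (-u) := by
          gcongr
          linarith
      _ = _ := by
        have h7 : Real.exp u * Real.exp (-u) = 1 := by rw [← Real.exp_add]; simp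
        rw [sub_eq_add_neg b u, Real.exp_add]
        linear_combination -h7
  · intro c hc hc'
    rw [Finset.mem_range, Nat.lt_succ_iff] at hc
    rw [Finset.mem_Ioc, not_and_or] at hc'
    rcases Nat.eq_zero_or_pos c with rfl | hc0
    · simp
    have hcu : c ≤ ⌊Real.exp u⌋₊ := by omega
    have h1 : (c : ℝ) ≤ Real.exp u := (Nat.le_floor_iff (Real.exp_pos u).le).1 hcu
    have h2 : Real.log c ≤ u := by
      have := Real.log_le_log (by exact_mod_cast hc0) h1
      rwa [Real.log_exp] at this
    simp [unitStep, h2, h2.trans hub]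

lemma sum_Icc_one_eq_sum_range (f : ℕ → ℝ) (N : ℕ) :
    ∑ j ∈ Finset.Icc 1 N, f j = ∑ k ∈ Finset.range N, f (k + 1) := by
  rw [Finset.range_eq_Ico, Finset.sum_Ico_add' f 0 N 1, zero_add]
  rfl

lemma moebiusSum_ramp_sub_sq_le {s L : ℝ} (hs : 1 ≤ s) (hL : 0 < L) {a u b : ℝ} (hau : a ≤ u)
    (hub : u ≤ b) : (moebiusSum (ramp L) s b - moebiusSum (ramp L) s u) ^ 2 ≤
      2 * (L ^ 2)⁻¹ * (b - a) * ((∫ t in a..b, moebiusSum unitStep s t ^ 2) +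
        ∫ t in (a - L)..(b - L), moebiusSum unitStep s t ^ 2) := by
  have hi := isCutoff_unitStep.intervalIntegrable_moebiusSum hs
  have hi2 := isCutoff_unitStep.intervalIntegrable_moebiusSum_sq hs
  set M := moebiusSum unitStep s with hM
  have h1 : moebiusSum (ramp L) s b - moebiusSum (ramp L) s u =
      L⁻¹ * ((∫ t in u..b, M t) - ∫ t in (u - L)..(b - L), M t) := by
    rw [moebiusSum_ramp_eq hL, moebiusSum_ramp_eq hL, ← mul_sub]
    congr 1
    rw [intervalIntegral.integral_interval_sub_interval_comm' (hi _ _) (hi _ _) (hi _ _)]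
  have h2 := sq_integral_le hub (hi u b) (hi2 u b)
  have h3 := sq_integral_le (show u - L ≤ b - L by linarith) (hi _ _) (hi2 _ _)
  have h4 : ∀ c, ∫ t in (u - c)..(b - c), M t ^ 2 ≤ ∫ t in (a - c)..(b - c), M t ^ 2 := fun c =>
    intervalIntegral.integral_mono_interval (by linarith) (by linarith) le_rfl
      (Eventually.of_forall fun t => sq_nonneg _) (hi2 _ _)
  have h5 := h4 L
  have h6 := h4 0
  simp only [sub_zero] at h6
  have h7 : ∀ c, 0 ≤ ∫ t in (u - c)..(b - c), M t ^ 2 := fun c =>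
    intervalIntegral.integral_nonneg (by linarith) fun t _ => sq_nonneg _
  have h8 := h7 L
  have h9 := h7 0
  simp only [sub_zero] at h9
  rw [h1, mul_pow, inv_pow]
  set A := ∫ t in u..b, M t
  set B := ∫ t in (u - L)..(b - L), M t
  have h10 : (A - B) ^ 2 ≤ 2 * (b - a) * ((∫ t in a..b, M t ^ 2) +
      ∫ t in (a - L)..(b - L), M t ^ 2) := by
    have e1 : (b - u) * (∫ t in u..b, M t ^ 2) ≤ (b - a) * ∫ t in a..b, M t ^ 2 := by
      gcongr
      linarith
    have e2 : (b - L - (u - L)) * (∫ t in (u - L)..(b - L), M t ^ 2) ≤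
        (b - a) * ∫ t in (a - L)..(b - L), M t ^ 2 :=
      mul_le_mul (by linarith) h5 h8 (by linarith)
    nlinarith [sq_nonneg (A + B)]
  calc _ ≤ (L ^ 2)⁻¹ * (2 * (b - a) * ((∫ t in a..b, M t ^ 2) +
      ∫ t in (a - L)..(b - L), M t ^ 2)) := by gcongr
    _ = _ := by ring

lemma exists_sum_moebiusSum_sq_le : ∃ C : ℝ, 0 < C ∧ ∀ P ε₀ : ℝ, 0 ≤ P → 0 ≤ ε₀ →
    ε₀ ≤ 1 / (2 * (1 + P)) →
    ∑ j ∈ Finset.Icc 1 ⌊Real.exp P⌋₊,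
      (j : ℝ) ^ (-(1 + ε₀)) * moebiusSum unitStep (1 + ε₀) (P - Real.log j) ^ 2 ≤ C ∧
    ∀ L : ℝ, 1 ≤ L → ∑ j ∈ Finset.Icc 1 ⌊Real.exp P⌋₊,
      (j : ℝ) ^ (-(1 + ε₀)) * moebiusSum (ramp L) (1 + ε₀) (P - Real.log j) ^ 2 ≤ C / L := by
  obtain ⟨C, hC, H⟩ := exists_integral_moebiusSum_sq_le
  refine ⟨60 * C + 56, by positivity, fun P ε₀ hP h0 h1 => ?_⟩
  set ε := 1 / (2 * (1 + P)) with hε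
  have hε0 : 0 < ε := by positivity
  have hε1 : ε ≤ 1 / 2 := by
    rw [hε]
    exact one_div_le_one_div_of_le (by norm_num) (by linarith)
  have hεP : 2 * ε * P ≤ 1 := by
    have : 2 * ε * P = P / (1 + P) := by rw [hε]; field_simp
    rw [this, div_le_one (by positivity)]
    linarith
  obtain ⟨⟨hi, hle⟩, HL⟩ := H ε₀ ε h0 h1 hε0 hε1
  set s := 1 + ε₀ with hs
  have hs1 : 1 ≤ s := by linarith
  set N := ⌊Real.exp P⌋₊ with hN
  have hNP : (N : ℝ) ≤ Real.exp P := Nat.floor_le (Real.exp_pos P).le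
  have hlogN : P - Real.log (N + 1) ≤ P := by
    have := Real.log_nonneg (show (1 : ℝ) ≤ (N : ℝ) + 1 by
      have := Nat.cast_nonneg (α := ℝ) N
      linarith)
    linarith
  have hpow : ∀ f : ℝ → ℝ, ∑ j ∈ Finset.Icc 1 N, (j : ℝ) ^ (-s) * f (P - Real.log j) ^ 2 ≤
      ∑ k ∈ Finset.range N, ((k : ℝ) + 1)⁻¹ * f (P - Real.log (k + 1)) ^ 2 := by
    intro f
    rw [sum_Icc_one_eq_sum_range (fun j => (j : ℝ) ^ (-s) * f (P - Real.log j) ^ 2)]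
    push_cast
    gcongr with k _
    rw [← Real.rpow_neg_one]
    have := Nat.cast_nonneg (α := ℝ) k
    exact Real.rpow_le_rpow_of_exponent_le (by linarith) (by linarith)
  have hmain := fun a b (hab : a ≤ b) (hb : b ≤ P) =>
    isCutoff_unitStep.integral_sq_le hs1 hε0 hεP hi hle hab hb
  constructor
  · refine (hpow _).trans ((sum_inv_mul_sq_le (isCutoff_unitStep.intervalIntegrable_moebiusSum_sq
      hs1) (δ := fun k => 2 * (((k : ℝ) + 1) ^ 2)⁻¹ + 8 * (((k : ℝ) + 1) / Real.exp P) ^ 2) N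
      ?_).trans ?_)
    · intro k _ u hu
      have hk : (0 : ℝ) ≤ k := Nat.cast_nonneg k
      have h2 := abs_moebiusSum_unitStep_sub_le hs1 hu.2
      have h3 : Real.exp (P - Real.log (k + 1) - u) - 1 ≤ ((k : ℝ) + 1)⁻¹ := by
        have : P - Real.log (k + 1) - u ≤ Real.log (k + 2) - Real.log (k + 1) := by
          linarith [hu.1]
        have h4 := Real.exp_le_exp.2 this
        rw [Real.exp_sub (Real.log _), Real.exp_log (by positivity),
          Real.exp_log (by positivity)] at h4
        have h5 : ((k : ℝ) + 2) / (k + 1) = 1 + ((k : ℝ) + 1)⁻¹ := by field_simp; ring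
        linarith
      have h4 : Real.exp (-u) ≤ 2 * (((k : ℝ) + 1) / Real.exp P) := by
        have : -u ≤ Real.log (k + 2) - P := by linarith [hu.1]
        have h5 := Real.exp_le_exp.2 this
        rw [Real.exp_sub, Real.exp_log (by positivity)] at h5
        refine h5.trans ?_
        rw [← mul_div_assoc]
        gcongr
        linarith
      have h5 : (moebiusSum unitStep s (P - Real.log (k + 1)) - moebiusSum unitStep s u) ^ 2 ≤
          (((k : ℝ) + 1)⁻¹ + 2 * (((k : ℝ) + 1) / Real.exp P)) ^ 2 := by
        rw [← sq_abs]
        gcongr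
        linarith
      refine h5.trans ?_
      rw [← inv_pow]
      nlinarith [sq_nonneg (((k : ℝ) + 1)⁻¹ - 2 * (((k : ℝ) + 1) / Real.exp P))]
    · have h2 := hmain _ _ hlogN le_rfl
      have h3 : ∑ k ∈ Finset.range N, (Real.log (k + 2) - Real.log (k + 1)) *
          (2 * (((k : ℝ) + 1) ^ 2)⁻¹ + 8 * (((k : ℝ) + 1) / Real.exp P) ^ 2) ≤
          ∑ k ∈ Finset.range N, (2 * (((k : ℝ) + 1) ^ 3)⁻¹ +
            8 / Real.exp P ^ 2 * ((k : ℝ) + 1)) := by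
        refine Finset.sum_le_sum fun k _ => ?_
        refine (mul_le_mul_of_nonneg_right half_inv_le_log.2 (by positivity)).trans (le_of_eq ?_)
        field_simp
      rw [Finset.sum_add_distrib, ← Finset.mul_sum, ← Finset.mul_sum] at h3
      have h4 := sum_range_inv_cube_le N
      have h5 : 8 / Real.exp P ^ 2 * ∑ k ∈ Finset.range N, ((k : ℝ) + 1) ≤ 8 := by
        calc _ ≤ 8 / Real.exp P ^ 2 * Real.exp P ^ 2 := by
              gcongr
              exact (sum_range_succ_cast_le N).trans (by gcongr)
          _ = 8 := by field_simp
      have h6 : 0 ≤ 2 / ((N : ℝ) + 1) := by positivity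
      linarith
  · intro L hL
    have hL0 : 0 < L := by linarith
    obtain ⟨hiL, hleL⟩ := HL L hL0
    have hcut := isCutoff_ramp hL0
    set M := moebiusSum unitStep s with hM
    have hi2 := isCutoff_unitStep.intervalIntegrable_moebiusSum_sq hs1
    set a : ℕ → ℝ := fun k => P - Real.log (k + 1) with ha
    have ha1 : ∀ k : ℕ, a (k + 1) = P - Real.log (k + 2) := by
      intro k
      simp only [ha]
      push_cast
      rw [show (k : ℝ) + 1 + 1 = k + 2 by ring]
    have hle1 : ∀ k, a (k + 1) ≤ a k := by
      intro k
      rw [ha1]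
      have := (half_inv_le_log (k := k)).1
      have h2 : (0 : ℝ) ≤ (2 * ((k : ℝ) + 1))⁻¹ := by positivity
      simp only [ha]
      linarith
    refine (hpow _).trans ((sum_inv_mul_sq_le (hcut.intervalIntegrable_moebiusSum_sq hs1)
      (δ := fun k => 2 * (L ^ 2)⁻¹ * ((∫ t in a (k + 1)..a k, M t ^ 2) +
        ∫ t in (a (k + 1) - L)..(a k - L), M t ^ 2)) N ?_).trans ?_)
    · intro k _ u hu
      have h2 := moebiusSum_ramp_sub_sq_le hs1 hL0 hu.1 hu.2
      rw [ha1]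
      refine h2.trans ?_
      have h3 := (half_inv_le_log (k := k)).2
      have h4 : ((k : ℝ) + 1)⁻¹ ≤ 1 := inv_le_one_of_one_le₀ (by
        have := Nat.cast_nonneg (α := ℝ) k
        linarith)
      have h5 := hle1 k
      rw [ha1] at h5
      have h6 : 0 ≤ (∫ t in (P - Real.log (k + 2))..a k, M t ^ 2) +
          ∫ t in (P - Real.log (k + 2) - L)..(a k - L), M t ^ 2 :=
        add_nonneg (intervalIntegral.integral_nonneg h5 fun t _ => sq_nonneg _)
          (intervalIntegral.integral_nonneg (by linarith) fun t _ => sq_nonneg _)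
      refine mul_le_mul_of_nonneg_right ?_ h6
      calc _ ≤ 2 * (L ^ 2)⁻¹ * 1 := by
            gcongr
            linarith
        _ = _ := mul_one _
    · have h2 := hcut.integral_sq_le hs1 hε0 hεP hiL hleL hlogN le_rfl
      have hsum : ∀ c, 0 ≤ c → ∑ k ∈ Finset.range N, ∫ t in (a (k + 1) - c)..(a k - c), M t ^ 2 ≤
          3 * C := by
        intro c hc
        have h5 := intervalIntegral.sum_integral_adjacent_intervals (μ := volume) (n := N)
          (f := fun u => M u ^ 2) (a := fun k : ℕ => a k - c) fun k _ => hi2 _ _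
        have h6 : ∑ k ∈ Finset.range N, ∫ t in (a (k + 1) - c)..(a k - c), M t ^ 2 =
            ∫ t in (a N - c)..(a 0 - c), M t ^ 2 := by
          rw [intervalIntegral.integral_symm, ← h5, ← Finset.sum_neg_distrib]
          exact Finset.sum_congr rfl fun k _ => intervalIntegral.integral_symm _ _
        have ha0 : a 0 = P := by simp [ha]
        rw [h6, ha0]
        exact hmain _ _ (by simp only [ha]; linarith) (by linarith)
      have h3 : ∑ k ∈ Finset.range N, (Real.log (k + 2) - Real.log (k + 1)) *
          (2 * (L ^ 2)⁻¹ * ((∫ t in a (k + 1)..a k, M t ^ 2) +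
            ∫ t in (a (k + 1) - L)..(a k - L), M t ^ 2)) ≤ 2 * (L ^ 2)⁻¹ * (3 * C + 3 * C) := by
        have h4 := hsum 0 le_rfl
        simp only [sub_zero] at h4
        have h5 := hsum L hL0.le
        calc _ ≤ ∑ k ∈ Finset.range N, 2 * (L ^ 2)⁻¹ * ((∫ t in a (k + 1)..a k, M t ^ 2) +
            ∫ t in (a (k + 1) - L)..(a k - L), M t ^ 2) := by
              refine Finset.sum_le_sum fun k _ => ?_
              have h7 : 0 ≤ (∫ t in a (k + 1)..a k, M t ^ 2) +
                  ∫ t in (a (k + 1) - L)..(a k - L), M t ^ 2 :=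
                add_nonneg (intervalIntegral.integral_nonneg (hle1 k) fun t _ => sq_nonneg _)
                  (intervalIntegral.integral_nonneg (by linarith [hle1 k]) fun t _ => sq_nonneg _)
              refine mul_le_of_le_one_left (by positivity) ?_
              refine half_inv_le_log.2.trans (inv_le_one_of_one_le₀ ?_)
              have := Nat.cast_nonneg (α := ℝ) k
              linarith
          _ ≤ _ := by
            rw [← Finset.mul_sum, Finset.sum_add_distrib]
            gcongr
      have h4 : (L ^ 2)⁻¹ ≤ L⁻¹ := by
        refine inv_anti₀ hL0 ?_
        nlinarith
      calc _ ≤ 4 * (3 * (C / L)) + 4 * (2 * (L ^ 2)⁻¹ * (3 * C + 3 * C)) := by linarith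
        _ ≤ 4 * (3 * (C / L)) + 4 * (2 * L⁻¹ * (3 * C + 3 * C)) := by gcongr
        _ = 60 * C / L := by ring
        _ ≤ _ := by gcongr; linarith

lemma sum_sum_mul_eq_sum_divisorsAntidiagonal (Y : ℕ) (F : ℕ → ℕ → ℝ)
    (hF : ∀ j c, Y < j * c → F j c = 0) :
    ∑ j ∈ Finset.Icc 1 Y, ∑ c ∈ Finset.Icc 1 Y, F j c =
      ∑ n ∈ Finset.Icc 1 Y, ∑ p ∈ n.divisorsAntidiagonal, F p.1 p.2 := by
  classical
  rw [← Finset.sum_product']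
  have h1 : ∑ x ∈ Finset.Icc 1 Y ×ˢ Finset.Icc 1 Y, F x.1 x.2 =
      ∑ x ∈ Finset.Icc 1 Y ×ˢ Finset.Icc 1 Y with x.1 * x.2 ≤ Y, F x.1 x.2 := by
    rw [Finset.sum_filter]
    refine Finset.sum_congr rfl fun x _ => ?_
    split_ifs with h
    · rfl
    · exact hF _ _ (by omega)
  rw [h1, ← Finset.sum_fiberwise_of_maps_to (g := fun x : ℕ × ℕ => x.1 * x.2)
    (t := Finset.Icc 1 Y)]
  · refine Finset.sum_congr rfl fun n hn => Finset.sum_congr ?_ fun _ _ => rfl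
    ext ⟨j, c⟩
    simp only [Finset.mem_filter, Finset.mem_product, Finset.mem_Icc,
      Nat.mem_divisorsAntidiagonal] at hn ⊢
    constructor
    · rintro ⟨_, h⟩
      exact ⟨h, by omega⟩
    · rintro ⟨h, _⟩
      have hj : 0 < j := Nat.pos_of_ne_zero fun h0 => by subst h0; omega
      have hc : 0 < c := Nat.pos_of_ne_zero fun h0 => by subst h0; omega
      have := Nat.le_mul_of_pos_right j hc
      have := Nat.le_mul_of_pos_left c hj
      omega
  · rintro ⟨j, c⟩ h
    simp only [Finset.mem_filter, Finset.mem_product, Finset.mem_Icc] at h ⊢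
    exact ⟨Nat.mul_pos (by omega) (by omega), h.2⟩

lemma sum_squarefree_moebius_eq_zero {j k p : ℕ} (hp : p.Prime) (hpj : p ∣ j) (hpk : ¬ p ∣ k) :
    ∑ d ∈ j.divisors with k ∣ d ∧ Squarefree d, (ArithmeticFunction.moebius d : ℝ) = 0 := by
  have hcop : Nat.Coprime k p := (Nat.Prime.coprime_iff_not_dvd hp).2 hpk |>.symm
  have hmu : ∀ d : ℕ, ¬ p ∣ d → (ArithmeticFunction.moebius (d * p) : ℝ) =
      -(ArithmeticFunction.moebius d : ℝ) := by
    intro d hd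
    rw [ArithmeticFunction.isMultiplicative_moebius.map_mul_of_coprime
      ((Nat.Prime.coprime_iff_not_dvd hp).2 hd |>.symm), ArithmeticFunction.moebius_apply_prime hp]
    push_cast
    ring
  have hsq : ∀ d : ℕ, Squarefree (d * p) → ¬ p ∣ d := fun d hd h => by
    have h1 : p * p ∣ d * p := mul_dvd_mul_right h p
    exact hp.one_lt.ne' (Nat.isUnit_iff.1 (hd p h1))
  refine Finset.sum_involution (fun d _ => if p ∣ d then d / p else d * p) ?_ ?_ ?_ ?_
  · intro d hd
    simp only [Finset.mem_filter] at hd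
    split_ifs with h
    · obtain ⟨e, rfl⟩ := h
      rw [mul_comm p e] at hd ⊢
      rw [Nat.mul_div_cancel _ hp.pos, hmu e (hsq e hd.2.2)]
      ring
    · rw [hmu d h]
      ring
  · intro d hd _
    simp only [Finset.mem_filter, Nat.mem_divisors] at hd
    have hd0 : d ≠ 0 := ne_zero_of_dvd_ne_zero hd.1.2 hd.1.1
    split_ifs with h
    · exact (Nat.div_lt_self (Nat.pos_of_ne_zero hd0) hp.one_lt).ne
    · have := Nat.mul_lt_mul_of_pos_left hp.one_lt (Nat.pos_of_ne_zero hd0)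
      omega
  · intro d hd
    simp only [Finset.mem_filter, Nat.mem_divisors] at hd ⊢
    obtain ⟨⟨hdj, hj⟩, hkd, hds⟩ := hd
    split_ifs with h
    · obtain ⟨e, rfl⟩ := h
      rw [Nat.mul_div_cancel_left _ hp.pos]
      exact ⟨⟨(Dvd.intro_left p rfl).trans hdj, hj⟩, hcop.dvd_of_dvd_mul_left hkd,
        hds.of_mul_right⟩
    · have hc : Nat.Coprime d p := (Nat.Prime.coprime_iff_not_dvd hp).2 h |>.symm
      exact ⟨⟨hc.mul_dvd_of_dvd_of_dvd hdj hpj, hj⟩, hkd.trans (Dvd.intro p rfl),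
        (Nat.squarefree_mul hc).2 ⟨hds, hp.squarefree⟩⟩
  · intro d hd
    simp only [Finset.mem_filter] at hd
    split_ifs with h h1 h2
    · obtain ⟨e, rfl⟩ := h
      rw [mul_comm p e] at hd h1
      rw [Nat.mul_div_cancel _ hp.pos] at h1
      exact absurd h1 (hsq e hd.2.2)
    · exact Nat.div_mul_cancel h
    · exact Nat.mul_div_cancel _ hp.pos
    · exact absurd (Dvd.intro_left d rfl) h2

lemma abs_sum_filter_dvd_moebius_le {j k : ℕ} (hj : j ≠ 0) (hk : Squarefree k) :
    |∑ d ∈ j.divisors with k ∣ d, (ArithmeticFunction.moebius d : ℝ)| ≤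
      if j.primeFactors = k.primeFactors then 1 else 0 := by
  have h1 : ∑ d ∈ j.divisors with k ∣ d, (ArithmeticFunction.moebius d : ℝ) =
      ∑ d ∈ j.divisors with k ∣ d ∧ Squarefree d, (ArithmeticFunction.moebius d : ℝ) := by
    rw [← Finset.filter_filter, Finset.sum_filter (p := fun d => Squarefree d)]
    refine Finset.sum_congr rfl fun d _ => ?_
    split_ifs with h
    · rfl
    · rw [ArithmeticFunction.moebius_eq_zero_of_not_squarefree h, Int.cast_zero]
  rw [h1]
  split_ifs with h
  · have h2 : j.divisors.filter (fun d => k ∣ d ∧ Squarefree d) ⊆ {k} := by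
      intro d hd
      simp only [Finset.mem_filter, Nat.mem_divisors] at hd
      obtain ⟨⟨hdj, _⟩, hkd, hds⟩ := hd
      have h3 : d.primeFactors = k.primeFactors :=
        Finset.Subset.antisymm (h ▸ Nat.primeFactors_mono hdj hj)
          (Nat.primeFactors_mono hkd hds.ne_zero)
      rw [Finset.mem_singleton, ← Nat.prod_primeFactors_of_squarefree hds, h3,
        Nat.prod_primeFactors_of_squarefree hk]
    refine (Finset.abs_sum_le_sum_abs _ _).trans ((Finset.sum_le_sum_of_subset_of_nonneg h2
      fun _ _ _ => abs_nonneg _).trans ?_)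
    rw [Finset.sum_singleton]
    exact_mod_cast ArithmeticFunction.abs_moebius_le_one
  · by_cases hkj : k ∣ j
    · have h2 : ¬ j.primeFactors ⊆ k.primeFactors := fun h3 =>
        h (Finset.Subset.antisymm h3 (Nat.primeFactors_mono hkj hj))
      rw [Finset.not_subset] at h2
      obtain ⟨p, hpj, hpk⟩ := h2
      have hp := Nat.prime_of_mem_primeFactors hpj
      rw [sum_squarefree_moebius_eq_zero hp (Nat.dvd_of_mem_primeFactors hpj)
        fun h3 => hpk (Nat.mem_primeFactors.2 ⟨hp, h3, hk.ne_zero⟩), abs_zero]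
    · rw [Finset.sum_eq_zero, abs_zero]
      intro d hd
      simp only [Finset.mem_filter, Nat.mem_divisors] at hd
      exact absurd (hd.2.1.trans hd.1.1) hkj

/-- The Jordan totient `∏ p ∣ k, (p ^ s - 1)` of a squarefree number. -/
noncomputable def jordan (s : ℝ) (k : ℕ) : ℝ := ∏ p ∈ k.primeFactors, ((p : ℝ) ^ s - 1)

lemma jordan_pos {s : ℝ} (hs : 0 < s) (k : ℕ) : 0 < jordan s k :=
  Finset.prod_pos fun p hp => by
    have h1 : (1 : ℝ) < p := by exact_mod_cast (Nat.prime_of_mem_primeFactors hp).one_lt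
    have := Real.one_lt_rpow h1 hs
    linarith

lemma prod_primeFactors_rpow {g : ℕ} (hg : Squarefree g) (s : ℝ) :
    ∏ p ∈ g.primeFactors, (p : ℝ) ^ s = (g : ℝ) ^ s := by
  rw [Real.finsetProd_rpow _ _ fun p _ => Nat.cast_nonneg p]
  rw [← Nat.cast_prod, Nat.prod_primeFactors_of_squarefree hg]

lemma sum_divisors_jordan {g : ℕ} (hg : Squarefree g) (s : ℝ) :
    ∑ k ∈ g.divisors, jordan s k = (g : ℝ) ^ s := by
  have h := (ArithmeticFunction.IsMultiplicative.prodPrimeFactors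
    (fun p : ℕ => (p : ℝ) ^ s - 1)).prodPrimeFactors_one_add_of_squarefree hg
  rw [← prod_primeFactors_rpow hg s]
  calc _ = ∑ k ∈ g.divisors, ArithmeticFunction.prodPrimeFactors
        (fun p : ℕ => (p : ℝ) ^ s - 1) k := by
        refine Finset.sum_congr rfl fun k hk => ?_
        rw [ArithmeticFunction.prodPrimeFactors_apply
          (ne_zero_of_dvd_ne_zero hg.ne_zero (Nat.dvd_of_mem_divisors hk))]
        rfl
    _ = _ := h.symm
    _ = _ := by
        refine Finset.prod_congr rfl fun p hp => ?_
        have hp' := Nat.prime_of_mem_primeFactors hp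
        rw [ArithmeticFunction.prodPrimeFactors_apply hp'.ne_zero, hp'.primeFactors,
          Finset.prod_singleton]
        ring

lemma sum_rpow_neg_le_inv_jordan {s : ℝ} (hs : 0 < s) {k : ℕ} (hk : Squarefree k) (T : Finset ℕ)
    (hT : ∀ j ∈ T, j ≠ 0 ∧ j.primeFactors = k.primeFactors) :
    ∑ j ∈ T, (j : ℝ) ^ (-s) ≤ (jordan s k)⁻¹ := by
  let f : ℕ →* ℝ :=
    { toFun := fun n => (n : ℝ) ^ (-s)
      map_one' := by simp
      map_mul' := fun m n => by
        rw [Nat.cast_mul, Real.mul_rpow (Nat.cast_nonneg _) (Nat.cast_nonneg _)] }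
  have hf : ∀ n : ℕ, f n = (n : ℝ) ^ (-s) := fun n => rfl
  have hf0 : ∀ n : ℕ, 0 ≤ f n := fun n => Real.rpow_nonneg (Nat.cast_nonneg _) _
  have hf1 : ∀ {p : ℕ}, p.Prime → ‖f p‖ < 1 := fun {p} hp => by
    rw [Real.norm_of_nonneg (hf0 p), hf]
    exact Real.rpow_lt_one_of_one_lt_of_neg (by exact_mod_cast hp.one_lt) (by linarith)
  obtain ⟨-, hsum⟩ := EulerProduct.summable_and_hasSum_factoredNumbers_prod_filter_prime_geometric
    hf1 k.primeFactors
  have hfil : k.primeFactors.filter Nat.Prime = k.primeFactors :=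
    Finset.filter_true_of_mem fun p hp => Nat.prime_of_mem_primeFactors hp
  rw [hfil] at hsum
  have hkj : ∀ j ∈ T, k ∣ j := fun j hj => by
    rw [← Nat.prod_primeFactors_of_squarefree hk, ← (hT j hj).2]
    exact Nat.prod_primeFactors_dvd j
  have hmem : ∀ j ∈ T, j / k ∈ Nat.factoredNumbers k.primeFactors := fun j hj => by
    obtain ⟨b, rfl⟩ := hkj j hj
    rw [Nat.mul_div_cancel_left _ hk.ne_zero.bot_lt, Nat.mem_factoredNumbers']
    intro p hp hpb
    rw [← (hT _ hj).2, Nat.mem_primeFactors]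
    exact ⟨hp, hpb.trans (Dvd.intro_left k rfl), (hT _ hj).1⟩
  have h1 : ∑ j ∈ T, f (j / k) ≤ ∏ p ∈ k.primeFactors, (1 - f p)⁻¹ := by
    classical
    let φ : T → Nat.factoredNumbers k.primeFactors := fun j => ⟨j / k, hmem j j.2⟩
    have hφ : Function.Injective φ := by
      rintro ⟨i, hi⟩ ⟨j, hj⟩ h
      have h2 : i / k = j / k := congrArg Subtype.val h
      have h3 : i = j := by
        rw [← Nat.div_mul_cancel (hkj i hi), h2, Nat.div_mul_cancel (hkj j hj)]
      exact Subtype.ext h3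
    have h2 := sum_le_hasSum (Finset.univ.map ⟨φ, hφ⟩) (fun i _ => hf0 _) hsum
    rw [Finset.sum_map] at h2
    rw [← Finset.sum_coe_sort]
    exact h2
  have h2 : ∑ j ∈ T, (j : ℝ) ^ (-s) = f k * ∑ j ∈ T, f (j / k) := by
    rw [Finset.mul_sum]
    refine Finset.sum_congr rfl fun j hj => ?_
    rw [← map_mul, Nat.mul_div_cancel' (hkj j hj), hf]
  rw [h2]
  refine (mul_le_mul_of_nonneg_left h1 (hf0 k)).trans (le_of_eq ?_)
  rw [hf, ← prod_primeFactors_rpow hk, ← Finset.prod_mul_distrib, jordan, ← Finset.prod_inv_distrib]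
  refine Finset.prod_congr rfl fun p hp => ?_
  have hp' := Nat.prime_of_mem_primeFactors hp
  have h1 : (1 : ℝ) < p := by exact_mod_cast hp'.one_lt
  have h3 := Real.one_lt_rpow h1 hs
  rw [hf, Real.rpow_neg (by linarith)]
  have : (p : ℝ) ^ s - 1 ≠ 0 := by linarith
  field_simp

/-- The quadratic form `∑ μ(d) μ(e) a(d) a(e) lcm(d, e) ^ (-s)`. -/
noncomputable def lcmForm (a : ℕ → ℝ) (s : ℝ) (Y : ℕ) : ℝ :=
  ∑ d ∈ Finset.Icc 1 Y, ∑ e ∈ Finset.Icc 1 Y,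
    ((ArithmeticFunction.moebius d : ℝ) * a d) * ((ArithmeticFunction.moebius e : ℝ) * a e) *
      (d.lcm e : ℝ) ^ (-s)

lemma moebius_mul_moebius_mul_lcm_rpow {s : ℝ} {Y d e : ℕ} (hd : d ∈ Finset.Icc 1 Y)
    (he : e ∈ Finset.Icc 1 Y) :
    (ArithmeticFunction.moebius d : ℝ) * (ArithmeticFunction.moebius e : ℝ) *
      (d.lcm e : ℝ) ^ (-s) =
    ∑ k ∈ Finset.Icc 1 Y with Squarefree k, jordan s k *
      ((if k ∣ d then (ArithmeticFunction.moebius d : ℝ) * (d : ℝ) ^ (-s) else 0) *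
        if k ∣ e then (ArithmeticFunction.moebius e : ℝ) * (e : ℝ) ^ (-s) else 0) := by
  rw [Finset.mem_Icc] at hd he
  by_cases hds : Squarefree d
  swap
  · simp [ArithmeticFunction.moebius_eq_zero_of_not_squarefree hds]
  have hg : Squarefree (d.gcd e) := hds.squarefree_of_dvd (Nat.gcd_dvd_left d e)
  have hd0 : (0 : ℝ) < d := by exact_mod_cast hd.1
  have he0 : (0 : ℝ) < e := by exact_mod_cast he.1
  have h1 : (d.lcm e : ℝ) ^ (-s) = (d : ℝ) ^ (-s) * (e : ℝ) ^ (-s) * (d.gcd e : ℝ) ^ s := by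
    have hg0 : (0 : ℝ) < d.gcd e := by exact_mod_cast Nat.gcd_pos_of_pos_left e hd.1
    rw [← Real.mul_rpow hd0.le he0.le, ← Nat.cast_mul, ← Nat.gcd_mul_lcm d e, Nat.cast_mul,
      Real.mul_rpow hg0.le (Nat.cast_nonneg _), Real.rpow_neg hg0.le]
    have : (d.gcd e : ℝ) ^ s ≠ 0 := (Real.rpow_pos_of_pos hg0 s).ne'
    field_simp
  have h2 : (d.gcd e).divisors ⊆ (Finset.Icc 1 Y).filter (fun k => Squarefree k) := by
    intro k hk
    have hk' := Nat.dvd_of_mem_divisors hk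
    simp only [Finset.mem_filter, Finset.mem_Icc]
    exact ⟨⟨Nat.pos_of_mem_divisors hk,
      (Nat.le_of_dvd hd.1 (hk'.trans (Nat.gcd_dvd_left d e))).trans hd.2⟩,
      hg.squarefree_of_dvd hk'⟩
  rw [h1, ← sum_divisors_jordan hg s, ← Finset.sum_subset h2]
  · rw [Finset.mul_sum, Finset.mul_sum]
    refine Finset.sum_congr rfl fun k hk => ?_
    have hk' := Nat.dvd_of_mem_divisors hk
    rw [if_pos (hk'.trans (Nat.gcd_dvd_left d e)), if_pos (hk'.trans (Nat.gcd_dvd_right d e))]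
    ring
  · intro k _ hk
    have : ¬ (k ∣ d ∧ k ∣ e) := fun h => hk (Nat.mem_divisors.2 ⟨Nat.dvd_gcd h.1 h.2, hg.ne_zero⟩)
    rw [not_and_or] at this
    rcases this with h | h <;> simp [h]

lemma lcmForm_eq_sum (a : ℕ → ℝ) (s : ℝ) (Y : ℕ) :
    lcmForm a s Y = ∑ k ∈ Finset.Icc 1 Y with Squarefree k, jordan s k *
      (∑ d ∈ Finset.Icc 1 Y,
        if k ∣ d then (ArithmeticFunction.moebius d : ℝ) * (d : ℝ) ^ (-s) * a d else 0) ^ 2 := by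
  have h1 : lcmForm a s Y = ∑ d ∈ Finset.Icc 1 Y, ∑ e ∈ Finset.Icc 1 Y,
      ∑ k ∈ Finset.Icc 1 Y with Squarefree k, jordan s k *
      ((if k ∣ d then (ArithmeticFunction.moebius d : ℝ) * (d : ℝ) ^ (-s) * a d else 0) *
        if k ∣ e then (ArithmeticFunction.moebius e : ℝ) * (e : ℝ) ^ (-s) * a e else 0) := by
    refine Finset.sum_congr rfl fun d hd => Finset.sum_congr rfl fun e he => ?_
    calc _ = (ArithmeticFunction.moebius d : ℝ) * (ArithmeticFunction.moebius e : ℝ) *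
          (d.lcm e : ℝ) ^ (-s) * (a d * a e) := by ring
      _ = _ := by
          rw [moebius_mul_moebius_mul_lcm_rpow hd he, Finset.sum_mul]
          refine Finset.sum_congr rfl fun k _ => ?_
          split_ifs <;> ring
  rw [h1]
  simp_rw [sq, Finset.sum_mul_sum, Finset.mul_sum]
  symm
  rw [Finset.sum_comm]
  exact Finset.sum_congr rfl fun d _ => Finset.sum_comm

lemma sum_filter_dvd_eq {a : ℕ → ℝ} {Y : ℕ} (ha : ∀ n, Y < n → a n = 0) {s : ℝ} (k : ℕ) :
    (∑ d ∈ Finset.Icc 1 Y,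
        if k ∣ d then (ArithmeticFunction.moebius d : ℝ) * (d : ℝ) ^ (-s) * a d else 0) =
    ∑ j ∈ Finset.Icc 1 Y, (j : ℝ) ^ (-s) *
      (∑ d ∈ j.divisors with k ∣ d, (ArithmeticFunction.moebius d : ℝ)) *
      ∑ c ∈ Finset.Icc 1 Y, (ArithmeticFunction.moebius c : ℝ) * (c : ℝ) ^ (-s) * a (j * c) := by
  let f : ArithmeticFunction ℝ :=
    ⟨fun d => if k ∣ d then (ArithmeticFunction.moebius d : ℝ) else 0, by simp⟩
  have hf : ∀ d, f d = if k ∣ d then (ArithmeticFunction.moebius d : ℝ) else 0 := fun d => rfl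
  have h1 : ∀ j, ∑ d ∈ j.divisors with k ∣ d, (ArithmeticFunction.moebius d : ℝ) =
      (f * (ArithmeticFunction.zeta : ArithmeticFunction ℝ)) j := fun j => by
    rw [ArithmeticFunction.coe_mul_zeta_apply, Finset.sum_filter]
    rfl
  have h2 : (f * (ArithmeticFunction.zeta : ArithmeticFunction ℝ)) *
      ((ArithmeticFunction.moebius : ArithmeticFunction ℤ) : ArithmeticFunction ℝ) = f := by
    rw [mul_assoc, ArithmeticFunction.coe_zeta_mul_coe_moebius, mul_one]
  simp_rw [h1, Finset.mul_sum]
  rw [sum_sum_mul_eq_sum_divisorsAntidiagonal Y (fun j c => (j : ℝ) ^ (-s) *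
    (f * (ArithmeticFunction.zeta : ArithmeticFunction ℝ)) j *
    ((ArithmeticFunction.moebius c : ℝ) * (c : ℝ) ^ (-s) * a (j * c)))]
  · refine Finset.sum_congr rfl fun n _ => ?_
    have h3 := congrArg (fun g : ArithmeticFunction ℝ => g n) h2
    simp only [ArithmeticFunction.mul_apply (n := n), hf] at h3
    calc _ = (if k ∣ n then (ArithmeticFunction.moebius n : ℝ) else 0) *
          ((n : ℝ) ^ (-s) * a n) := by split_ifs <;> ring
      _ = _ := by
          rw [← h3, Finset.sum_mul]
          refine Finset.sum_congr rfl fun p hp => ?_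
          have h4 := (Nat.mem_divisorsAntidiagonal.1 hp).1
          rw [← h4, Nat.cast_mul, Real.mul_rpow (Nat.cast_nonneg _) (Nat.cast_nonneg _)]
          simp only [ArithmeticFunction.intCoe_apply]
          ring
  · intro j c h
    rw [ha _ h]
    ring

lemma lcmForm_le {a : ℕ → ℝ} {Y : ℕ} (ha : ∀ n, Y < n → a n = 0) {s : ℝ} (hs : 0 < s) :
    lcmForm a s Y ≤ ∑ j ∈ Finset.Icc 1 Y, (j : ℝ) ^ (-s) *
      (∑ c ∈ Finset.Icc 1 Y, (ArithmeticFunction.moebius c : ℝ) * (c : ℝ) ^ (-s) *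
        a (j * c)) ^ 2 := by
  classical
  set V : ℕ → ℝ := fun j => ∑ c ∈ Finset.Icc 1 Y, (ArithmeticFunction.moebius c : ℝ) *
    (c : ℝ) ^ (-s) * a (j * c) with hV
  have hp : ∀ j : ℕ, 0 ≤ (j : ℝ) ^ (-s) := fun j => Real.rpow_nonneg (Nat.cast_nonneg _) _
  rw [lcmForm_eq_sum]
  set K := (Finset.Icc 1 Y).filter (fun k => Squarefree k) with hK
  have h1 : ∀ k ∈ K, jordan s k * (∑ d ∈ Finset.Icc 1 Y,
      if k ∣ d then (ArithmeticFunction.moebius d : ℝ) * (d : ℝ) ^ (-s) * a d else 0) ^ 2 ≤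
      ∑ j ∈ Finset.Icc 1 Y with j.primeFactors = k.primeFactors, (j : ℝ) ^ (-s) * V j ^ 2 := by
    intro k hk
    have hks : Squarefree k := (Finset.mem_filter.1 hk).2
    set T := (Finset.Icc 1 Y).filter (fun j => j.primeFactors = k.primeFactors) with hT
    rw [sum_filter_dvd_eq ha]
    have h2 : |∑ j ∈ Finset.Icc 1 Y, (j : ℝ) ^ (-s) *
        (∑ d ∈ j.divisors with k ∣ d, (ArithmeticFunction.moebius d : ℝ)) * V j| ≤
        ∑ j ∈ T, (j : ℝ) ^ (-s) * |V j| := by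
      refine (Finset.abs_sum_le_sum_abs _ _).trans ?_
      rw [hT, Finset.sum_filter]
      refine Finset.sum_le_sum fun j hj => ?_
      have h3 := abs_sum_filter_dvd_moebius_le (j := j)
        (by rw [Finset.mem_Icc] at hj; omega) hks
      rw [abs_mul, abs_mul, abs_of_nonneg (hp j)]
      split_ifs at h3 ⊢
      · have : (j : ℝ) ^ (-s) * |∑ d ∈ j.divisors with k ∣ d, (ArithmeticFunction.moebius d : ℝ)|
            ≤ (j : ℝ) ^ (-s) * 1 := mul_le_mul_of_nonneg_left h3 (hp j)
        rw [mul_one] at this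
        exact mul_le_mul_of_nonneg_right this (abs_nonneg _)
      · rw [le_antisymm h3 (abs_nonneg _)]
        simp
    have h3 : (∑ j ∈ T, (j : ℝ) ^ (-s) * |V j|) ^ 2 ≤
        (∑ j ∈ T, (j : ℝ) ^ (-s)) * ∑ j ∈ T, (j : ℝ) ^ (-s) * V j ^ 2 := by
      refine Finset.sum_sq_le_sum_mul_sum_of_sq_le_mul T (fun j _ => hp j)
        (fun j _ => mul_nonneg (hp j) (sq_nonneg _)) fun j _ => le_of_eq ?_
      rw [mul_pow, sq_abs]
      ring
    have h4 := sum_rpow_neg_le_inv_jordan hs hks T fun j hj => by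
      rw [hT, Finset.mem_filter, Finset.mem_Icc] at hj
      exact ⟨by omega, hj.2⟩
    have h5 : 0 ≤ ∑ j ∈ T, (j : ℝ) ^ (-s) * V j ^ 2 :=
      Finset.sum_nonneg fun j _ => mul_nonneg (hp j) (sq_nonneg _)
    have hJ := jordan_pos hs k
    calc _ ≤ jordan s k * ((jordan s k)⁻¹ * ∑ j ∈ T, (j : ℝ) ^ (-s) * V j ^ 2) := by
          refine mul_le_mul_of_nonneg_left ?_ hJ.le
          rw [← sq_abs]
          exact (pow_le_pow_left₀ (abs_nonneg _) h2 2).trans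
            (h3.trans (mul_le_mul_of_nonneg_right h4 h5))
      _ = _ := mul_inv_cancel_left₀ hJ.ne' _
  refine (Finset.sum_le_sum h1).trans ?_
  simp only [Finset.sum_filter (s := Finset.Icc 1 Y)]
  rw [Finset.sum_comm]
  refine Finset.sum_le_sum fun j _ => ?_
  rw [← Finset.sum_filter, Finset.sum_const, nsmul_eq_mul]
  have h2 : ((K.filter fun k => j.primeFactors = k.primeFactors).card : ℝ) ≤ 1 := by
    have : (K.filter fun k => j.primeFactors = k.primeFactors).card ≤ 1 := by
      refine Finset.card_le_one.2 fun k hk l hl => ?_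
      simp only [hK, Finset.mem_filter] at hk hl
      rw [← Nat.prod_primeFactors_of_squarefree hk.1.2,
        ← Nat.prod_primeFactors_of_squarefree hl.1.2, ← hk.2, ← hl.2]
    exact_mod_cast this
  calc _ ≤ 1 * ((j : ℝ) ^ (-s) * V j ^ 2) :=
        mul_le_mul_of_nonneg_right h2 (mul_nonneg (hp j) (sq_nonneg _))
    _ = _ := one_mul _

lemma sq_sum_divisors_eq {a : ℕ → ℝ} {Y : ℕ} (ha : ∀ n, Y < n → a n = 0) {n : ℕ} (hn : n ≠ 0) :
    (∑ d ∈ n.divisors, (ArithmeticFunction.moebius d : ℝ) * a d) ^ 2 =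
    ∑ d ∈ Finset.Icc 1 Y, ∑ e ∈ Finset.Icc 1 Y,
      ((ArithmeticFunction.moebius d : ℝ) * a d) * ((ArithmeticFunction.moebius e : ℝ) * a e) *
        if d.lcm e ∣ n then 1 else 0 := by
  have h1 : ∑ d ∈ n.divisors, (ArithmeticFunction.moebius d : ℝ) * a d =
      ∑ d ∈ Finset.Icc 1 Y, if d ∣ n then (ArithmeticFunction.moebius d : ℝ) * a d else 0 := by
    rw [← Finset.sum_filter]
    symm
    refine Finset.sum_subset ?_ ?_
    · intro d hd
      rw [Finset.mem_filter] at hd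
      exact Nat.mem_divisors.2 ⟨hd.2, hn⟩
    · intro d hd hd'
      rw [Finset.mem_filter, Finset.mem_Icc] at hd'
      have h2 := Nat.pos_of_mem_divisors hd
      have h3 := Nat.dvd_of_mem_divisors hd
      rw [ha d (by by_contra h; exact hd' ⟨⟨h2, by omega⟩, h3⟩), mul_zero]
  rw [h1, sq, Finset.sum_mul_sum]
  refine Finset.sum_congr rfl fun d _ => Finset.sum_congr rfl fun e _ => ?_
  by_cases h2 : d ∣ n <;> by_cases h3 : e ∣ n <;> simp [Nat.lcm_dvd_iff, h2, h3]

lemma abs_sum_dvd_sub_le {X : ℝ} (hX : 0 ≤ X) {l : ℕ} (hl : 0 < l) :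
    |∑ n ∈ Finset.Icc 1 ⌊X⌋₊, (if l ∣ n then (1 : ℝ) else 0) - X * (l : ℝ) ^ (-(1 : ℝ))| ≤ 1 := by
  have h1 : ∑ n ∈ Finset.Icc 1 ⌊X⌋₊, (if l ∣ n then (1 : ℝ) else 0) = (⌊X / l⌋₊ : ℝ) := by
    rw [Nat.floor_div_natCast, ← Nat.card_multiples', ← Finset.sum_filter, Finset.sum_const,
      nsmul_eq_mul, mul_one]
    congr 2
    ext n
    simp only [Finset.mem_filter, Finset.mem_Icc, Finset.mem_range]
    constructor
    · rintro ⟨h1, h2⟩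
      exact ⟨by omega, by omega, h2⟩
    · rintro ⟨h1, h2, h3⟩
      exact ⟨by omega, h3⟩
  rw [h1, Real.rpow_neg_one, ← div_eq_mul_inv]
  have h2 := Nat.floor_le (show 0 ≤ X / l by positivity)
  have h3 := Nat.lt_floor_add_one (X / l)
  rw [abs_le]
  constructor <;> linarith

lemma abs_moebius_mul_le {a : ℕ → ℝ} (ha1 : ∀ n, |a n| ≤ 1) (d : ℕ) :
    |(ArithmeticFunction.moebius d : ℝ) * a d| ≤ 1 := by
  rw [abs_mul]
  have h3 : |(ArithmeticFunction.moebius d : ℝ)| ≤ 1 := by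
    exact_mod_cast ArithmeticFunction.abs_moebius_le_one
  exact mul_le_one₀ h3 (abs_nonneg _) (ha1 d)

lemma sum_sq_sum_divisors_le {a : ℕ → ℝ} {Y : ℕ} (ha : ∀ n, Y < n → a n = 0)
    (ha1 : ∀ n, |a n| ≤ 1) {X : ℝ} (hX : 0 ≤ X) :
    ∑ n ∈ Finset.Icc 1 ⌊X⌋₊, (∑ d ∈ n.divisors, (ArithmeticFunction.moebius d : ℝ) * a d) ^ 2 ≤
      X * lcmForm a 1 Y + (Y : ℝ) ^ 2 := by
  have h1 : ∑ n ∈ Finset.Icc 1 ⌊X⌋₊,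
      (∑ d ∈ n.divisors, (ArithmeticFunction.moebius d : ℝ) * a d) ^ 2 =
      ∑ d ∈ Finset.Icc 1 Y, ∑ e ∈ Finset.Icc 1 Y,
      ((ArithmeticFunction.moebius d : ℝ) * a d) * ((ArithmeticFunction.moebius e : ℝ) * a e) *
        ∑ n ∈ Finset.Icc 1 ⌊X⌋₊, if d.lcm e ∣ n then 1 else 0 := by
    rw [Finset.sum_congr rfl fun n hn => sq_sum_divisors_eq ha (n := n)
      (by rw [Finset.mem_Icc] at hn; omega), Finset.sum_comm]
    refine Finset.sum_congr rfl fun d _ => ?_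
    rw [Finset.sum_comm]
    exact Finset.sum_congr rfl fun e _ => (Finset.mul_sum _ _ _).symm
  have h2 : ∀ d ∈ Finset.Icc 1 Y, ∀ e ∈ Finset.Icc 1 Y,
      ((ArithmeticFunction.moebius d : ℝ) * a d) * ((ArithmeticFunction.moebius e : ℝ) * a e) *
        (∑ n ∈ Finset.Icc 1 ⌊X⌋₊, if d.lcm e ∣ n then 1 else 0) ≤
      X * (((ArithmeticFunction.moebius d : ℝ) * a d) *
        ((ArithmeticFunction.moebius e : ℝ) * a e) * (d.lcm e : ℝ) ^ (-(1 : ℝ))) + 1 := by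
    intro d hd e he
    rw [Finset.mem_Icc] at hd he
    have h3 := abs_sum_dvd_sub_le hX (Nat.lcm_pos hd.1 he.1)
    have h4 := abs_moebius_mul_le ha1 d
    have h5 := abs_moebius_mul_le ha1 e
    set A := (ArithmeticFunction.moebius d : ℝ) * a d
    set B := (ArithmeticFunction.moebius e : ℝ) * a e
    set S := ∑ n ∈ Finset.Icc 1 ⌊X⌋₊, if d.lcm e ∣ n then (1 : ℝ) else 0
    have h6 : |A * B * (S - X * (d.lcm e : ℝ) ^ (-(1 : ℝ)))| ≤ 1 := by
      rw [abs_mul, abs_mul]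
      exact mul_le_one₀ (mul_le_one₀ h4 (abs_nonneg _) h5) (abs_nonneg _) h3
    have h7 := (abs_le.1 h6).2
    linarith
  rw [h1]
  refine (Finset.sum_le_sum fun d hd => Finset.sum_le_sum fun e he => h2 d hd e he).trans
    (le_of_eq ?_)
  simp only [Finset.sum_add_distrib, ← Finset.mul_sum, Finset.sum_const, Nat.card_Icc,
    nsmul_eq_mul, lcmForm]
  simp
  ring

lemma summable_natCast_rpow_neg {s : ℝ} (hs : 1 < s) : Summable fun n : ℕ => (n : ℝ) ^ (-s) :=
  Real.summable_nat_rpow.2 (by linarith)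

lemma hasSum_ite_dvd_rpow_neg {s : ℝ} (hs : 1 < s) {l : ℕ} (hl : 0 < l) :
    HasSum (fun n : ℕ => (n : ℝ) ^ (-s) * if l ∣ n then 1 else 0)
      ((∑' n : ℕ, (n : ℝ) ^ (-s)) * (l : ℝ) ^ (-s)) := by
  have h1 := (summable_natCast_rpow_neg hs).hasSum.mul_right ((l : ℝ) ^ (-s))
  have hinj : Function.Injective fun n : ℕ => n * l := fun m n h => Nat.eq_of_mul_eq_mul_right hl h
  rw [← hinj.hasSum_iff]
  · have h2 : ((fun n : ℕ => (n : ℝ) ^ (-s) * if l ∣ n then 1 else 0) ∘ fun n => n * l) =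
        fun n : ℕ => (n : ℝ) ^ (-s) * (l : ℝ) ^ (-s) := by
      funext n
      simp [Real.mul_rpow]
    rwa [h2]
  · intro n hn
    rw [if_neg, mul_zero]
    rintro ⟨m, rfl⟩
    exact hn ⟨m, mul_comm m l⟩

lemma sum_rpow_mul_sq_sum_divisors_le {a : ℕ → ℝ} {Y : ℕ} (ha : ∀ n, Y < n → a n = 0) {s : ℝ}
    (hs : 1 < s) (N : ℕ) : ∑ n ∈ Finset.Icc 1 N, (n : ℝ) ^ (-s) *
      (∑ d ∈ n.divisors, (ArithmeticFunction.moebius d : ℝ) * a d) ^ 2 ≤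
      (∑' n : ℕ, (n : ℝ) ^ (-s)) * lcmForm a s Y := by
  have h1 : HasSum (fun n : ℕ => ∑ d ∈ Finset.Icc 1 Y, ∑ e ∈ Finset.Icc 1 Y,
      ((ArithmeticFunction.moebius d : ℝ) * a d) * ((ArithmeticFunction.moebius e : ℝ) * a e) *
        ((n : ℝ) ^ (-s) * if d.lcm e ∣ n then 1 else 0))
      (∑ d ∈ Finset.Icc 1 Y, ∑ e ∈ Finset.Icc 1 Y,
      ((ArithmeticFunction.moebius d : ℝ) * a d) * ((ArithmeticFunction.moebius e : ℝ) * a e) *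
        ((∑' n : ℕ, (n : ℝ) ^ (-s)) * (d.lcm e : ℝ) ^ (-s))) := by
    refine hasSum_sum fun d hd => hasSum_sum fun e he => ?_
    rw [Finset.mem_Icc] at hd he
    exact (hasSum_ite_dvd_rpow_neg hs (Nat.lcm_pos hd.1 he.1)).mul_left _
  have h2 : ∀ n : ℕ, (n : ℝ) ^ (-s) *
      (∑ d ∈ n.divisors, (ArithmeticFunction.moebius d : ℝ) * a d) ^ 2 =
      ∑ d ∈ Finset.Icc 1 Y, ∑ e ∈ Finset.Icc 1 Y,
      ((ArithmeticFunction.moebius d : ℝ) * a d) * ((ArithmeticFunction.moebius e : ℝ) * a e) *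
        ((n : ℝ) ^ (-s) * if d.lcm e ∣ n then 1 else 0) := by
    intro n
    rcases Nat.eq_zero_or_pos n with rfl | hn
    · simp [Real.zero_rpow (show -s ≠ 0 by linarith)]
    · rw [sq_sum_divisors_eq ha hn.ne', Finset.mul_sum]
      refine Finset.sum_congr rfl fun d _ => ?_
      rw [Finset.mul_sum]
      exact Finset.sum_congr rfl fun e _ => by ring
  simp_rw [← h2] at h1
  have h3 := sum_le_hasSum (Finset.Icc 1 N) (fun n _ =>
    mul_nonneg (Real.rpow_nonneg (Nat.cast_nonneg n) _) (sq_nonneg _)) h1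
  refine h3.trans (le_of_eq ?_)
  rw [lcmForm, Finset.mul_sum]
  refine Finset.sum_congr rfl fun d _ => ?_
  rw [Finset.mul_sum]
  exact Finset.sum_congr rfl fun e _ => by ring

lemma tsum_rpow_neg_le {ε : ℝ} (hε : 0 < ε) (hε1 : ε ≤ 1) :
    ∑' n : ℕ, (n : ℝ) ^ (-(1 + ε)) ≤ 1 / ε + 4 := by
  have hs : 1 < ((1 + ε : ℝ) : ℂ).re := by rw [Complex.ofReal_re]; linarith
  have h1 := norm_riemannZeta_sub_sum_le hs one_pos
  have h2 : riemannZeta ((1 + ε : ℝ) : ℂ) = ((∑' n : ℕ, (n : ℝ) ^ (-(1 + ε)) : ℝ) : ℂ) := by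
    rw [zeta_eq_tsum_one_div_nat_cpow hs, Complex.ofReal_tsum]
    refine tsum_congr fun n => ?_
    rw [Complex.ofReal_cpow (Nat.cast_nonneg n), Complex.ofReal_neg, Complex.cpow_neg, one_div,
      Complex.ofReal_natCast]
  have h3 : (-((1 + ε : ℝ) : ℂ)) ≠ 0 := by
    rw [← Complex.ofReal_neg, Complex.ofReal_ne_zero]
    linarith
  rw [h2] at h1
  simp only [Finset.range_one, Finset.sum_singleton, Nat.cast_zero, Complex.zero_cpow h3, zero_add,
    Nat.cast_one, Complex.one_cpow, div_one] at h1
  have h4 : (1 : ℂ) / (((1 + ε : ℝ) : ℂ) - 1) = ((1 / ε : ℝ) : ℂ) := by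
    push_cast
    congr 1
    ring
  rw [h4, ← Complex.ofReal_sub, Complex.norm_real, Complex.norm_real, Real.norm_eq_abs,
    Real.norm_eq_abs, abs_of_pos (show 0 < 1 + ε by linarith)] at h1
  have := (abs_le.1 h1).2
  linarith

/-- The sum `∑ d ∣ n, μ(d) χ(v - log d)`. -/
noncomputable def divisorSum (χ : ℝ → ℝ) (v : ℝ) (n : ℕ) : ℝ :=
  ∑ d ∈ n.divisors, (ArithmeticFunction.moebius d : ℝ) * χ (v - Real.log d)

section
variable {χ : ℝ → ℝ}

lemma IsCutoff.eq_zero_of_floor_lt (hχ : IsCutoff χ) {P : ℝ} {n : ℕ} (hn : ⌊Real.exp P⌋₊ < n) :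
    χ (P - Real.log n) = 0 := by
  have h1 := (Nat.floor_lt (Real.exp_pos P).le).1 hn
  have h2 := Real.log_lt_log (Real.exp_pos P) h1
  rw [Real.log_exp] at h2
  exact hχ.eq_zero _ (by linarith)

lemma IsCutoff.lcmForm_le (hχ : IsCutoff χ) (P : ℝ) {s : ℝ} (hs : 0 < s) :
    lcmForm (fun d => χ (P - Real.log d)) s ⌊Real.exp P⌋₊ ≤
      ∑ j ∈ Finset.Icc 1 ⌊Real.exp P⌋₊, (j : ℝ) ^ (-s) *
        moebiusSum χ s (P - Real.log j) ^ 2 := by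
  refine (_root_.lcmForm_le (a := fun d : ℕ => χ (P - Real.log d))
    (fun n hn => hχ.eq_zero_of_floor_lt hn) hs).trans (le_of_eq ?_)
  refine Finset.sum_congr rfl fun j hj => ?_
  rw [Finset.mem_Icc] at hj
  have hj0 : (0 : ℝ) < j := by exact_mod_cast hj.1
  rw [hχ.moebiusSum_eq_sum (S := Finset.Icc 1 ⌊Real.exp P⌋₊)]
  · congr 2
    refine Finset.sum_congr rfl fun c hc => ?_
    rw [Finset.mem_Icc] at hc
    have hc0 : (0 : ℝ) < c := by exact_mod_cast hc.1
    rw [Nat.cast_mul, Real.log_mul hj0.ne' hc0.ne', sub_sub]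
  · intro c hc hcu
    rw [Finset.mem_Icc]
    refine ⟨hc, Nat.le_floor (hcu.trans (Real.exp_le_exp.2 ?_))⟩
    have := Real.log_nonneg (show (1 : ℝ) ≤ j by exact_mod_cast hj.1)
    linarith

lemma IsCutoff.abs_le_one (hχ : IsCutoff χ) (x : ℝ) : |χ x| ≤ 1 := by
  rw [abs_of_nonneg (hχ.nonneg x)]
  exact hχ.le_one x

lemma IsCutoff.sum_divisorSum_sq_le (hχ : IsCutoff χ) {B v X : ℝ} (hX : 0 ≤ X)
    (hB : ∑ j ∈ Finset.Icc 1 ⌊Real.exp v⌋₊, (j : ℝ) ^ (-(1 : ℝ)) *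
      moebiusSum χ 1 (v - Real.log j) ^ 2 ≤ B) :
    ∑ n ∈ Finset.Icc 1 ⌊X⌋₊, divisorSum χ v n ^ 2 ≤ B * X + Real.exp v ^ 2 := by
  refine (sum_sq_sum_divisors_le (a := fun d : ℕ => χ (v - Real.log d))
    (fun n hn => hχ.eq_zero_of_floor_lt hn) (fun n => hχ.abs_le_one _) hX).trans ?_
  have h1 := (hχ.lcmForm_le v one_pos).trans hB
  have h2 := Nat.floor_le (Real.exp_pos v).le
  have h3 := mul_le_mul_of_nonneg_left h1 hX
  have h4 := pow_le_pow_left₀ (Nat.cast_nonneg _) h2 2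
  linarith

lemma IsCutoff.sum_inv_mul_divisorSum_sq_le (hχ : IsCutoff χ) {B v T : ℝ} (hT : 0 ≤ T)
    (hB : ∑ j ∈ Finset.Icc 1 ⌊Real.exp v⌋₊, (j : ℝ) ^ (-(1 + 1 / (2 * (1 + T)))) *
      moebiusSum χ (1 + 1 / (2 * (1 + T))) (v - Real.log j) ^ 2 ≤ B) :
    ∑ n ∈ Finset.Icc 1 ⌊Real.exp T⌋₊, (n : ℝ)⁻¹ * divisorSum χ v n ^ 2 ≤ 18 * (1 + T) * B := by
  set ε := 1 / (2 * (1 + T)) with hε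
  have hε0 : 0 < ε := by positivity
  have hε1 : ε ≤ 1 := by
    rw [hε, div_le_one (by positivity)]
    linarith
  have hεT : ε * T ≤ 1 := by
    rw [hε, div_mul_eq_mul_div, one_mul, div_le_one (by positivity)]
    linarith
  have h1 := sum_rpow_mul_sq_sum_divisors_le (a := fun d : ℕ => χ (v - Real.log d))
    (Y := ⌊Real.exp v⌋₊) (fun n hn => hχ.eq_zero_of_floor_lt hn) (show 1 < 1 + ε by linarith)
    ⌊Real.exp T⌋₊
  have h2 := (hχ.lcmForm_le v (show 0 < 1 + ε by linarith)).trans hB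
  have h3 := tsum_rpow_neg_le hε0 hε1
  have hZ : 0 ≤ ∑' n : ℕ, (n : ℝ) ^ (-(1 + ε)) :=
    tsum_nonneg fun n => Real.rpow_nonneg (Nat.cast_nonneg n) _
  have hB0 : 0 ≤ B := (Finset.sum_nonneg fun j _ =>
    mul_nonneg (Real.rpow_nonneg (Nat.cast_nonneg j) _) (sq_nonneg _)).trans hB
  have h4 : 1 / ε + 4 ≤ 6 * (1 + T) := by
    have : 1 / ε = 2 * (1 + T) := by rw [hε]; field_simp
    linarith
  have h5 : ∑ n ∈ Finset.Icc 1 ⌊Real.exp T⌋₊, (n : ℝ)⁻¹ * divisorSum χ v n ^ 2 ≤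
      3 * ∑ n ∈ Finset.Icc 1 ⌊Real.exp T⌋₊, (n : ℝ) ^ (-(1 + ε)) * divisorSum χ v n ^ 2 := by
    rw [Finset.mul_sum]
    refine Finset.sum_le_sum fun n hn => ?_
    rw [Finset.mem_Icc, Nat.le_floor_iff (Real.exp_pos T).le] at hn
    have hn0 : (0 : ℝ) < n := by exact_mod_cast hn.1
    rw [← mul_assoc]
    refine mul_le_mul_of_nonneg_right ?_ (sq_nonneg _)
    rw [neg_add, Real.rpow_add hn0, Real.rpow_neg_one, Real.rpow_neg hn0.le]
    have h6 : (n : ℝ) ^ ε ≤ 3 := by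
      calc (n : ℝ) ^ ε ≤ Real.exp T ^ ε := Real.rpow_le_rpow hn0.le hn.2 hε0.le
        _ = Real.exp (ε * T) := by rw [← Real.exp_mul, mul_comm]
        _ ≤ Real.exp 1 := Real.exp_le_exp.2 hεT
        _ ≤ 3 := Real.exp_one_lt_three.le
    have h7 : 0 < (n : ℝ) ^ ε := Real.rpow_pos_of_pos hn0 _
    have h8 : 1 ≤ 3 * ((n : ℝ) ^ ε)⁻¹ := by
      rw [← div_eq_mul_inv, one_le_div h7]
      exact h6
    calc (n : ℝ)⁻¹ = (n : ℝ)⁻¹ * 1 := (mul_one _).symm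
      _ ≤ (n : ℝ)⁻¹ * (3 * ((n : ℝ) ^ ε)⁻¹) := by gcongr
      _ = _ := by ring
  have h6 : (∑' n : ℕ, (n : ℝ) ^ (-(1 + ε))) *
      lcmForm (fun d : ℕ => χ (v - Real.log d)) (1 + ε) ⌊Real.exp v⌋₊ ≤ 6 * (1 + T) * B :=
    (mul_le_mul_of_nonneg_left h2 hZ).trans (mul_le_mul_of_nonneg_right (h3.trans h4) hB0)
  have h7 := h1.trans h6
  unfold divisorSum at h5 ⊢
  linarith

end

lemma exists_sum_divisorSum_sq_le : ∃ C : ℝ, 0 < C ∧ ∀ v : ℝ, 0 ≤ v → ∀ X : ℝ, 0 ≤ X →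
    ∑ n ∈ Finset.Icc 1 ⌊X⌋₊, divisorSum unitStep v n ^ 2 ≤ C * X + Real.exp v ^ 2 ∧
    ∀ L : ℝ, 1 ≤ L →
      ∑ n ∈ Finset.Icc 1 ⌊X⌋₊, divisorSum (ramp L) v n ^ 2 ≤ C / L * X + Real.exp v ^ 2 := by
  obtain ⟨C, hC, H⟩ := exists_sum_moebiusSum_sq_le
  refine ⟨C, hC, fun v hv X hX => ?_⟩
  obtain ⟨h1, h2⟩ := H v 0 hv le_rfl (by positivity)
  rw [add_zero] at h1
  refine ⟨isCutoff_unitStep.sum_divisorSum_sq_le hX h1, fun L hL => ?_⟩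
  have h3 := h2 L hL
  rw [add_zero] at h3
  exact (isCutoff_ramp (by linarith)).sum_divisorSum_sq_le hX h3

lemma exists_sum_inv_mul_divisorSum_sq_le : ∃ C : ℝ, 0 < C ∧ ∀ v T : ℝ, 0 ≤ v → v ≤ T →
    ∑ n ∈ Finset.Icc 1 ⌊Real.exp T⌋₊, (n : ℝ)⁻¹ * divisorSum unitStep v n ^ 2 ≤ C * (1 + T) ∧
    ∀ L : ℝ, 1 ≤ L → ∑ n ∈ Finset.Icc 1 ⌊Real.exp T⌋₊,
      (n : ℝ)⁻¹ * divisorSum (ramp L) v n ^ 2 ≤ C * (1 + T) / L := by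
  obtain ⟨C, hC, H⟩ := exists_sum_moebiusSum_sq_le
  refine ⟨18 * C, by positivity, fun v T hv hT => ?_⟩
  obtain ⟨h1, h2⟩ := H v (1 / (2 * (1 + T))) hv
    (div_nonneg zero_le_one (by linarith))
    (one_div_le_one_div_of_le (by linarith) (by linarith))
  refine ⟨(isCutoff_unitStep.sum_inv_mul_divisorSum_sq_le (by linarith) h1).trans
    (le_of_eq (by ring)), fun L hL => ?_⟩
  exact ((isCutoff_ramp (by linarith)).sum_inv_mul_divisorSum_sq_le (by linarith)
    (h2 L hL)).trans (le_of_eq (by ring))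

section
variable {χ : ℝ → ℝ}

lemma IsCutoff.divisorSum_eq_zero (hχ : IsCutoff χ) {v : ℝ} (hv : v < 0) (n : ℕ) :
    divisorSum χ v n = 0 := by
  refine Finset.sum_eq_zero fun d hd => ?_
  have h1 : (1 : ℝ) ≤ d := by exact_mod_cast Nat.pos_of_mem_divisors hd
  rw [hχ.eq_zero _ (by linarith [Real.log_nonneg h1]), mul_zero]

lemma IsCutoff.measurable_divisorSum (hχ : IsCutoff χ) (n : ℕ) :
    Measurable fun v => divisorSum χ v n := by
  have := hχ.measurable
  unfold divisorSum
  fun_prop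

lemma IsCutoff.abs_divisorSum_le (hχ : IsCutoff χ) (v : ℝ) (n : ℕ) :
    |divisorSum χ v n| ≤ n.divisors.card := by
  refine (Finset.abs_sum_le_sum_abs _ _).trans ?_
  refine (Finset.sum_le_card_nsmul _ _ 1 fun d _ => ?_).trans (by simp)
  exact abs_moebius_mul_le (a := fun d : ℕ => χ (v - Real.log d)) (fun d => hχ.abs_le_one _) d

lemma IsCutoff.intervalIntegrable_divisorSum (hχ : IsCutoff χ) (n : ℕ) (a b : ℝ) :
    IntervalIntegrable (fun v => divisorSum χ v n) volume a b :=
  (intervalIntegrable_const (c := (n.divisors.card : ℝ))).mono_fun'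
    (hχ.measurable_divisorSum n).aestronglyMeasurable
    (Eventually.of_forall fun v => hχ.abs_divisorSum_le v n)

lemma IsCutoff.intervalIntegrable_divisorSum_sq (hχ : IsCutoff χ) (n : ℕ) (a b : ℝ) :
    IntervalIntegrable (fun v => divisorSum χ v n ^ 2) volume a b := by
  refine (intervalIntegrable_const (c := (n.divisors.card : ℝ) ^ 2)).mono_fun'
    ((hχ.measurable_divisorSum n).pow_const 2).aestronglyMeasurable
    (Eventually.of_forall fun v => ?_)
  simp only
  rw [Real.norm_eq_abs, abs_pow]
  have := hχ.abs_divisorSum_le v n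
  gcongr

end

lemma divisorSum_ramp_eq {L : ℝ} (hL : 0 < L) (v : ℝ) (n : ℕ) :
    divisorSum (ramp L) v n = L⁻¹ * ∫ t in (v - L)..v, divisorSum unitStep t n :=
  sum_mul_ramp _ _ _ hL v

lemma divisorSum_ramp_sq_le {L : ℝ} (hL : 0 < L) (v : ℝ) (n : ℕ) :
    divisorSum (ramp L) v n ^ 2 ≤ L⁻¹ * ∫ t in (v - L)..v, divisorSum unitStep t n ^ 2 := by
  have h1 := sq_integral_le (show v - L ≤ v by linarith)
    (isCutoff_unitStep.intervalIntegrable_divisorSum n _ _)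
    (isCutoff_unitStep.intervalIntegrable_divisorSum_sq n _ _)
  rw [divisorSum_ramp_eq hL, mul_pow]
  calc _ ≤ (L⁻¹) ^ 2 * ((v - (v - L)) * ∫ t in (v - L)..v, divisorSum unitStep t n ^ 2) := by
        gcongr
    _ = _ := by field_simp; ring

lemma divisorSum_ramp_sub_sq_le {L : ℝ} (hL : 0 < L) {a u b : ℝ} (hau : a ≤ u)
    (hub : u ≤ b) (n : ℕ) : (divisorSum (ramp L) b n - divisorSum (ramp L) u n) ^ 2 ≤
      2 * (L ^ 2)⁻¹ * (b - a) * ((∫ t in a..b, divisorSum unitStep t n ^ 2) +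
        ∫ t in (a - L)..(b - L), divisorSum unitStep t n ^ 2) := by
  have hi := isCutoff_unitStep.intervalIntegrable_divisorSum n
  have hi2 := isCutoff_unitStep.intervalIntegrable_divisorSum_sq n
  set M := fun t => divisorSum unitStep t n with hM
  have h1 : divisorSum (ramp L) b n - divisorSum (ramp L) u n =
      L⁻¹ * ((∫ t in u..b, M t) - ∫ t in (u - L)..(b - L), M t) := by
    rw [divisorSum_ramp_eq hL, divisorSum_ramp_eq hL, ← mul_sub]
    congr 1
    rw [intervalIntegral.integral_interval_sub_interval_comm' (hi _ _) (hi _ _) (hi _ _)]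
  have h2 := sq_integral_le hub (hi u b) (hi2 u b)
  have h3 := sq_integral_le (show u - L ≤ b - L by linarith) (hi _ _) (hi2 _ _)
  have h4 : ∀ c, ∫ t in (u - c)..(b - c), M t ^ 2 ≤ ∫ t in (a - c)..(b - c), M t ^ 2 := fun c =>
    intervalIntegral.integral_mono_interval (by linarith) (by linarith) le_rfl
      (Eventually.of_forall fun t => sq_nonneg _) (hi2 _ _)
  have h5 := h4 L
  have h6 := h4 0
  simp only [sub_zero] at h6
  have h7 : ∀ c, 0 ≤ ∫ t in (u - c)..(b - c), M t ^ 2 := fun c =>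
    intervalIntegral.integral_nonneg (by linarith) fun t _ => sq_nonneg _
  have h8 := h7 L
  have h9 := h7 0
  simp only [sub_zero] at h9
  rw [h1, mul_pow, inv_pow]
  change (∫ t in u..b, M t) ^ 2 ≤ (b - u) * ∫ t in u..b, M t ^ 2 at h2
  change (∫ t in (u - L)..(b - L), M t) ^ 2 ≤
    (b - L - (u - L)) * ∫ t in (u - L)..(b - L), M t ^ 2 at h3
  change _ ≤ 2 * (L ^ 2)⁻¹ * (b - a) * ((∫ t in a..b, M t ^ 2) +
        ∫ t in (a - L)..(b - L), M t ^ 2)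
  set A := ∫ t in u..b, M t
  set B := ∫ t in (u - L)..(b - L), M t
  have h10 : (A - B) ^ 2 ≤ 2 * (b - a) * ((∫ t in a..b, M t ^ 2) +
      ∫ t in (a - L)..(b - L), M t ^ 2) := by
    have e1 : (b - u) * (∫ t in u..b, M t ^ 2) ≤ (b - a) * ∫ t in a..b, M t ^ 2 :=
      mul_le_mul (by linarith) h6 h9 (by linarith)
    have e2 : (b - L - (u - L)) * (∫ t in (u - L)..(b - L), M t ^ 2) ≤
        (b - a) * ∫ t in (a - L)..(b - L), M t ^ 2 :=
      mul_le_mul (by linarith) h5 h8 (by linarith)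
    nlinarith [sq_nonneg (A + B)]
  calc _ ≤ (L ^ 2)⁻¹ * (2 * (b - a) * ((∫ t in a..b, M t ^ 2) +
      ∫ t in (a - L)..(b - L), M t ^ 2)) := by gcongr
    _ = _ := by ring

lemma ramp_sub_self {L : ℝ} (hL : 0 < L) (x : ℝ) : ramp L (L - x) = 1 - ramp L x := by
  have h : (L - x) / L = 1 - x / L := by field_simp
  unfold ramp
  rw [h]
  rcases le_total (x / L) 0 with h1 | h1
  · rw [min_eq_left (by linarith), min_eq_right (by linarith), max_eq_right zero_le_one,
      max_eq_left h1, sub_zero]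
  · rcases le_total (x / L) 1 with h2 | h2
    · rw [min_eq_right (by linarith), min_eq_right h2, max_eq_right (by linarith),
        max_eq_right h1]
    · rw [min_eq_right (by linarith), min_eq_left h2, max_eq_left (by linarith),
        max_eq_right zero_le_one, sub_self]

lemma divisorSum_ramp_sq_eq {L : ℝ} (hL : 0 < L) (v : ℝ) {n : ℕ} (hn : Squarefree n)
    (hn1 : n ≠ 1) :
    divisorSum (ramp L) v n ^ 2 = divisorSum (ramp L) (Real.log n - (v - L)) n ^ 2 := by
  have hn0 : (0 : ℝ) < n := by exact_mod_cast hn.ne_zero.bot_lt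
  have h1 : divisorSum (ramp L) v n = (ArithmeticFunction.moebius n : ℝ) *
      ∑ e ∈ n.divisors, (ArithmeticFunction.moebius e : ℝ) *
        (1 - ramp L (Real.log n - (v - L) - Real.log e)) := by
    rw [divisorSum, Finset.mul_sum, ← Nat.sum_div_divisors n]
    refine Finset.sum_congr rfl fun e he => ?_
    obtain ⟨d, rfl⟩ := Nat.dvd_of_mem_divisors he
    have he0 : e ≠ 0 := left_ne_zero_of_mul hn.ne_zero
    have hd0 : d ≠ 0 := right_ne_zero_of_mul hn.ne_zero
    rw [Nat.mul_div_cancel_left _ he0.bot_lt, ← ramp_sub_self hL, Nat.cast_mul,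
      Real.log_mul (by exact_mod_cast he0) (by exact_mod_cast hd0),
      ArithmeticFunction.isMultiplicative_moebius.map_mul_of_coprime
        (Nat.coprime_of_squarefree_mul hn)]
    have h2 : (ArithmeticFunction.moebius e : ℝ) * ArithmeticFunction.moebius e = 1 := by
      have := ArithmeticFunction.moebius_sq_eq_one_of_squarefree hn.of_mul_left
      rw [sq] at this
      exact_mod_cast this
    rw [show L - (Real.log e + Real.log d - (v - L) - Real.log e) = v - Real.log d by ring]
    push_cast
    linear_combination (-(ArithmeticFunction.moebius d : ℝ) * ramp L (v - Real.log d)) * h2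
  have h2 : ∑ e ∈ n.divisors, (ArithmeticFunction.moebius e : ℝ) = 0 := by
    have h := congrArg (fun f : ArithmeticFunction ℝ => f n)
      (ArithmeticFunction.coe_moebius_mul_coe_zeta (R := ℝ))
    simp only [ArithmeticFunction.coe_mul_zeta_apply, ArithmeticFunction.one_apply_ne hn1] at h
    exact h
  have h3 : (ArithmeticFunction.moebius n : ℝ) ^ 2 = 1 := by
    exact_mod_cast ArithmeticFunction.moebius_sq_eq_one_of_squarefree hn
  simp only [mul_sub, mul_one, Finset.sum_sub_distrib, h2, zero_sub] at h1
  rw [h1, mul_pow, h3]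
  simp only [divisorSum]
  ring

lemma exists_rankin_bound : ∃ C : ℝ, 0 < C ∧ ∀ L v T : ℝ, 0 < L → L ≤ v → v ≤ T →
    v - L ≤ T - v + L →
    ∑ n ∈ Finset.Icc 1 ⌊Real.exp T⌋₊, (n : ℝ)⁻¹ * divisorSum (ramp L) v n ^ 2 ≤
      C * ((T - v + L) / L) := by
  obtain ⟨C, hC, H⟩ := exists_sum_inv_mul_divisorSum_sq_le
  refine ⟨3 * C, by positivity, fun L v T hL hLv hvT hZ => ?_⟩
  rcases le_or_gt 1 L with h1 | h1
  · refine ((H v T (by linarith) hvT).2 L h1).trans ?_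
    rw [mul_div_assoc, mul_assoc 3 C, mul_left_comm]
    refine mul_le_mul_of_nonneg_left ?_ hC.le
    rw [← mul_div_assoc]
    gcongr
    linarith
  · have h2 : ∑ n ∈ Finset.Icc 1 ⌊Real.exp T⌋₊, (n : ℝ)⁻¹ * divisorSum (ramp L) v n ^ 2 ≤
        C * (1 + T) := by
      calc _ ≤ ∑ n ∈ Finset.Icc 1 ⌊Real.exp T⌋₊,
            L⁻¹ * ∫ t in (v - L)..v, (n : ℝ)⁻¹ * divisorSum unitStep t n ^ 2 := by
            refine Finset.sum_le_sum fun n _ => ?_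
            rw [intervalIntegral.integral_const_mul, mul_left_comm]
            exact mul_le_mul_of_nonneg_left (divisorSum_ramp_sq_le hL v n) (by positivity)
        _ = L⁻¹ * ∫ t in (v - L)..v, ∑ n ∈ Finset.Icc 1 ⌊Real.exp T⌋₊,
            (n : ℝ)⁻¹ * divisorSum unitStep t n ^ 2 := by
            rw [intervalIntegral.integral_finsetSum, Finset.mul_sum]
            exact fun n _ =>
              (isCutoff_unitStep.intervalIntegrable_divisorSum_sq n _ _).const_mul _
        _ ≤ L⁻¹ * ∫ t in (v - L)..v, C * (1 + T) := by
            refine mul_le_mul_of_nonneg_left ?_ (by positivity)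
            refine intervalIntegral.integral_mono_on (by linarith) ?_ (by simp) fun t ht =>
              (H t T (by linarith [ht.1]) (by linarith [ht.2])).1
            have : IntervalIntegrable (∑ n ∈ Finset.Icc 1 ⌊Real.exp T⌋₊, fun t =>
                (n : ℝ)⁻¹ * divisorSum unitStep t n ^ 2) volume (v - L) v :=
              IntervalIntegrable.sum _ fun n _ =>
                (isCutoff_unitStep.intervalIntegrable_divisorSum_sq n _ _).const_mul _
            convert this using 1
            funext t
            simp
        _ = _ := by
            rw [intervalIntegral.integral_const, smul_eq_mul]
            field_simp
            ring
    refine h2.trans ?_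
    rw [mul_assoc 3 C, mul_left_comm]
    refine mul_le_mul_of_nonneg_left ?_ hC.le
    rw [← mul_div_assoc, le_div_iff₀ hL]
    nlinarith

/-- Integrating a bound over windows of logarithmic length one. -/
lemma sum_inv_mul_le_integral_of_window {F : ℝ → ℕ → ℝ} {g : ℕ → ℝ} {A Z p q : ℝ}
    (hZ : 0 ≤ Z) (hF : ∀ t n, 0 ≤ F t n) (hF0 : ∀ t n, t < 0 → F t n = 0)
    (hFi : ∀ n a b, IntervalIntegrable (fun t => F t n) volume a b)
    (hFs : ∀ t X, 0 ≤ t → 0 ≤ X → ∑ n ∈ Finset.Icc 1 ⌊X⌋₊, F t n ≤ p * X + q * Real.exp t ^ 2)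
    (hg : ∀ n : ℕ, g n ≤ ∫ t in (Real.log n - A - 1)..(Real.log n - A), F t n)
    (S : Finset ℕ) (hS : ∀ n ∈ S, 0 < n ∧ A < Real.log n ∧ Real.log n ≤ A + Z) :
    ∑ n ∈ S, (n : ℝ)⁻¹ * g n ≤
      ∫ t in (0 : ℝ)..Z, (p * Real.exp 1 + q * Real.exp (t - A)) := by
  classical
  set G : ℕ → ℝ → ℝ := fun n => (Set.Ioc (Real.log n - A - 1) (Real.log n - A)).indicator
    (fun t => Real.exp (-A - t) * F t n) with hG
  have hcont : Continuous fun t : ℝ => Real.exp (-A - t) := by fun_prop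
  have hFe : ∀ n a b, IntervalIntegrable (fun t => Real.exp (-A - t) * F t n) volume a b :=
    fun n a b => (hFi n a b).continuousOn_mul hcont.continuousOn
  have hGi : ∀ n, IntervalIntegrable (G n) volume 0 Z := by
    intro n
    rw [intervalIntegrable_iff]
    exact (intervalIntegrable_iff.1 (hFe n 0 Z)).indicator measurableSet_Ioc
  have h1 : ∀ n ∈ S, (n : ℝ)⁻¹ * g n ≤ ∫ t in (0 : ℝ)..Z, G n t := by
    intro n hn
    obtain ⟨hn0, hAn, hnZ⟩ := hS n hn
    set u := Real.log n - A with hu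
    have hn0' : (0 : ℝ) < n := by exact_mod_cast hn0
    have hu0 : 0 < u := by linarith
    have huZ : u ≤ Z := by linarith
    set r := max 0 (u - 1) with hr
    have hru : r ≤ u := max_le hu0.le (by linarith)
    have e1 : ∫ t in (0 : ℝ)..Z, G n t = ∫ t in r..u, Real.exp (-A - t) * F t n := by
      rw [intervalIntegral.integral_of_le hZ, intervalIntegral.integral_of_le hru,
        setIntegral_indicator measurableSet_Ioc, Set.Ioc_inter_Ioc, ← hu, ← hr,
        min_eq_right huZ]
    have e2 : ∫ t in (u - 1)..u, F t n = ∫ t in r..u, F t n := by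
      rw [← intervalIntegral.integral_add_adjacent_intervals (hFi n (u - 1) r) (hFi n r u)]
      have : ∫ t in (u - 1)..r, F t n = 0 := by
        refine intervalIntegral.integral_zero_ae ?_
        filter_upwards [Measure.ae_ne volume (0 : ℝ)] with t ht htr
        rw [Set.uIoc_of_le (le_max_right _ _)] at htr
        refine hF0 t n (lt_of_le_of_ne ?_ ht)
        rcases le_total (u - 1) 0 with h | h
        · rw [max_eq_left h] at htr
          exact htr.2
        · rw [max_eq_right h] at htr
          linarith [htr.1, htr.2]
      rw [this, zero_add]
    rw [e1]
    refine (mul_le_mul_of_nonneg_left (hg n) (by positivity)).trans ?_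
    rw [e2, ← intervalIntegral.integral_const_mul]
    refine intervalIntegral.integral_mono_on hru ((hFi n r u).const_mul _) (hFe n r u)
      fun t ht => mul_le_mul_of_nonneg_right ?_ (hF t n)
    rw [← Real.exp_log hn0', ← Real.exp_neg]
    exact Real.exp_le_exp.2 (by linarith [ht.2])
  calc _ ≤ ∑ n ∈ S, ∫ t in (0 : ℝ)..Z, G n t := Finset.sum_le_sum h1
    _ = ∫ t in (0 : ℝ)..Z, ∑ n ∈ S, G n t :=
        (intervalIntegral.integral_finsetSum fun n _ => hGi n).symm
    _ ≤ _ := by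
        refine intervalIntegral.integral_mono_on hZ ?_ ?_ fun t ht => ?_
        · have : IntervalIntegrable (∑ n ∈ S, G n) volume 0 Z :=
            IntervalIntegrable.sum _ fun n _ => hGi n
          convert this using 1
          funext t
          simp
        · have : Continuous fun t => p * Real.exp 1 + q * Real.exp (t - A) := by fun_prop
          exact this.intervalIntegrable _ _
        · have h2 : ∑ n ∈ S, G n t ≤
              ∑ n ∈ Finset.Icc 1 ⌊Real.exp (A + t + 1)⌋₊, Real.exp (-A - t) * F t n := by
            have h3 : ∑ n ∈ S, G n t =
                ∑ n ∈ S.filter (fun n : ℕ => t ∈ Set.Ioc (Real.log n - A - 1) (Real.log n - A)),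
                  Real.exp (-A - t) * F t n := by
              rw [Finset.sum_filter]
              exact Finset.sum_congr rfl fun n _ => by simp only [hG, Set.indicator_apply]
            rw [h3]
            refine Finset.sum_le_sum_of_subset_of_nonneg ?_ fun n _ _ =>
              mul_nonneg (Real.exp_pos _).le (hF t n)
            intro n hn
            rw [Finset.mem_filter] at hn
            obtain ⟨hnS, hnt⟩ := hn
            have hn0 := (hS n hnS).1
            rw [Finset.mem_Icc]
            refine ⟨hn0, Nat.le_floor ?_⟩
            rw [← Real.exp_log (show (0 : ℝ) < n by exact_mod_cast hn0)]
            exact Real.exp_le_exp.2 (by linarith [hnt.1])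
          refine h2.trans ?_
          rw [← Finset.mul_sum]
          refine (mul_le_mul_of_nonneg_left (hFs t _ ht.1 (Real.exp_pos _).le)
            (Real.exp_pos _).le).trans (le_of_eq ?_)
          have e1 : Real.exp (-A - t) * Real.exp (A + t + 1) = Real.exp 1 := by
            rw [← Real.exp_add]
            congr 1
            ring
          have e2 : Real.exp (-A - t) * Real.exp t ^ 2 = Real.exp (t - A) := by
            rw [← Real.exp_nat_mul, ← Real.exp_add]
            congr 1
            push_cast
            ring
          rw [← e1, ← e2]
          ring

lemma integral_const_add_exp_le {A Z : ℝ} (hZ : 0 ≤ Z) (hZA : Z ≤ A) {p q b : ℝ} (hq : 0 ≤ q)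
    (hb : q * min 1 Z ≤ b) :
    ∫ t in (0 : ℝ)..Z, (p * Real.exp 1 + q * Real.exp (t - A)) ≤ p * Real.exp 1 * Z + b := by
  have h1 : ∫ t in (0 : ℝ)..Z, Real.exp (t - A) = Real.exp (Z - A) - Real.exp (0 - A) := by
    rw [intervalIntegral.integral_comp_sub_right (fun t => Real.exp t), integral_exp]
  have hc : Continuous fun t : ℝ => q * Real.exp (t - A) := by fun_prop
  rw [intervalIntegral.integral_add (by simp) (hc.intervalIntegrable _ _),
    intervalIntegral.integral_const, smul_eq_mul, intervalIntegral.integral_const_mul, h1]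
  have h2 : Real.exp (Z - A) - Real.exp (0 - A) ≤ min 1 Z := by
    have h3 : Real.exp (Z - A) ≤ 1 := Real.exp_le_one_iff.2 (by linarith)
    refine le_min (by linarith [Real.exp_pos (0 - A)]) ?_
    have h4 : Real.exp (0 - A) = Real.exp (Z - A) * Real.exp (-Z) := by
      rw [← Real.exp_add]
      congr 1
      ring
    have h5 := Real.add_one_le_exp (-Z)
    have h6 := Real.exp_pos (Z - A)
    rw [h4]
    nlinarith
  nlinarith [mul_le_mul_of_nonneg_left h2 hq]

lemma divisorSum_ramp_sq_le_integral_of_le_one {L : ℝ} (hL : 0 < L) (hL1 : L ≤ 1) (u : ℝ)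
    (n : ℕ) : divisorSum (ramp L) u n ^ 2 ≤
      ∫ t in (u - 1)..u, L⁻¹ * divisorSum unitStep t n ^ 2 := by
  rw [intervalIntegral.integral_const_mul]
  refine (divisorSum_ramp_sq_le hL u n).trans (mul_le_mul_of_nonneg_left ?_ (by positivity))
  exact intervalIntegral.integral_mono_interval (by linarith) (by linarith) le_rfl
    (Eventually.of_forall fun t => sq_nonneg _)
    (isCutoff_unitStep.intervalIntegrable_divisorSum_sq n _ _)

lemma divisorSum_ramp_sq_le_integral {L : ℝ} (hL : 0 < L) (u : ℝ) (n : ℕ) :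
    divisorSum (ramp L) u n ^ 2 ≤
      ∫ t in (u - 1)..u, (2 * divisorSum (ramp L) t n ^ 2 + 4 * (L ^ 2)⁻¹ *
        (divisorSum unitStep t n ^ 2 + divisorSum unitStep (t - L) n ^ 2)) := by
  have hN := isCutoff_unitStep.intervalIntegrable_divisorSum_sq n
  have hD := (isCutoff_ramp hL).intervalIntegrable_divisorSum_sq n
  have hN' : IntervalIntegrable (fun t => divisorSum unitStep (t - L) n ^ 2) volume (u - 1) u := by
    have := (hN (u - 1 - L) (u - L)).comp_sub_right L
    simpa using this
  rw [intervalIntegral.integral_add ((hD _ _).const_mul 2) (((hN _ _).add hN').const_mul _),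
    intervalIntegral.integral_const_mul, intervalIntegral.integral_const_mul,
    intervalIntegral.integral_add (hN _ _) hN',
    intervalIntegral.integral_comp_sub_right (fun t => divisorSum unitStep t n ^ 2)]
  set E := 4 * (L ^ 2)⁻¹ * ((∫ t in (u - 1)..u, divisorSum unitStep t n ^ 2) +
    ∫ t in (u - 1 - L)..(u - L), divisorSum unitStep t n ^ 2) with hE
  have h1 : ∀ t ∈ Set.Icc (u - 1) u, divisorSum (ramp L) u n ^ 2 - E ≤
      2 * divisorSum (ramp L) t n ^ 2 := by
    intro t ht
    have h := divisorSum_ramp_sub_sq_le hL ht.1 ht.2 n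
    rw [show 2 * (L ^ 2)⁻¹ * (u - (u - 1)) * ((∫ t in (u - 1)..u, divisorSum unitStep t n ^ 2) +
      ∫ t in (u - 1 - L)..(u - L), divisorSum unitStep t n ^ 2) = E / 2 by rw [hE]; ring] at h
    nlinarith [sq_nonneg (divisorSum (ramp L) u n - 2 * divisorSum (ramp L) t n)]
  have h2 := intervalIntegral.integral_mono_on (by linarith) (by simp)
    ((hD (u - 1) u).const_mul 2) h1
  rw [intervalIntegral.integral_const, intervalIntegral.integral_const_mul, sub_sub_cancel,
    one_smul] at h2
  linarith

lemma exists_sum_inv_mul_divisorSum_log_sub_sq_le : ∃ C : ℝ, 0 < C ∧ ∀ L A Z : ℝ, 0 < L →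
    L ≤ Z → Z ≤ A → ∀ S : Finset ℕ, (∀ n ∈ S, 0 < n ∧ A < Real.log n ∧ Real.log n ≤ A + Z) →
    ∑ n ∈ S, (n : ℝ)⁻¹ * divisorSum (ramp L) (Real.log n - A) n ^ 2 ≤ C * (Z / L) := by
  obtain ⟨C, hC, H⟩ := exists_sum_divisorSum_sq_le
  refine ⟨10 * C * Real.exp 1 + 10, by positivity, fun L A Z hL hLZ hZA S hS => ?_⟩
  have hZ : 0 < Z := hL.trans_le hLZ
  have hN := isCutoff_unitStep.intervalIntegrable_divisorSum_sq
  rcases le_total L 1 with h1 | h1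
  · have := sum_inv_mul_le_integral_of_window
      (F := fun t n => L⁻¹ * divisorSum unitStep t n ^ 2)
      (g := fun n => divisorSum (ramp L) (Real.log n - A) n ^ 2)
      (p := C / L) (q := L⁻¹) hZ.le (fun t n => by positivity)
      (fun t n ht => by rw [isCutoff_unitStep.divisorSum_eq_zero ht]; simp)
      (fun n a b => (hN n a b).const_mul _)
      (fun t X ht hX => by
        rw [← Finset.mul_sum, div_eq_inv_mul, mul_assoc, ← mul_add]
        exact mul_le_mul_of_nonneg_left (H t ht X hX).1 (by positivity))
      (fun n => divisorSum_ramp_sq_le_integral_of_le_one hL h1 _ n) S hS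
    refine this.trans ((integral_const_add_exp_le (b := Z / L) hZ.le hZA (by positivity) ?_).trans
      ?_)
    · rw [div_eq_inv_mul]
      exact mul_le_mul_of_nonneg_left (min_le_right _ _) (by positivity)
    · have : 0 ≤ Z / L := by positivity
      have h2 : C / L * Real.exp 1 * Z = C * Real.exp 1 * (Z / L) := by ring
      have h3 : 0 ≤ C * Real.exp 1 * (Z / L) := by positivity
      nlinarith
  · have hr := isCutoff_ramp hL
    have := sum_inv_mul_le_integral_of_window
      (F := fun t n => 2 * divisorSum (ramp L) t n ^ 2 + 4 * (L ^ 2)⁻¹ *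
        (divisorSum unitStep t n ^ 2 + divisorSum unitStep (t - L) n ^ 2))
      (g := fun n => divisorSum (ramp L) (Real.log n - A) n ^ 2)
      (p := 10 * C / L) (q := 10) hZ.le (fun t n => by positivity)
      (fun t n ht => by
        rw [hr.divisorSum_eq_zero ht, isCutoff_unitStep.divisorSum_eq_zero ht,
          isCutoff_unitStep.divisorSum_eq_zero (by linarith : t - L < 0)]
        simp)
      (fun n a b => by
        have hN' : IntervalIntegrable (fun t => divisorSum unitStep (t - L) n ^ 2) volume a b := by
          have := (hN n (a - L) (b - L)).comp_sub_right L
          simpa using this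
        exact ((hr.intervalIntegrable_divisorSum_sq n a b).const_mul 2).add
          (((hN n a b).add hN').const_mul _))
      (fun t X ht hX => by
        have e1 := (H t ht X hX).2 L h1
        have e2 := (H t ht X hX).1
        have e3 : ∑ n ∈ Finset.Icc 1 ⌊X⌋₊, divisorSum unitStep (t - L) n ^ 2 ≤
            C * X + Real.exp t ^ 2 := by
          rcases lt_or_ge (t - L) 0 with h | h
          · rw [Finset.sum_eq_zero fun n _ => by
              rw [isCutoff_unitStep.divisorSum_eq_zero h]; simp]
            positivity
          · refine (H (t - L) h X hX).1.trans ?_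
            gcongr
            linarith
        have e4 : (L ^ 2)⁻¹ * (C * X) ≤ C / L * X := by
          rw [div_mul_eq_mul_div, div_eq_inv_mul]
          refine mul_le_mul_of_nonneg_right ?_ (by positivity)
          exact inv_anti₀ hL (by nlinarith)
        have e5 : (L ^ 2)⁻¹ * Real.exp t ^ 2 ≤ Real.exp t ^ 2 :=
          mul_le_of_le_one_left (by positivity) (inv_le_one_of_one_le₀ (by nlinarith))
        rw [Finset.sum_add_distrib, ← Finset.mul_sum, ← Finset.mul_sum, Finset.sum_add_distrib]
        have e6 := mul_le_mul_of_nonneg_left (add_le_add e2 e3)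
          (show 0 ≤ 4 * (L ^ 2)⁻¹ by positivity)
        have e7 : 10 * C / L * X = 10 * (C / L * X) := by ring
        rw [e7]
        nlinarith)
      (fun n => divisorSum_ramp_sq_le_integral hL _ n) S hS
    have hZL : 1 ≤ Z / L := (one_le_div hL).2 hLZ
    refine this.trans ((integral_const_add_exp_le (b := 10 * (Z / L)) hZ.le hZA (by norm_num)
      ?_).trans (le_of_eq (by ring)))
    have := min_le_left 1 Z
    linarith

lemma ramp_eq_div_mul_ramp {L v x : ℝ} (hL : 0 < L) (hv : 0 < v) (hvL : v ≤ L) (hx : x ≤ v) :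
    ramp L x = v / L * ramp v x := by
  unfold ramp
  rw [min_eq_right ((div_le_one hv).2 hx), min_eq_right ((div_le_one hL).2 (hx.trans hvL)),
    mul_max_of_nonneg _ _ (by positivity), mul_zero]
  congr 1
  field_simp

lemma divisorSum_ramp_eq_div_mul {L v : ℝ} (hL : 0 < L) (hv : 0 < v) (hvL : v ≤ L) (n : ℕ) :
    divisorSum (ramp L) v n = v / L * divisorSum (ramp v) v n := by
  rw [divisorSum, divisorSum, Finset.mul_sum]
  refine Finset.sum_congr rfl fun d hd => ?_
  have h1 : (1 : ℝ) ≤ d := by exact_mod_cast Nat.pos_of_mem_divisors hd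
  rw [ramp_eq_div_mul_ramp hL hv hvL (by linarith [Real.log_nonneg h1])]
  ring

lemma divisorSum_ramp_eq_zero {L v : ℝ} (hL : 0 < L) (hv : v ≤ 0) (n : ℕ) :
    divisorSum (ramp L) v n = 0 := by
  refine Finset.sum_eq_zero fun d hd => ?_
  have h1 : (1 : ℝ) ≤ d := by exact_mod_cast Nat.pos_of_mem_divisors hd
  have h2 : (v - Real.log d) / L ≤ 0 :=
    div_nonpos_of_nonpos_of_nonneg (by linarith [Real.log_nonneg h1]) hL.le
  rw [ramp, max_eq_left ((min_le_right _ _).trans h2), mul_zero]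

lemma exists_sum_squarefree_inv_mul_divisorSum_sq_le : ∃ C : ℝ, 0 < C ∧ ∀ L v T : ℝ, 0 < L →
    v ≤ T → ∑ m ∈ Finset.Icc 1 ⌊Real.exp T⌋₊ with Squarefree m,
      (m : ℝ)⁻¹ * divisorSum (ramp L) v m ^ 2 ≤ C * ((T - v + L) / L) := by
  obtain ⟨C₁, hC₁, H₁⟩ := exists_rankin_bound
  obtain ⟨C₂, hC₂, H₂⟩ := exists_sum_inv_mul_divisorSum_log_sub_sq_le
  refine ⟨C₁ + C₂ + 1, by positivity, fun L v T hL hvT => ?_⟩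
  have hZL : 1 ≤ (T - v + L) / L := (one_le_div hL).2 (by linarith)
  have hsub : ∀ M : ℝ, ∑ m ∈ Finset.Icc 1 ⌊Real.exp T⌋₊ with Squarefree m,
      (m : ℝ)⁻¹ * divisorSum (ramp M) v m ^ 2 ≤
      ∑ m ∈ Finset.Icc 1 ⌊Real.exp T⌋₊, (m : ℝ)⁻¹ * divisorSum (ramp M) v m ^ 2 := fun M =>
    Finset.sum_le_sum_of_subset_of_nonneg (Finset.filter_subset _ _) fun m _ _ => by positivity
  rcases le_or_gt v 0 with hv | hv
  · rw [Finset.sum_eq_zero fun m _ => by rw [divisorSum_ramp_eq_zero hL hv]; simp]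
    positivity
  rcases le_total v L with hvL | hvL
  · have h1 := (hsub v).trans (H₁ v v T hv le_rfl hvT (by linarith))
    rw [Finset.sum_congr rfl fun m _ => by
      rw [divisorSum_ramp_eq_div_mul hL hv hvL, mul_pow, mul_left_comm], ← Finset.mul_sum]
    refine (mul_le_mul_of_nonneg_left h1 (by positivity)).trans ?_
    have h2 : (v / L) ^ 2 * ((T - v + v) / v) ≤ (T - v + L) / L := by
      rw [show (v / L) ^ 2 * ((T - v + v) / v) = v * T / (L * L) by field_simp; ring,
        div_le_div_iff₀ (by positivity) hL]
      have : v * T ≤ (T - v + L) * L := by nlinarith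
      nlinarith
    rw [mul_left_comm]
    refine (mul_le_mul_of_nonneg_left h2 hC₁.le).trans ?_
    gcongr
    linarith
  rcases le_total (v - L) (T - v + L) with hZ | hZ
  · refine ((hsub L).trans (H₁ L v T hL hvL hvT hZ)).trans ?_
    gcongr
    linarith
  set S := (Finset.Icc 1 ⌊Real.exp T⌋₊).filter (fun n : ℕ => v - L < Real.log n) with hS
  have h1 : ∀ m ∈ (Finset.Icc 1 ⌊Real.exp T⌋₊).filter Squarefree,
      (m : ℝ)⁻¹ * divisorSum (ramp L) v m ^ 2 ≤ (if m = 1 then (1 : ℝ) else 0) +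
        if v - L < Real.log m then
          (m : ℝ)⁻¹ * divisorSum (ramp L) (Real.log m - (v - L)) m ^ 2 else 0 := by
    intro m hm
    rw [Finset.mem_filter] at hm
    by_cases hm1 : m = 1
    · have h2 := (isCutoff_ramp hL).abs_divisorSum_le v 1
      simp only [Nat.divisors_one, Finset.card_singleton, Nat.cast_one] at h2
      have h3 : divisorSum (ramp L) v 1 ^ 2 ≤ 1 := (sq_le_one_iff_abs_le_one _).2 h2
      subst hm1
      rw [if_pos rfl, Nat.cast_one, inv_one, one_mul]
      refine h3.trans (le_add_of_nonneg_right ?_)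
      split_ifs <;> positivity
    · rw [if_neg hm1, zero_add, divisorSum_ramp_sq_eq hL v hm.2 hm1]
      split_ifs with h
      · exact le_rfl
      · rw [divisorSum_ramp_eq_zero hL (by linarith)]
        simp
  have h2 := H₂ L (v - L) (T - v + L) hL (by linarith) hZ S fun n hn => by
    rw [hS, Finset.mem_filter, Finset.mem_Icc] at hn
    refine ⟨hn.1.1, hn.2, ?_⟩
    have h3 : (n : ℝ) ≤ Real.exp T := (Nat.le_floor_iff (Real.exp_pos _).le).1 hn.1.2
    have h4 := Real.log_le_log (by exact_mod_cast hn.1.1) h3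
    rw [Real.log_exp] at h4
    linarith
  refine (Finset.sum_le_sum h1).trans ?_
  refine (Finset.sum_le_sum_of_subset_of_nonneg (Finset.filter_subset _ _) fun m _ _ => by
    split_ifs <;> positivity).trans ?_
  rw [Finset.sum_add_distrib, ← Finset.sum_filter, ← Finset.sum_filter, ← hS]
  have h3 : ∑ m ∈ Finset.Icc 1 ⌊Real.exp T⌋₊ with m = 1, (1 : ℝ) ≤ 1 := by
    rw [Finset.sum_const, nsmul_eq_mul, mul_one]
    exact_mod_cast Finset.card_le_one.2 fun a ha b hb => by
      rw [(Finset.mem_filter.1 ha).2, (Finset.mem_filter.1 hb).2]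
  nlinarith

lemma divisorSum_eq_of_squarefree_dvd (χ : ℝ → ℝ) (v : ℝ) {n r : ℕ} (hn : n ≠ 0) (hr : r ∣ n)
    (h : ∀ d, Squarefree d → d ∣ n → d ∣ r) : divisorSum χ v n = divisorSum χ v r := by
  symm
  refine Finset.sum_subset (Nat.divisors_subset_of_dvd hn hr) fun d hd hd' => ?_
  have h1 : ¬ Squarefree d := fun h1 =>
    hd' (Nat.mem_divisors.2 ⟨h d h1 (Nat.dvd_of_mem_divisors hd), ne_zero_of_dvd_ne_zero hn hr⟩)
  rw [ArithmeticFunction.moebius_eq_zero_of_not_squarefree h1, Int.cast_zero, zero_mul]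

lemma divisorSum_mul_of_coprime (χ : ℝ → ℝ) (v : ℝ) {m k : ℕ} (h : m.Coprime k) :
    divisorSum χ v (m * k) =
      ∑ e ∈ k.divisors, (ArithmeticFunction.moebius e : ℝ) *
        divisorSum χ (v - Real.log e) m := by
  rw [divisorSum, Nat.divisors_mul, ← Finset.image_mul_product,
    Finset.sum_image (by exact_mod_cast h.mul_injOn_divisors), Finset.sum_product_right]
  refine Finset.sum_congr rfl fun e he => ?_
  rw [divisorSum, Finset.mul_sum]
  refine Finset.sum_congr rfl fun d hd => ?_
  have h1 : d.Coprime e := h.of_dvd (Nat.dvd_of_mem_divisors hd) (Nat.dvd_of_mem_divisors he)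
  have hd0 := (Nat.pos_of_mem_divisors hd).ne'
  have he0 := (Nat.pos_of_mem_divisors he).ne'
  rw [ArithmeticFunction.isMultiplicative_moebius.map_mul_of_coprime h1, Nat.cast_mul,
    Real.log_mul (by exact_mod_cast hd0) (by exact_mod_cast he0), sub_sub,
    add_comm (Real.log (d : ℝ))]
  push_cast
  ring

lemma divisorSum_sq_mul_sq_le (χ : ℝ → ℝ) (v : ℝ) {k m : ℕ} (hk : k ≠ 0) (hm : Squarefree m) :
    divisorSum χ v (k ^ 2 * m) ^ 2 ≤
      k.divisors.card * ∑ e ∈ k.divisors, divisorSum χ (v - Real.log e) m ^ 2 := by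
  have hn : k ^ 2 * m ≠ 0 := mul_ne_zero (pow_ne_zero _ hk) hm.ne_zero
  set r := UniqueFactorizationMonoid.radical (k ^ 2 * m) with hr
  have hrn : r ∣ k ^ 2 * m := UniqueFactorizationMonoid.radical_dvd_self
  have hrs : Squarefree r := UniqueFactorizationMonoid.squarefree_radical
  have hd : ∀ d, Squarefree d → d ∣ k ^ 2 * m → d ∣ r := fun d hd hdn =>
    (UniqueFactorizationMonoid.dvd_radical_iff hd.isRadical hn).2 hdn
  obtain ⟨c, hc⟩ := hd m hm (Dvd.intro_left _ rfl)
  have hcop : m.Coprime c := Nat.coprime_of_squarefree_mul (hc ▸ hrs)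
  have hck : c ∣ k := by
    have h1 : c ∣ k ^ 2 :=
      hcop.symm.dvd_of_dvd_mul_right ((Dvd.intro_left m hc.symm).trans hrn)
    exact ((hrs.squarefree_of_dvd (Dvd.intro_left m hc.symm)).dvd_pow_iff_dvd two_ne_zero).1 h1
  have hsub := Nat.divisors_subset_of_dvd hk hck
  rw [divisorSum_eq_of_squarefree_dvd χ v hn hrn hd, hc, divisorSum_mul_of_coprime χ v hcop]
  calc _ ≤ (c.divisors.card : ℝ) * ∑ e ∈ c.divisors, ((ArithmeticFunction.moebius e : ℝ) *
        divisorSum χ (v - Real.log e) m) ^ 2 := sq_sum_le_card_mul_sum_sq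
    _ ≤ (c.divisors.card : ℝ) * ∑ e ∈ c.divisors, divisorSum χ (v - Real.log e) m ^ 2 := by
        refine mul_le_mul_of_nonneg_left (Finset.sum_le_sum fun e _ => ?_) (Nat.cast_nonneg _)
        rw [mul_pow]
        refine mul_le_of_le_one_left (sq_nonneg _) ((sq_le_one_iff_abs_le_one _).2 ?_)
        exact_mod_cast ArithmeticFunction.abs_moebius_le_one
    _ ≤ _ := by
        gcongr

lemma sum_mul_card_divisors_le {f : ℕ → ℝ} (hf : ∀ n, 0 ≤ f n) (Y : ℕ) :
    ∑ n ∈ Finset.Icc 1 Y, f n * n.divisors.card ≤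
      ∑ a ∈ Finset.Icc 1 Y, ∑ b ∈ Finset.Icc 1 Y, f (a * b) := by
  have h1 := sum_sum_mul_eq_sum_divisorsAntidiagonal Y
    (fun a b => if a * b ≤ Y then f (a * b) else 0) (fun a b h => if_neg (by omega))
  have h2 : ∑ n ∈ Finset.Icc 1 Y, f n * n.divisors.card = ∑ n ∈ Finset.Icc 1 Y,
      ∑ p ∈ n.divisorsAntidiagonal, if p.1 * p.2 ≤ Y then f (p.1 * p.2) else 0 := by
    refine Finset.sum_congr rfl fun n hn => ?_
    have h3 : ∀ p ∈ n.divisorsAntidiagonal, (if p.1 * p.2 ≤ Y then f (p.1 * p.2) else 0) =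
        f n := by
      intro p hp
      rw [(Nat.mem_divisorsAntidiagonal.1 hp).1, if_pos (Finset.mem_Icc.1 hn).2]
    rw [Finset.sum_congr rfl h3, Finset.sum_const, ← Nat.map_div_right_divisors, Finset.card_map,
      nsmul_eq_mul, mul_comm]
  rw [h2, ← h1]
  refine Finset.sum_le_sum fun a _ => Finset.sum_le_sum fun b _ => ?_
  split_ifs
  · exact le_rfl
  · exact hf _

lemma exists_sum_card_divisors_sq_mul_inv_sq_le : ∃ C : ℝ, 0 < C ∧ ∀ Y : ℕ,
    ∑ k ∈ Finset.Icc 1 Y, (k.divisors.card : ℝ) ^ 2 * ((k : ℝ) ^ 2)⁻¹ ≤ C := by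
  have hs : Summable fun k : ℕ => ((k : ℝ) ^ 2)⁻¹ :=
    Real.summable_nat_pow_inv.2 one_lt_two
  have h0 : ∀ k : ℕ, 0 ≤ ((k : ℝ) ^ 2)⁻¹ := fun k => by positivity
  set K := ∑' k : ℕ, ((k : ℝ) ^ 2)⁻¹ with hK
  have hsum : ∀ Y : ℕ, ∑ k ∈ Finset.Icc 1 Y, ((k : ℝ) ^ 2)⁻¹ ≤ K := fun Y =>
    hs.sum_le_tsum _ fun k _ => h0 k
  have hK1 : 1 ≤ K := by simpa using hsum 1
  refine ⟨(K ^ 2) ^ 2, by positivity, fun Y => ?_⟩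
  have h1 : ∑ k ∈ Finset.Icc 1 Y, ((k : ℝ) ^ 2)⁻¹ * k.divisors.card ≤ K ^ 2 := by
    refine (sum_mul_card_divisors_le h0 Y).trans ?_
    simp only [Nat.cast_mul, mul_pow, mul_inv]
    rw [← Finset.sum_mul_sum, ← sq]
    have := hsum Y
    gcongr
  calc _ = ∑ k ∈ Finset.Icc 1 Y, (((k : ℝ) ^ 2)⁻¹ * k.divisors.card) * k.divisors.card :=
        Finset.sum_congr rfl fun k _ => by ring
    _ ≤ ∑ a ∈ Finset.Icc 1 Y, ∑ b ∈ Finset.Icc 1 Y,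
          (((a * b : ℕ) : ℝ) ^ 2)⁻¹ * (a * b).divisors.card :=
        sum_mul_card_divisors_le (f := fun k : ℕ => ((k : ℝ) ^ 2)⁻¹ * k.divisors.card)
          (fun k => by positivity) Y
    _ ≤ ∑ a ∈ Finset.Icc 1 Y, ∑ b ∈ Finset.Icc 1 Y,
          (((a : ℝ) ^ 2)⁻¹ * a.divisors.card) * (((b : ℝ) ^ 2)⁻¹ * b.divisors.card) := by
        refine Finset.sum_le_sum fun a _ => Finset.sum_le_sum fun b _ => ?_
        have h2 : ((a * b).divisors.card : ℝ) ≤ a.divisors.card * b.divisors.card := by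
          rw [Nat.divisors_mul]
          exact_mod_cast Finset.card_mul_le
        calc _ ≤ (((a * b : ℕ) : ℝ) ^ 2)⁻¹ * (a.divisors.card * b.divisors.card : ℝ) := by
              gcongr
          _ = _ := by
              push_cast
              rw [mul_pow, mul_inv]
              ring
    _ ≤ _ := by
        rw [← Finset.sum_mul_sum, ← sq]
        exact pow_le_pow_left₀ (Finset.sum_nonneg fun k _ => by positivity) h1 2

lemma sum_Icc_le_sum_sum_sq_mul_squarefree {f : ℕ → ℝ} {G : ℕ → ℕ → ℝ} (N : ℕ)
    (hG : ∀ k m, 0 ≤ G k m)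
    (hf : ∀ k m, k ≠ 0 → Squarefree m → f (k ^ 2 * m) ≤ G k m) :
    ∑ n ∈ Finset.Icc 1 N, f n ≤ ∑ k ∈ Finset.Icc 1 N,
      ∑ m ∈ Finset.Icc 1 N with Squarefree m ∧ k ^ 2 * m ≤ N, G k m := by
  classical
  set P := (Finset.Icc 1 N ×ˢ Finset.Icc 1 N).filter
    (fun p : ℕ × ℕ => Squarefree p.2 ∧ p.1 ^ 2 * p.2 ≤ N) with hP
  have h1 : ∀ n ∈ Finset.Icc 1 N, f n ≤
      ∑ p ∈ P with p.1 ^ 2 * p.2 = n, G p.1 p.2 := by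
    intro n hn
    rw [Finset.mem_Icc] at hn
    obtain ⟨m, k, hkm, hm⟩ := Nat.sq_mul_squarefree n
    have hk : k ≠ 0 := by
      rintro rfl
      rw [zero_pow two_ne_zero, zero_mul] at hkm
      omega
    have hm0 := hm.ne_zero
    have hk1 : 1 ≤ k ^ 2 := Nat.one_le_iff_ne_zero.2 (pow_ne_zero _ hk)
    have hkk : k ≤ k ^ 2 := Nat.le_self_pow two_ne_zero k
    have hmem : (k, m) ∈ P.filter (fun p => p.1 ^ 2 * p.2 = n) := by
      simp only [hP, Finset.mem_filter, Finset.mem_product, Finset.mem_Icc]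
      refine ⟨⟨⟨⟨by omega, ?_⟩, by omega, ?_⟩, hm, by omega⟩, hkm⟩
      · nlinarith [Nat.one_le_iff_ne_zero.2 hm0]
      · nlinarith
    rw [← hkm] at hmem ⊢
    exact (hf k m hk hm).trans (Finset.single_le_sum
      (f := fun p : ℕ × ℕ => G p.1 p.2) (fun p _ => hG _ _) hmem)
  refine (Finset.sum_le_sum h1).trans ?_
  rw [Finset.sum_fiberwise_of_maps_to fun p hp => ?_]
  · rw [hP, Finset.sum_filter, Finset.sum_product]
    exact le_of_eq (Finset.sum_congr rfl fun k _ => (Finset.sum_filter _ _).symm)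
  · simp only [hP, Finset.mem_filter, Finset.mem_product, Finset.mem_Icc] at hp
    rw [Finset.mem_Icc]
    have := Nat.mul_pos (pow_pos hp.1.1.1 2) hp.1.2.1
    omega

lemma exists_sum_inv_mul_divisorSum_ramp_sq_le : ∃ C : ℝ, 0 < C ∧ ∀ L v T : ℝ, 0 < L →
    v ≤ T → ∑ n ∈ Finset.Icc 1 ⌊Real.exp T⌋₊,
      (n : ℝ)⁻¹ * divisorSum (ramp L) v n ^ 2 ≤ C * ((T - v + L) / L) := by
  obtain ⟨C₁, hC₁, H₁⟩ := exists_sum_squarefree_inv_mul_divisorSum_sq_le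
  obtain ⟨C₂, hC₂, H₂⟩ := exists_sum_card_divisors_sq_mul_inv_sq_le
  refine ⟨C₁ * C₂, by positivity, fun L v T hL hvT => ?_⟩
  set N := ⌊Real.exp T⌋₊ with hN
  have hZ : 0 ≤ (T - v + L) / L := div_nonneg (by linarith) hL.le
  have h1 := sum_Icc_le_sum_sum_sq_mul_squarefree
    (f := fun n => (n : ℝ)⁻¹ * divisorSum (ramp L) v n ^ 2)
    (G := fun k m => (k.divisors.card : ℝ) * ((k : ℝ) ^ 2)⁻¹ *
      ∑ e ∈ k.divisors, (m : ℝ)⁻¹ * divisorSum (ramp L) (v - Real.log e) m ^ 2) N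
    (fun k m => by positivity)
    (fun k m hk hm => by
      have := divisorSum_sq_mul_sq_le (ramp L) v hk hm
      rw [← Finset.mul_sum]
      refine (mul_le_mul_of_nonneg_left this (by positivity)).trans (le_of_eq ?_)
      push_cast
      rw [mul_inv]
      ring)
  have h2 : ∀ k ∈ Finset.Icc 1 N, ∀ e ∈ k.divisors,
      ∑ m ∈ Finset.Icc 1 N with Squarefree m ∧ k ^ 2 * m ≤ N,
        (m : ℝ)⁻¹ * divisorSum (ramp L) (v - Real.log e) m ^ 2 ≤
      C₁ * ((T - v + L) / L) := by
    intro k hk e he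
    have hk1 : 1 ≤ k := (Finset.mem_Icc.1 hk).1
    have hk0 : (0 : ℝ) < k := by exact_mod_cast hk1
    have he0 : 0 < e := Nat.pos_of_mem_divisors he
    have hek : Real.log e ≤ Real.log k := Real.log_le_log (by exact_mod_cast he0)
      (by exact_mod_cast Nat.divisor_le he)
    have hlk : 0 ≤ Real.log k := Real.log_nonneg (by exact_mod_cast hk1)
    set T' := max (T - 2 * Real.log k) (v - Real.log e) with hT'
    have h3 := H₁ L (v - Real.log e) T' hL (le_max_right _ _)
    have h4 : T' - (v - Real.log e) ≤ T - v := by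
      rw [sub_le_iff_le_add]
      exact max_le (by linarith) (by linarith)
    refine (Finset.sum_le_sum_of_subset_of_nonneg ?_ fun m _ _ => by positivity).trans
      (h3.trans ?_)
    · intro m hm
      simp only [Finset.mem_filter, Finset.mem_Icc] at hm ⊢
      refine ⟨⟨hm.1.1, Nat.le_floor ?_⟩, hm.2.1⟩
      have h5 : ((k ^ 2 * m : ℕ) : ℝ) ≤ Real.exp T :=
        (Nat.le_floor_iff (Real.exp_pos _).le).1 hm.2.2
      push_cast at h5
      refine le_trans ?_ (Real.exp_le_exp.2 (le_max_left _ _))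
      rw [Real.exp_sub, show 2 * Real.log k = Real.log ((k : ℝ) ^ 2) by
        rw [Real.log_pow]; norm_num, Real.exp_log (by positivity), le_div_iff₀ (by positivity)]
      linarith
    · gcongr
  refine h1.trans ?_
  calc _ ≤ ∑ k ∈ Finset.Icc 1 N,
        (k.divisors.card : ℝ) ^ 2 * ((k : ℝ) ^ 2)⁻¹ * (C₁ * ((T - v + L) / L)) := by
        refine Finset.sum_le_sum fun k hk => ?_
        rw [← Finset.mul_sum, Finset.sum_comm]
        refine (mul_le_mul_of_nonneg_left (Finset.sum_le_card_nsmul _ _ _ (h2 k hk))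
          (by positivity)).trans (le_of_eq ?_)
        rw [nsmul_eq_mul]
        ring
    _ ≤ C₂ * (C₁ * ((T - v + L) / L)) := by
        rw [← Finset.sum_mul]
        exact mul_le_mul_of_nonneg_right (H₂ N) (by positivity)
    _ = _ := by ring

lemma selbergM_eq_ramp {w y : ℝ} (hw : 0 < w) (hwy : w < y) {d : ℕ} (hd : 0 < d) :
    selbergM w y d = ramp (Real.log (y / w)) (Real.log y - Real.log d) := by
  have hd0 : (0 : ℝ) < d := by exact_mod_cast hd
  have hy : 0 < y := hw.trans hwy
  have hL : 0 < Real.log (y / w) := Real.log_pos ((one_lt_div hw).2 hwy)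
  have hLe : Real.log (y / w) = Real.log y - Real.log w := Real.log_div hy.ne' hw.ne'
  rw [selbergM, ramp]
  split_ifs with h1 h2
  · have := Real.log_le_log hd0 h1
    rw [min_eq_left ((one_le_div hL).2 (by linarith)), max_eq_right zero_le_one]
  · have h3 := Real.log_le_log hd0 h2
    have h4 := Real.log_le_log hw (not_le.1 h1).le
    rw [min_eq_right ((div_le_one hL).2 (by linarith)),
      max_eq_right (div_nonneg (by linarith) hL.le), Real.log_div hy.ne' hd0.ne']
  · have := Real.log_le_log hy (not_le.1 h2).le
    rw [max_eq_left ((min_le_right _ _).trans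
      (div_nonpos_of_nonpos_of_nonneg (by linarith) hL.le))]

lemma selbergDelta_eq_divisorSum {w y : ℝ} (hw : 0 < w) (hwy : w < y) (n : ℕ) :
    selbergDelta w y n = divisorSum (ramp (Real.log (y / w))) (Real.log y) n := by
  refine Finset.sum_congr rfl fun d hd => ?_
  rw [selbergLambda, selbergM_eq_ramp hw hwy (Nat.pos_of_mem_divisors hd)]

/-- Graham's lemma.  There is an absolute constant `C > 0` such that
for all real parameters `1 ≤ w < y`, every real `α` with `1/2 < α < 1`, and every real
`x ≥ y`, one has `∑_{n ≤ x} Δ(n)²·n^{1−2α} ≤ C·(log(x/w)/log(y/w))·x^{2−2α}`. -/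
theorem stmt6 :
    ∃ C : ℝ, 0 < C ∧
      ∀ w y α x : ℝ, 1 ≤ w → w < y → 1 / 2 < α → α < 1 → y ≤ x →
        ∑ n ∈ Finset.Icc 1 (Nat.floor x),
            selbergDelta w y n ^ 2 * (n : ℝ) ^ (1 - 2 * α) ≤
          C * (Real.log (x / w) / Real.log (y / w)) * x ^ (2 - 2 * α) := by
  obtain ⟨C, hC, H⟩ := exists_sum_inv_mul_divisorSum_ramp_sq_le
  refine ⟨C, hC, fun w y α x hw hwy hα hα1 hyx => ?_⟩
  have hw0 : 0 < w := by linarith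
  have hy0 : 0 < y := by linarith
  have hx0 : 0 < x := by linarith
  have hL : 0 < Real.log (y / w) := Real.log_pos ((one_lt_div hw0).2 hwy)
  have h1 := H (Real.log (y / w)) (Real.log y) (Real.log x) hL (Real.log_le_log hy0 hyx)
  rw [Real.exp_log hx0, show Real.log x - Real.log y + Real.log (y / w) = Real.log (x / w) by
    rw [Real.log_div hy0.ne' hw0.ne', Real.log_div hx0.ne' hw0.ne']; ring] at h1
  refine le_trans ?_ (mul_le_mul_of_nonneg_right h1 (Real.rpow_nonneg hx0.le _))
  rw [Finset.sum_mul]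
  refine Finset.sum_le_sum fun n hn => ?_
  rw [Finset.mem_Icc] at hn
  have hn0 : (0 : ℝ) < n := by exact_mod_cast hn.1
  have hnx : (n : ℝ) ≤ x := (Nat.le_floor_iff hx0.le).1 hn.2
  have h2 : (n : ℝ) ^ (1 - 2 * α) ≤ (n : ℝ)⁻¹ * x ^ (2 - 2 * α) := by
    rw [show 1 - 2 * α = -1 + (2 - 2 * α) by ring, Real.rpow_add hn0, Real.rpow_neg_one]
    exact mul_le_mul_of_nonneg_left (Real.rpow_le_rpow hn0.le hnx (by linarith)) (by positivity)
  rw [selbergDelta_eq_divisorSum hw0 hwy]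
  calc _ ≤ divisorSum (ramp (Real.log (y / w))) (Real.log y) n ^ 2 *
        ((n : ℝ)⁻¹ * x ^ (2 - 2 * α)) := mul_le_mul_of_nonneg_left h2 (sq_nonneg _)
    _ = _ := by ring
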